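/- arXiv:2204.05489 — 3 statements merged into one kernel-verified Lean document; each statement's English description precedes it below -/
import Mathlib

section
/- Let G be a unicyclic graph whose unique cycle is the odd cycle C_{2n+1} = (x_1,…,x_{2n+1}) (n ≥ 1), let I = I(G) be its edge ideal, c = x_1⋯x_{2n+1}, and l = |E(G)| − (2n+1). For j ≥ n+1 let 𝒢_j denote the set of minimal monomial generators of I^j that are not a multiple of any minimal monomial generator of I^{j−(n+1)}·(c), and for 0 ≤ j ≤ n let 𝒢_j denote the full set of minimal monomial generators of I^j (so |𝒢_j| = ((2n+1+l) multichoose j)). Then for every s = k(n+1) + r with k ≥ 1 and 0 ≤ r ≤ n, one has sdefect(I, s) = Σ_{i=0}^{k−1} |𝒢_{i(n+1)+r}|. -/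
open MvPolynomial

noncomputable section

/-- The edge ideal of a simple graph: `I(G) = ⟨X_u · X_v : {u,v} ∈ E(G)⟩`. -/
def edgeIdeal (𝕜 : Type) [Field 𝕜] {V : Type} (G : SimpleGraph V) :
    Ideal (MvPolynomial V 𝕜) :=
  Ideal.span {p | ∃ u v : V, G.Adj u v ∧ p = X u * X v}

/-- `G` is a unicyclic graph (connected with exactly one cycle, equivalently connected with as
many edges as vertices) whose unique cycle is the odd cycle `C_{2n+1}` on the vertices `x j`. -/
structure IsUnicyclicOddCycle {V : Type} [Fintype V] (G : SimpleGraph V) (n : ℕ)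
    (x : ZMod (2 * n + 1) → V) : Prop where
  connected : G.Connected
  edge_count : G.edgeSet.ncard = Fintype.card V
  inj : Function.Injective x
  adj_iff : ∀ i j : ZMod (2 * n + 1), G.Adj (x i) (x j) ↔ (j = i + 1 ∨ i = j + 1)

/-- `f` is a minimal monomial generator of the monomial ideal `J`: it is a monic monomial
belonging to `J` such that no monic monomial of `J` properly divides it. -/
def IsMinMonomialGen {𝕜 : Type} [Field 𝕜] {V : Type} (J : Ideal (MvPolynomial V 𝕜))
    (f : MvPolynomial V 𝕜) : Prop :=
  (∃ m : V →₀ ℕ, f = monomial m 1) ∧ f ∈ J ∧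
    ∀ g : MvPolynomial V 𝕜, (∃ m : V →₀ ℕ, g = monomial m 1) → g ∈ J → g ∣ f → g = f

def localizationComap {R : Type} [CommRing R] (p : Ideal R) (hp : p.IsPrime) (J : Ideal R) :
    Ideal R :=
  letI := hp
  Ideal.comap (algebraMap R (Localization p.primeCompl))
    (Ideal.map (algebraMap R (Localization p.primeCompl)) J)

/-- The `s`-th symbolic power `I^{(s)} = ⋂_{p ∈ Ass(R/I)} (I^s R_p ∩ R)`. -/
def symbolicPower {R : Type} [CommRing R] (I : Ideal R) (s : ℕ) : Ideal R :=
  sInf {J : Ideal R | ∃ (p : Ideal R) (hp : p.IsPrime),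
    p ∈ associatedPrimes R (R ⧸ I) ∧ J = localizationComap p hp (I ^ s)}

/-- The `s`-th symbolic defect of `I`: the minimal number of generators of the module
`I^{(s)}/I^s`, i.e. the least `m` such that `I^{(s)} = I^s + (f_1, …, f_m)` for some
`f_1, …, f_m ∈ I^{(s)}`. -/
def sdefect {R : Type} [CommRing R] (I : Ideal R) (s : ℕ) : ℕ :=
  sInf {m : ℕ | ∃ S : Finset R, S.card = m ∧ (↑S : Set R) ⊆ (symbolicPower I s : Set R) ∧
    I ^ s ⊔ Ideal.span (↑S : Set R) = symbolicPower I s}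

/-- The sets `𝒢_j`: for `j ≤ n`, all minimal monomial generators of `I^j`; for `j ≥ n+1`, the
minimal monomial generators of `I^j` not divisible by any minimal monomial generator of
`I^{j-(n+1)}·(c)`. -/
def GSet (𝕜 : Type) [Field 𝕜] {V : Type} (I : Ideal (MvPolynomial V 𝕜))
    (c : MvPolynomial V 𝕜) (n j : ℕ) : Set (MvPolynomial V 𝕜) :=
  if j ≤ n then {f | IsMinMonomialGen (I ^ j) f}
  else {f | IsMinMonomialGen (I ^ j) f ∧
    ¬ ∃ g : MvPolynomial V 𝕜,
      IsMinMonomialGen (I ^ (j - (n + 1)) * Ideal.span {c}) g ∧ g ∣ f}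

section
theorem UC_konig {α β : Type} [Fintype α] [Fintype β] [DecidableEq α] [DecidableEq β]
    (H : α → β → Prop) : ∀ (M : ℕ) (wa : α → ℕ) (wb : β → ℕ) (s : ℕ),
    (∑ a, wa a = M) →
    (∀ (S : Finset α) (T : Finset β), (∀ a b, H a b → a ∈ S ∨ b ∈ T) →
      s ≤ ∑ a ∈ S, wa a + ∑ b ∈ T, wb b) →
    ∃ y : α → β → ℕ, (∀ a b, y a b ≠ 0 → H a b) ∧ (∀ a, ∑ b, y a b ≤ wa a) ∧
      (∀ b, ∑ a, y a b ≤ wb b) ∧ ∑ a, ∑ b, y a b = s := by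
  classical
  intro M
  induction M with
  | zero =>
    intro wa wb s hM hc
    have h := hc Finset.univ ∅ (by simp)
    rw [hM] at h
    simp at h
    subst h
    exact ⟨fun _ _ => 0, by simp⟩
  | succ M ih =>
    intro wa wb s hM hc
    obtain ⟨u, hu⟩ : ∃ u, 0 < wa u := by
      by_contra! hcon
      have : ∑ a, wa a = 0 := Finset.sum_eq_zero (fun a _ => by simpa using hcon a)
      omega
    rcases Nat.eq_zero_or_pos s with rfl | hs
    · exact ⟨fun _ _ => 0, by simp⟩
    let wa' : α → ℕ := fun a => wa a - if a = u then 1 else 0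
    have hwa : ∀ a, wa a = wa' a + if a = u then 1 else 0 := by
      intro a
      simp only [wa']
      split_ifs with h
      · subst h; omega
      · omega
    have hsa : ∀ S : Finset α, ∑ a ∈ S, wa a = ∑ a ∈ S, wa' a + if u ∈ S then 1 else 0 := by
      intro S
      rw [Finset.sum_congr rfl (fun a _ => hwa a), Finset.sum_add_distrib, Finset.sum_ite_eq']
    have hM' : ∑ a, wa' a = M := by
      have := hsa Finset.univ
      simp at this
      omega
    by_cases h1 : ∀ (S : Finset α) (T : Finset β), (∀ a b, H a b → a ∈ S ∨ b ∈ T) →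
      s ≤ ∑ a ∈ S, wa' a + ∑ b ∈ T, wb b
    · obtain ⟨y, hy1, hy2, hy3, hy4⟩ := ih wa' wb s hM' h1
      exact ⟨y, hy1, fun a => (hy2 a).trans (by have := hwa a; omega), hy3, hy4⟩
    push Not at h1
    obtain ⟨S0, T0, hc0, hlt0⟩ := h1
    have hS0 := hsa S0
    have hge0 := hc S0 T0 hc0
    have hu0 : u ∈ S0 := by
      by_contra h
      simp only [h, if_false] at hS0
      omega
    simp only [hu0, if_true] at hS0
    by_cases h2 : ∃ b, H u b ∧ 0 < wb b ∧ ∀ (S : Finset α) (T : Finset β),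
      (∀ a b, H a b → a ∈ S ∨ b ∈ T) →
      s - 1 ≤ ∑ a ∈ S, wa' a + ∑ b' ∈ T, (wb b' - if b' = b then 1 else 0)
    · obtain ⟨b, hub, hb, h3⟩ := h2
      obtain ⟨y, hy1, hy2, hy3, hy4⟩ := ih wa' _ (s - 1) hM' h3
      refine ⟨fun a b' => y a b' + if a = u ∧ b' = b then 1 else 0, ?_, ?_, ?_, ?_⟩
      · intro a b' h
        by_cases hab : a = u ∧ b' = b
        · rw [hab.1, hab.2]; exact hub
        · simp only [hab, if_false, add_zero] at h
          exact hy1 a b' h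
      · intro a
        rw [Finset.sum_add_distrib, hwa a]
        refine add_le_add (hy2 a) ?_
        by_cases hau : a = u <;> simp [hau]
      · intro b'
        rw [Finset.sum_add_distrib]
        have := hy3 b'
        by_cases hbb : b' = b
        · subst hbb
          simp at this ⊢
          omega
        · simp [hbb] at this ⊢
          omega
      · simp only [Finset.sum_add_distrib]
        rw [hy4]
        have : ∑ a : α, ∑ b' : β, (if a = u ∧ b' = b then 1 else 0) = 1 := by
          rw [Finset.sum_eq_single u]
          · simp
          · intro a _ h; simp [h]
          · simp
        omega
    · exfalso
      push Not at h2
      have key : ∀ F : Finset β, (∀ b ∈ F, H u b ∧ 0 < wb b) → ∃ (S : Finset α) (T : Finset β),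
          (∀ a b, H a b → a ∈ S ∨ b ∈ T) ∧ u ∈ S ∧ F ⊆ T ∧
          ∑ a ∈ S, wa a + ∑ b ∈ T, wb b ≤ s := by
        intro F
        induction F using Finset.induction_on with
        | empty =>
          intro _
          exact ⟨S0, T0, hc0, hu0, by simp, by omega⟩
        | insert b F hbF ihF =>
          intro hF
          obtain ⟨S, T, hST, huS, hFT, hw⟩ := ihF (fun b' hb' => hF b' (by simp [hb']))
          obtain ⟨hub, hb⟩ := hF b (by simp)
          obtain ⟨S', T', hST', hlt⟩ := h2 b hub hb
          have hsb : ∑ b' ∈ T', wb b' = ∑ b' ∈ T', (wb b' - if b' = b then 1 else 0)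
              + if b ∈ T' then 1 else 0 := by
            rw [← Finset.sum_ite_eq' T' b (fun _ => 1), ← Finset.sum_add_distrib]
            refine Finset.sum_congr rfl (fun b' _ => ?_)
            split_ifs with h
            · subst h; omega
            · omega
          have hS' := hsa S'
          have hge := hc S' T' hST'
          have huS' : u ∈ S' := by
            by_contra h
            simp only [h, if_false] at hS'
            split_ifs at hsb <;> omega
          have hbT' : b ∈ T' := by
            by_contra h
            simp only [h, if_false] at hsb
            split_ifs at hS' <;> omega
          simp only [huS', hbT', if_true] at hS' hsb
          refine ⟨S ∩ S', T ∪ T', ?_, by simp [huS, huS'], ?_, ?_⟩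
          · intro a b' hab
            have := hST a b' hab
            have := hST' a b' hab
            simp only [Finset.mem_inter, Finset.mem_union]
            tauto
          · intro b' hb'
            rcases Finset.mem_insert.1 hb' with rfl | h
            · simp [hbT']
            · exact Finset.mem_union_left _ (hFT h)
          · have hoth := hc (S ∪ S') (T ∩ T') (by
              intro a b' hab
              have := hST a b' hab
              have := hST' a b' hab
              simp only [Finset.mem_inter, Finset.mem_union]
              tauto)
            have e1 := Finset.sum_union_inter (s₁ := S) (s₂ := S') (f := wa)
            have e2 := Finset.sum_union_inter (s₁ := T) (s₂ := T') (f := wb)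
            omega
      obtain ⟨S, T, hST, huS, hFT, hw⟩ :=
        key (Finset.univ.filter (fun b => H u b ∧ 0 < wb b)) (by simp)
      have hfin := hc (S.erase u) (T ∪ Finset.univ.filter (fun b => H u b)) (by
        intro a b hab
        by_cases hau : a = u
        · subst hau; right; simp [hab]
        · rcases hST a b hab with h | h
          · left; simp [hau, h]
          · right; simp [h])
      have e1 := Finset.add_sum_erase S wa huS
      have e2 : ∑ b ∈ T ∪ Finset.univ.filter (fun b => H u b), wb b = ∑ b ∈ T, wb b := by
        symm
        apply Finset.sum_subset Finset.subset_union_left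
        intro b hb hbT
        by_contra hne
        apply hbT
        apply hFT
        simp only [Finset.mem_union, Finset.mem_filter, Finset.mem_univ, true_and] at hb ⊢
        exact ⟨hb.resolve_left hbT, by omega⟩
      omega

end

section
structure UCSetup {V : Type} (T : SimpleGraph V) (n : ℕ) (p : ℕ → V) (χ : V → Bool) : Prop where
  col : ∀ a b, T.Adj a b → χ a ≠ χ b
  inj : ∀ i j, i ≤ 2 * n → j ≤ 2 * n → p i = p j → i = j
  cpe : ∀ i, i ≤ n → χ (p (2 * i)) = true
  cut : ∀ k, k < n → ∃ L : Finset V, p 0 ∈ L ∧ p (2 * n) ∉ L ∧ p (2 * k) ∈ L ∧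
    p (2 * k + 1) ∉ L ∧
    ∀ a b, T.Adj a b → a ∈ L → b ∉ L → a = p (2 * k) ∧ b = p (2 * k + 1)

def UCCover {V : Type} (T : SimpleGraph V) (C : Finset V) : Prop :=
  ∀ a b, T.Adj a b → a ∈ C ∨ b ∈ C

theorem UC_sum_mix {V : Type} [DecidableEq V] (P Q : Finset V) (q : V → Prop)
    [DecidablePred q] (f : V → ℕ) :
    ∑ v ∈ P.filter q ∪ Q.filter (fun v => ¬ q v), f v +
      ∑ v ∈ Q.filter q ∪ P.filter (fun v => ¬ q v), f v = ∑ v ∈ P, f v + ∑ v ∈ Q, f v := by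
  have hd : ∀ A B : Finset V, Disjoint (A.filter q) (B.filter (fun v => ¬ q v)) := by
    intro A B
    rw [Finset.disjoint_left]
    intro a ha hb
    simp at ha hb
    exact hb.2 ha.2
  have e1 := Finset.sum_filter_add_sum_filter_not P q f
  have e2 := Finset.sum_filter_add_sum_filter_not Q q f
  rw [Finset.sum_union (hd _ _), Finset.sum_union (hd _ _), ← e1, ← e2]
  ring

theorem UC_bip_cover {V : Type} [DecidableEq V] {T : SimpleGraph V} {χ : V → Bool}
    (col : ∀ a b, T.Adj a b → χ a ≠ χ b) (S S' : Finset V)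
    (hSS : ∀ a b, T.Adj a b → χ a = true → a ∈ S ∨ b ∈ S') :
    UCCover T (S.filter (fun v => χ v = true) ∪ S'.filter (fun v => ¬ χ v = true)) := by
  intro a b hab
  have hne := col a b hab
  simp only [Finset.mem_union, Finset.mem_filter]
  by_cases ha : χ a = true
  · have hb : ¬ χ b = true := fun hb => hne (ha.trans hb.symm)
    rcases hSS a b hab ha with h | h
    · exact Or.inl (Or.inl ⟨h, ha⟩)
    · exact Or.inr (Or.inr ⟨h, hb⟩)
  · have hb : χ b = true := by
      revert hne ha
      cases χ a <;> cases χ b <;> simp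
    rcases hSS b a hab.symm hb with h | h
    · exact Or.inr (Or.inl ⟨h, hb⟩)
    · exact Or.inl (Or.inr ⟨h, ha⟩)

theorem UC_load {V : Type} [Fintype V] [DecidableEq V] (y : V → V → ℕ) (u1 : V → ℕ)
    (D : Finset V) (e1 e2 : V) (hload : ∀ v, ∑ b, y v b + ∑ a, y a v ≤ u1 v)
    (hd : ∀ a b, y a b ≠ 0 → (a ∈ D ∨ b ∈ D) ∨ (a = e1 ∧ b = e2)) :
    ∑ a, ∑ b, y a b ≤ ∑ v ∈ D, u1 v + y e1 e2 := by
  have hpt : ∀ a b, y a b ≤ (if a ∈ D then y a b else 0) + (if b ∈ D then y a b else 0) +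
      (if a = e1 then if b = e2 then y a b else 0 else 0) := by
    intro a b
    by_cases h0 : y a b = 0
    · simp [h0]
    rcases hd a b h0 with (h | h) | ⟨h, h'⟩
    · simp only [h, if_true]; omega
    · simp only [h, if_true]; omega
    · simp [h, h']
  calc ∑ a, ∑ b, y a b ≤ ∑ a, ∑ b, ((if a ∈ D then y a b else 0) +
        (if b ∈ D then y a b else 0) +
        (if a = e1 then if b = e2 then y a b else 0 else 0)) :=
        Finset.sum_le_sum (fun a _ => Finset.sum_le_sum (fun b _ => hpt a b))
    _ = ∑ v ∈ D, (∑ b, y v b + ∑ a, y a v) + y e1 e2 := by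
        simp only [Finset.sum_add_distrib]
        congr 1
        · congr 1
          · rw [← Finset.sum_subset (Finset.subset_univ D)]
            · exact Finset.sum_congr rfl (fun a ha => by simp [ha])
            · intro a _ ha; simp [ha]
          · rw [Finset.sum_comm, ← Finset.sum_subset (Finset.subset_univ D)]
            · exact Finset.sum_congr rfl (fun a ha => by simp [ha])
            · intro a _ ha; simp [ha]
        · rw [Finset.sum_eq_single e1]
          · simp
          · intro a _ ha; simp [ha]
          · simp
    _ ≤ _ := add_le_add (Finset.sum_le_sum (fun v _ => hload v)) le_rfl

theorem UC_main {V : Type} [Fintype V] [DecidableEq V] {T : SimpleGraph V} {n : ℕ} {p : ℕ → V}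
    {χ : V → Bool} (hn : 1 ≤ n) (h : UCSetup T n p χ) (u : V → ℕ) (N i : ℕ)
    (hG : ∀ C, UCCover T C → (p 0 ∈ C ∨ p (2 * n) ∈ C) → N ≤ ∑ v ∈ C, u v)
    (h2 : ∀ P Q, UCCover T P → UCCover T Q → p 0 ∈ P → p (2 * n) ∈ P → p 0 ∉ Q →
      p (2 * n) ∉ Q → 2 * N ≤ ∑ v ∈ P, u v + ∑ v ∈ Q, u v + i)
    (heq : i = 0 ∨ ∃ P Q, UCCover T P ∧ UCCover T Q ∧ p 0 ∈ P ∧ p (2 * n) ∈ P ∧ p 0 ∉ Q ∧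
      p (2 * n) ∉ Q ∧ 2 * N = ∑ v ∈ P, u v + ∑ v ∈ Q, u v + i) :
    ∃ (α : ℕ) (y : V → V → ℕ), (∀ a b, y a b ≠ 0 → T.Adj a b) ∧
      (α + ∑ a, ∑ b, y a b = N) ∧
      (∀ v, ∑ b, y v b + ∑ a, y a v + (if v = p 0 then α else 0) +
        (if v = p (2 * n) then α else 0) ≤ u v + if v = p 0 then i else 0) ∧
      i ≤ α ∧ ∀ k, k < n → i ≤ y (p (2 * k)) (p (2 * k + 1)) := by
  classical
  have hz : χ (p 0) = true := h.cpe 0 (by omega)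
  have hz' : χ (p (2 * n)) = true := h.cpe n le_rfl
  have hne : p 0 ≠ p (2 * n) := fun e => by
    have := h.inj 0 (2 * n) (by omega) le_rfl e
    omega
  obtain ⟨P0, hP0, hP0min⟩ := Finset.exists_min_image
    (Finset.univ.filter (fun P : Finset V => UCCover T P ∧ p 0 ∈ P ∧ p (2 * n) ∈ P))
    (fun P => ∑ v ∈ P, u v) ⟨Finset.univ, Finset.mem_filter.2
      ⟨Finset.mem_univ _, fun a _ _ => Or.inl (Finset.mem_univ a), Finset.mem_univ _,
        Finset.mem_univ _⟩⟩
  obtain ⟨Q0, hQ0, hQ0min⟩ := Finset.exists_min_image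
    (Finset.univ.filter (fun P : Finset V => UCCover T P ∧ p 0 ∉ P ∧ p (2 * n) ∉ P))
    (fun P => ∑ v ∈ P, u v) ⟨Finset.univ.filter (fun v => v ≠ p 0 ∧ v ≠ p (2 * n)), by
      simp only [Finset.mem_filter, Finset.mem_univ, true_and]
      refine ⟨?_, by simp, by simp⟩
      intro a b hab
      have hc := h.col a b hab
      simp only [Finset.mem_filter, Finset.mem_univ, true_and]
      by_contra hcon
      have ha : χ a = true := by
        by_cases h1 : a = p 0
        · rw [h1, hz]
        · by_cases h2 : a = p (2 * n)
          · rw [h2, hz']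
          · exact absurd (by tauto) hcon
      have hb : χ b = true := by
        by_cases h1 : b = p 0
        · rw [h1, hz]
        · by_cases h2 : b = p (2 * n)
          · rw [h2, hz']
          · exact absurd (by tauto) hcon
      exact hc (ha.trans hb.symm)⟩
  simp only [Finset.mem_filter, Finset.mem_univ, true_and] at hP0 hQ0 hP0min hQ0min
  obtain ⟨hP0c, hP0z, hP0z'⟩ := hP0
  obtain ⟨hQ0c, hQ0z, hQ0z'⟩ := hQ0
  set a0 := ∑ v ∈ Q0, u v with ha0
  set b0 := ∑ v ∈ P0, u v with hb0
  have hb0N : N ≤ b0 := hG P0 hP0c (Or.inl hP0z)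
  have hab : 2 * N ≤ b0 + a0 + i := h2 P0 Q0 hP0c hQ0c hP0z hP0z' hQ0z hQ0z'
  have heq' : i = 0 ∨ 2 * N = b0 + a0 + i := by
    rcases heq with h | ⟨P, Q, hP, hQ, h3, h4, h5, h6, h7⟩
    · exact Or.inl h
    · right
      have e1 := hP0min P ⟨hP, h3, h4⟩
      have e2 := hQ0min Q ⟨hQ, h5, h6⟩
      omega
  obtain ⟨α, hα⟩ : ∃ α, α = N - a0 := ⟨_, rfl⟩
  have hαi : i ≤ α := by omega
  have hins : ∀ z, z ∉ Q0 → (z = p 0 ∨ z = p (2 * n)) → α ≤ u z := by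
    intro z hzQ hzz
    have := hG (insert z Q0) (by
      intro a b hab
      rcases hQ0c a b hab with h | h
      · left; simp [h]
      · right; simp [h]) (by
      rcases hzz with h | h
      · left; simp [h]
      · right; simp [h])
    rw [Finset.sum_insert hzQ] at this
    omega
  have hαz := hins _ hQ0z (Or.inl rfl)
  have hαz' := hins _ hQ0z' (Or.inr rfl)
  let u1 : V → ℕ := fun v => (u v + if v = p 0 then i else 0) - (if v = p 0 then α else 0) -
    (if v = p (2 * n) then α else 0)
  have hu1 : ∀ v, u1 v + (if v = p 0 then α else 0) + (if v = p (2 * n) then α else 0) =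
      u v + if v = p 0 then i else 0 := by
    intro v
    simp only [u1]
    by_cases e1 : v = p 0
    · have e2 : v ≠ p (2 * n) := fun e => hne (e1.symm.trans e)
      simp only [e1, hne, if_true, if_false]
      omega
    · by_cases e2 : v = p (2 * n)
      · simp only [e2, hne.symm, if_true, if_false]
        omega
      · simp [e1, e2]
  have hs1 : ∀ C : Finset V, ∑ v ∈ C, u1 v + (if p 0 ∈ C then α else 0) +
      (if p (2 * n) ∈ C then α else 0) = ∑ v ∈ C, u v + if p 0 ∈ C then i else 0 := by
    intro C
    have := Finset.sum_congr (rfl : C = C) (fun v _ => hu1 v)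
    simpa only [Finset.sum_add_distrib, Finset.sum_ite_eq'] using this
  have hcov : ∀ C, UCCover T C → N - α ≤ ∑ v ∈ C, u1 v := by
    intro C hC
    have e := hs1 C
    by_cases h1 : p 0 ∈ C
    · have := hG C hC (Or.inl h1)
      by_cases h3 : p (2 * n) ∈ C
      · have := hP0min C ⟨hC, h1, h3⟩
        simp only [h1, h3, if_true] at e
        omega
      · simp only [h1, h3, if_true, if_false] at e
        omega
    · by_cases h3 : p (2 * n) ∈ C
      · have := hG C hC (Or.inr h3)
        simp only [h1, h3, if_true, if_false] at e
        omega
      · have := hQ0min C ⟨hC, h1, h3⟩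
        simp only [h1, h3, if_false] at e
        omega
  have hdisj : ∀ A B : Finset V,
      Disjoint (A.filter (fun v => χ v = true)) (B.filter (fun v => ¬ χ v = true)) := by
    intro A B
    rw [Finset.disjoint_left]
    intro a ha hb
    simp only [Finset.mem_filter] at ha hb
    exact hb.2 ha.2
  obtain ⟨y, hy1, hy2, hy3, hy4⟩ := UC_konig (fun a b : V => T.Adj a b ∧ χ a = true) _ u1 u1
    (N - α) rfl (by
      intro S S' hSS
      have hc := hcov (S.filter (fun v => χ v = true) ∪ S'.filter (fun v => ¬ χ v = true))
        (UC_bip_cover h.col S S' (fun a b hab ha => hSS a b ⟨hab, ha⟩))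
      rw [Finset.sum_union (hdisj _ _)] at hc
      refine hc.trans (add_le_add ?_ ?_)
      · exact Finset.sum_le_sum_of_subset (Finset.filter_subset _ _)
      · exact Finset.sum_le_sum_of_subset (Finset.filter_subset _ _))
  have hload : ∀ v, ∑ b, y v b + ∑ a, y a v ≤ u1 v := by
    intro v
    by_cases hv : χ v = true
    · have : ∑ a, y a v = 0 := Finset.sum_eq_zero (fun a _ => by
        by_contra hcon
        have := hy1 a v hcon
        exact h.col a v this.1 (this.2.trans hv.symm))
      have := hy2 v
      omega
    · have : ∑ b, y v b = 0 := Finset.sum_eq_zero (fun b _ => by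
        by_contra hcon
        exact hv (hy1 v b hcon).2)
      have := hy3 v
      omega
  have hαN : α ≤ N := by omega
  refine ⟨α, y, fun a b hab => (hy1 a b hab).1, by omega, ?_, hαi, ?_⟩
  · intro v
    rw [← hu1 v]
    have := hload v
    omega
  intro k hk
  rcases Nat.eq_zero_or_pos i with hi0 | hi
  · omega
  have heq2 : 2 * N = b0 + a0 + i := heq'.resolve_left (by omega)
  obtain ⟨L, hL0, hLn, hLk, hLk', hL⟩ := h.cut k hk
  obtain ⟨P, hP⟩ : ∃ P : Finset V, P = (P0 ∪ Q0).filter (fun v => χ v = true) ∪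
    (P0 ∩ Q0).filter (fun v => ¬ χ v = true) := ⟨_, rfl⟩
  obtain ⟨Q, hQ⟩ : ∃ Q : Finset V, Q = (P0 ∩ Q0).filter (fun v => χ v = true) ∪
    (P0 ∪ Q0).filter (fun v => ¬ χ v = true) := ⟨_, rfl⟩
  have hPc : UCCover T P := by
    rw [hP]
    refine UC_bip_cover h.col _ _ (fun a b hab _ => ?_)
    have h3 := hP0c a b hab
    have h4 := hQ0c a b hab
    rw [Finset.mem_union, Finset.mem_inter]
    clear * - h3 h4
    tauto
  have hQc : UCCover T Q := by
    rw [hQ]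
    refine UC_bip_cover h.col _ _ (fun a b hab _ => ?_)
    have h3 := hP0c a b hab
    have h4 := hQ0c a b hab
    rw [Finset.mem_union, Finset.mem_inter]
    clear * - h3 h4
    tauto
  have hPQ : ∑ v ∈ P, u v + ∑ v ∈ Q, u v = b0 + a0 := by
    have e := UC_sum_mix (P0 ∪ Q0) (P0 ∩ Q0) (fun v => χ v = true) u
    rw [Finset.sum_union_inter] at e
    rw [hP, hQ]
    exact e
  have hzP : p 0 ∈ P := by simp [hP, hz, hP0z]
  have hzP' : p (2 * n) ∈ P := by simp [hP, hz', hP0z']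
  have hzQ : p 0 ∉ Q := by simp [hQ, hz, hQ0z]
  have hzQ' : p (2 * n) ∉ Q := by simp [hQ, hz', hQ0z']
  obtain ⟨D1, hD1⟩ : ∃ D : Finset V, D = P.filter (fun v => v ∈ L) ∪
    Q.filter (fun v => ¬ v ∈ L) := ⟨_, rfl⟩
  obtain ⟨D2, hD2⟩ : ∃ D : Finset V, D = Q.filter (fun v => v ∈ L) ∪
    P.filter (fun v => ¬ v ∈ L) := ⟨_, rfl⟩
  have hDD : ∑ v ∈ D1, u v + ∑ v ∈ D2, u v = b0 + a0 := by
    rw [← hPQ, hD1, hD2]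
    exact UC_sum_mix P Q (fun v => v ∈ L) u
  have hmD1 : ∀ v, v ∈ D1 ↔ (v ∈ P ∧ v ∈ L) ∨ (v ∈ Q ∧ v ∉ L) := by
    intro v; simp [hD1]
  have hmD2 : ∀ v, v ∈ D2 ↔ (v ∈ Q ∧ v ∈ L) ∨ (v ∈ P ∧ v ∉ L) := by
    intro v; simp [hD2]
  have hke : p (2 * k) ∈ P ∨ p (2 * k + 1) ∈ Q ∨ ¬ T.Adj (p (2 * k)) (p (2 * k + 1)) := by
    by_contra! hcon
    obtain ⟨c1, c2, c3⟩ := hcon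
    rcases hQc _ _ c3 with c4 | c4
    · have hck := h.cpe k hk.le
      apply c1
      simp only [hQ, hP, Finset.mem_union, Finset.mem_filter, Finset.mem_inter, hck] at c4 ⊢
      clear * - c4
      tauto
    · exact c2 c4
  have hD1c : UCCover T D1 := by
    intro a b hab
    rw [hmD1, hmD1]
    have hp := hPc a b hab
    have hq := hQc a b hab
    by_cases ha : a ∈ L <;> by_cases hb : b ∈ L
    · clear * - ha hb hp hq
      tauto
    · obtain ⟨rfl, rfl⟩ := hL a b hab ha hb
      clear * - ha hb hke hab
      tauto
    · obtain ⟨rfl, rfl⟩ := hL b a hab.symm hb ha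
      have := hab.symm
      clear * - ha hb hke this
      tauto
    · clear * - ha hb hp hq
      tauto
  have hz1 : p 0 ∈ D1 := (hmD1 _).2 (Or.inl ⟨hzP, hL0⟩)
  have hz2 : p 0 ∉ D2 := fun hh => by
    rcases (hmD2 _).1 hh with hh | hh
    · exact hzQ hh.1
    · exact hh.2 hL0
  have hz2' : p (2 * n) ∈ D2 := (hmD2 _).2 (Or.inr ⟨hzP', hLn⟩)
  have hg1 := hG D1 hD1c (Or.inl hz1)
  have hs2 := hs1 D2
  simp only [hz2, hz2', if_true, if_false] at hs2
  have hbig : ∑ a, ∑ b, y a b ≤ ∑ v ∈ D2, u1 v + y (p (2 * k)) (p (2 * k + 1)) := by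
    refine UC_load y u1 D2 _ _ hload (fun a b h0 => ?_)
    obtain ⟨hab, hχ⟩ := hy1 a b h0
    have hp := hPc a b hab
    have hq := hQc a b hab
    rw [hmD2, hmD2]
    by_cases ha : a ∈ L <;> by_cases hb : b ∈ L
    · clear * - ha hb hp hq
      tauto
    · exact Or.inr (hL a b hab ha hb)
    · exfalso
      obtain ⟨e1, e2⟩ := hL b a hab.symm hb ha
      have hck := h.cpe k hk.le
      rw [← e1] at hck
      exact h.col a b hab (hχ.trans hck.symm)
    · clear * - ha hb hp hq
      tauto
  omega

end

section
open Finsupp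
def UCP {V : Type} (S : Set (V →₀ ℕ)) : ℕ → Set (V →₀ ℕ)
  | 0 => {0}
  | N + 1 => {w | ∃ e ∈ S, ∃ v ∈ UCP S N, w = e + v}

def UCE {V : Type} (G : SimpleGraph V) : Set (V →₀ ℕ) :=
  {w | ∃ a b, G.Adj a b ∧ w = single a 1 + single b 1}

theorem UCP_add {V : Type} {S : Set (V →₀ ℕ)} {a b : ℕ} {v w : V →₀ ℕ}
    (hv : v ∈ UCP S a) (hw : w ∈ UCP S b) : v + w ∈ UCP S (a + b) := by
  induction a generalizing v with
  | zero =>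
    have : v = 0 := hv
    rw [this, zero_add, zero_add]; exact hw
  | succ a ih =>
    obtain ⟨e, he, v', hv', rfl⟩ := hv
    rw [Nat.succ_add]
    exact ⟨e, he, v' + w, ih hv', by rw [add_assoc]⟩

theorem UCP_one {V : Type} {S : Set (V →₀ ℕ)} {e : V →₀ ℕ} (he : e ∈ S) : e ∈ UCP S 1 :=
  ⟨e, he, 0, rfl, by simp⟩

theorem UCP_nsmul {V : Type} {S : Set (V →₀ ℕ)} {e : V →₀ ℕ} (t : ℕ) (he : t ≠ 0 → e ∈ S) :
    t • e ∈ UCP S t := by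
  induction t with
  | zero => simp [UCP]
  | succ t ih =>
    rw [succ_nsmul]
    by_cases ht : t = 0
    · subst ht
      simpa using UCP_one (he (by simp))
    · exact UCP_add (ih (fun _ => he (by simp))) (UCP_one (he (by simp)))

theorem UCP_sum {V ι : Type} {S : Set (V →₀ ℕ)} (F : Finset ι) (y : ι → ℕ) (e : ι → V →₀ ℕ)
    (he : ∀ i ∈ F, y i ≠ 0 → e i ∈ S) : ∑ i ∈ F, y i • e i ∈ UCP S (∑ i ∈ F, y i) := by
  classical
  induction F using Finset.induction_on with
  | empty => simp [UCP]
  | insert i F hi ih =>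
    rw [Finset.sum_insert hi, Finset.sum_insert hi]
    exact UCP_add (UCP_nsmul _ (he i (by simp))) (ih (fun j hj => he j (by simp [hj])))

theorem UCP_weight {V : Type} [Fintype V] {G : SimpleGraph V} (f : V → ℕ) (q : ℕ)
    (hf : ∀ a b, G.Adj a b → q ≤ f a + f b) {N : ℕ} {u : V →₀ ℕ} (hu : u ∈ UCP (UCE G) N) :
    q * N ≤ ∑ v, u v * f v := by
  classical
  induction N generalizing u with
  | zero => simp
  | succ N ih =>
    obtain ⟨e, ⟨a, b, hab, rfl⟩, v', hv', rfl⟩ := hu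
    have h1 := ih hv'
    have h2 := hf a b hab
    simp only [Finsupp.add_apply, add_mul, Finset.sum_add_distrib, Finsupp.single_apply,
      ite_mul, one_mul, zero_mul, Finset.sum_ite_eq, Finset.mem_univ, if_true]
    rw [mul_add, mul_one]
    omega

theorem UCP_degree {V : Type} {G : SimpleGraph V} {N : ℕ} {u : V →₀ ℕ}
    (hu : u ∈ UCP (UCE G) N) : u.degree = 2 * N := by
  induction N generalizing u with
  | zero =>
    have : u = 0 := hu
    simp [this]
  | succ N ih =>
    obtain ⟨e, ⟨a, b, hab, rfl⟩, v', hv', rfl⟩ := hu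
    have h1 := ih hv'
    simp [map_add, h1]
    omega

theorem UCP_finite {V : Type} [Fintype V] (G : SimpleGraph V) (N : ℕ) :
    (UCP (UCE G) N).Finite := by
  have hE : (UCE G).Finite := by
    refine (Set.finite_range (fun ab : V × V => single ab.1 1 + single ab.2 1)).subset ?_
    rintro w ⟨a, b, -, rfl⟩
    exact ⟨(a, b), rfl⟩
  induction N with
  | zero => exact Set.finite_singleton 0
  | succ N ih =>
    refine (Set.Finite.image2 (fun e v => e + v) hE ih).subset ?_
    rintro w ⟨e, he, v, hv, rfl⟩
    exact ⟨e, he, v, hv, rfl⟩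

noncomputable def UCc {V : Type} (n : ℕ) (p : ℕ → V) : V →₀ ℕ := ∑ j ∈ Finset.range (2 * n + 1), single (p j) 1

theorem UCc_eq {V : Type} (n : ℕ) (p : ℕ → V) :
    UCc n p = ∑ k ∈ Finset.range n, (single (p (2 * k)) 1 + single (p (2 * k + 1)) 1)
      + single (p (2 * n)) 1 := by
  unfold UCc
  rw [Finset.sum_range_succ]
  congr 1
  induction n with
  | zero => simp
  | succ n ih =>
    rw [Finset.sum_range_succ, ← ih, show 2 * (n + 1) = 2 * n + 1 + 1 by ring,
      Finset.sum_range_succ, Finset.sum_range_succ, add_assoc]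

theorem UCc_degree {V : Type} (n : ℕ) (p : ℕ → V) : (UCc n p).degree = 2 * n + 1 := by
  simp [UCc, map_sum]

theorem UC_decomp {V : Type} [Fintype V] [DecidableEq V] {T G : SimpleGraph V} {n : ℕ}
    {p : ℕ → V} {χ : V → Bool} (hn : 1 ≤ n) (h : UCSetup T n p χ)
    (hTG : ∀ a b, T.Adj a b → G.Adj a b) (hz : G.Adj (p 0) (p (2 * n)))
    (u : V →₀ ℕ) (N i : ℕ)
    (hG : ∀ C, UCCover T C → (p 0 ∈ C ∨ p (2 * n) ∈ C) → N ≤ ∑ v ∈ C, u v)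
    (h2 : ∀ P Q, UCCover T P → UCCover T Q → p 0 ∈ P → p (2 * n) ∈ P → p 0 ∉ Q →
      p (2 * n) ∉ Q → 2 * N ≤ ∑ v ∈ P, u v + ∑ v ∈ Q, u v + i)
    (heq : i = 0 ∨ ∃ P Q, UCCover T P ∧ UCCover T Q ∧ p 0 ∈ P ∧ p (2 * n) ∈ P ∧ p 0 ∉ Q ∧
      p (2 * n) ∉ Q ∧ 2 * N = ∑ v ∈ P, u v + ∑ v ∈ Q, u v + i) :
    i * (n + 1) ≤ N ∧ ∃ v ∈ UCP (UCE G) (N - i * (n + 1)), v + i • UCc n p ≤ u := by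
  obtain ⟨α, y, hy1, hy2, hy3, hy4, hy5⟩ := UC_main hn h u N i hG h2 heq
  let ind : V × V → ℕ := fun ab => ∑ k ∈ Finset.range n,
    if ab = (p (2 * k), p (2 * k + 1)) then 1 else 0
  have hind : ∀ ab : V × V, i * ind ab ≤ y ab.1 ab.2 := by
    intro ab
    by_cases hex : ∃ k, k < n ∧ ab = (p (2 * k), p (2 * k + 1))
    · obtain ⟨k, hk, rfl⟩ := hex
      have : ind (p (2 * k), p (2 * k + 1)) = 1 := by
        simp only [ind]
        rw [Finset.sum_eq_single k]
        · simp
        · intro j hj hjk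
          rw [if_neg]
          intro e
          have e1 := (Prod.ext_iff.1 e).1
          have := h.inj _ _ (by omega) (by have := Finset.mem_range.1 hj; omega) e1
          omega
        · intro hk'; simp at hk'; omega
      rw [this, mul_one]
      exact hy5 k hk
    · have : ind ab = 0 := Finset.sum_eq_zero (fun k hk => if_neg (fun e =>
        hex ⟨k, Finset.mem_range.1 hk, e⟩))
      simp [this]
  let E : V × V → V →₀ ℕ := fun ab => single ab.1 1 + single ab.2 1
  have hsumE : ∑ ab : V × V, ind ab • E ab =
      ∑ k ∈ Finset.range n, (single (p (2 * k)) 1 + single (p (2 * k + 1)) 1) := by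
    simp only [ind, Finset.sum_smul]
    rw [Finset.sum_comm]
    refine Finset.sum_congr rfl (fun k _ => ?_)
    rw [Finset.sum_eq_single (p (2 * k), p (2 * k + 1))]
    · simp [E]
    · intro ab _ hab; simp [hab]
    · simp
  have hsumI : ∑ ab : V × V, ind ab = n := by
    simp only [ind]
    rw [Finset.sum_comm]
    simp
  have hYdef : ∀ ab : V × V, y ab.1 ab.2 = (y ab.1 ab.2 - i * ind ab) + i * ind ab :=
    fun ab => by have := hind ab; omega
  have hYtot : ∑ ab : V × V, y ab.1 ab.2 = ∑ ab : V × V, (y ab.1 ab.2 - i * ind ab) + i * n := by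
    rw [Finset.sum_congr rfl (fun ab _ => hYdef ab), Finset.sum_add_distrib, ← Finset.mul_sum,
      hsumI]
  have hYE : ∑ ab : V × V, y ab.1 ab.2 • E ab =
      ∑ ab : V × V, (y ab.1 ab.2 - i * ind ab) • E ab +
        i • ∑ k ∈ Finset.range n, (single (p (2 * k)) 1 + single (p (2 * k + 1)) 1) := by
    rw [← hsumE, Finset.smul_sum, ← Finset.sum_add_distrib]
    refine Finset.sum_congr rfl (fun ab _ => ?_)
    conv_lhs => rw [hYdef ab]
    rw [add_smul, mul_smul]
  rw [← Fintype.sum_prod_type'] at hy2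
  have hN : N = (∑ ab : V × V, (y ab.1 ab.2 - i * ind ab) + (α - i)) + i * (n + 1) := by
    rw [mul_add]
    omega
  refine ⟨by omega, ∑ ab : V × V, (y ab.1 ab.2 - i * ind ab) • E ab +
    (α - i) • (single (p 0) 1 + single (p (2 * n)) 1), ?_, ?_⟩
  · rw [show N - i * (n + 1) = ∑ ab : V × V, (y ab.1 ab.2 - i * ind ab) + (α - i) by omega]
    refine UCP_add (UCP_sum _ _ _ ?_) (UCP_nsmul _ (fun _ => ⟨_, _, hz, rfl⟩))
    intro ab _ hne
    exact ⟨ab.1, ab.2, hTG _ _ (hy1 _ _ (by omega)), rfl⟩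
  · have hW : ∑ ab : V × V, y ab.1 ab.2 • E ab + α • (single (p 0) 1 + single (p (2 * n)) 1) ≤
        u + i • single (p 0) 1 := by
      intro v
      have := hy3 v
      have e : (∑ ab : V × V, y ab.1 ab.2 • E ab) v = ∑ b, y v b + ∑ a, y a v := by
        rw [Finsupp.finsetSum_apply]
        simp only [E, Finsupp.smul_apply, Finsupp.add_apply, Finsupp.single_apply, smul_eq_mul,
          mul_add, mul_ite, mul_one, mul_zero]
        rw [Finset.sum_add_distrib, Fintype.sum_prod_type, Fintype.sum_prod_type_right]
        congr 1
        · rw [Finset.sum_eq_single v]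
          · simp
          · intro a _ ha; simp [ha]
          · simp
        · rw [Finset.sum_eq_single v]
          · simp
          · intro a _ ha; simp [ha]
          · simp
      simp only [Finsupp.add_apply, e, Finsupp.smul_apply, Finsupp.single_apply, smul_eq_mul,
        mul_add, mul_ite, mul_one, mul_zero]
      simp only [eq_comm (a := v)] at this
      omega
    rw [hYE] at hW
    rw [UCc_eq]
    obtain ⟨γ, rfl⟩ : ∃ γ, α = γ + i := ⟨α - i, by omega⟩
    rw [Nat.add_sub_cancel]
    intro v
    have := hW v
    simp only [Finsupp.add_apply, Finsupp.smul_apply, smul_eq_mul, smul_add, add_smul] at this ⊢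
    omega

theorem UC_sym {V : Type} [Fintype V] [DecidableEq V] {T G : SimpleGraph V} {n : ℕ}
    {p : ℕ → V} {χ : V → Bool} (hn : 1 ≤ n) (h : UCSetup T n p χ)
    (hTG : ∀ a b, G.Adj a b ↔ T.Adj a b ∨ (a = p 0 ∧ b = p (2 * n)) ∨ (a = p (2 * n) ∧ b = p 0))
    (u : V →₀ ℕ) (N : ℕ)
    (hG : ∀ C, UCCover G C → N ≤ ∑ v ∈ C, u v) :
    ∃ i, i * (n + 1) ≤ N ∧ ∃ v ∈ UCP (UCE G) (N - i * (n + 1)), v + i • UCc n p ≤ u := by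
  classical
  have hG' : ∀ C, UCCover T C → (p 0 ∈ C ∨ p (2 * n) ∈ C) → N ≤ ∑ v ∈ C, u v := by
    intro C hC hz
    apply hG
    intro a b hab
    rcases (hTG a b).1 hab with h1 | ⟨rfl, rfl⟩ | ⟨rfl, rfl⟩
    · exact hC a b h1
    · exact hz
    · exact hz.symm
  have hT : ∀ a b, T.Adj a b → G.Adj a b := fun a b hab => (hTG a b).2 (Or.inl hab)
  have hz : G.Adj (p 0) (p (2 * n)) := (hTG _ _).2 (Or.inr (Or.inl ⟨rfl, rfl⟩))
  let good : Finset V × Finset V → Prop := fun PQ => UCCover T PQ.1 ∧ UCCover T PQ.2 ∧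
    p 0 ∈ PQ.1 ∧ p (2 * n) ∈ PQ.1 ∧ p 0 ∉ PQ.2 ∧ p (2 * n) ∉ PQ.2
  by_cases hall : ∀ P Q, UCCover T P → UCCover T Q → p 0 ∈ P → p (2 * n) ∈ P → p 0 ∉ Q →
      p (2 * n) ∉ Q → 2 * N ≤ ∑ v ∈ P, u v + ∑ v ∈ Q, u v + 0
  · exact ⟨0, UC_decomp hn h hT hz u N 0 hG' hall (Or.inl rfl)⟩
  · push Not at hall
    obtain ⟨P1, Q1, a1, a2, a3, a4, a5, a6, a7⟩ := hall
    obtain ⟨PQ, hPQ, hmin⟩ := Finset.exists_min_image (Finset.univ.filter good)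
      (fun PQ => ∑ v ∈ PQ.1, u v + ∑ v ∈ PQ.2, u v)
      ⟨(P1, Q1), Finset.mem_filter.2 ⟨Finset.mem_univ _, a1, a2, a3, a4, a5, a6⟩⟩
    have hm : ∀ P Q, UCCover T P → UCCover T Q → p 0 ∈ P → p (2 * n) ∈ P → p 0 ∉ Q →
      p (2 * n) ∉ Q → ∑ v ∈ PQ.1, u v + ∑ v ∈ PQ.2, u v ≤ ∑ v ∈ P, u v + ∑ v ∈ Q, u v :=
      fun P Q b1 b2 b3 b4 b5 b6 => hmin (P, Q)
        (Finset.mem_filter.2 ⟨Finset.mem_univ _, b1, b2, b3, b4, b5, b6⟩)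
    obtain ⟨b1, b2, b3, b4, b5, b6⟩ := (Finset.mem_filter.1 hPQ).2
    have h1 := hm P1 Q1 a1 a2 a3 a4 a5 a6
    refine ⟨2 * N - (∑ v ∈ PQ.1, u v + ∑ v ∈ PQ.2, u v), UC_decomp hn h hT hz u N _ hG' ?_ ?_⟩
    · intro P Q c1 c2 c3 c4 c5 c6
      have := hm P Q c1 c2 c3 c4 c5 c6
      omega
    · right
      exact ⟨PQ.1, PQ.2, b1, b2, b3, b4, b5, b6, by omega⟩

theorem UC_concave {V : Type} [Fintype V] [DecidableEq V] {T G : SimpleGraph V} {n : ℕ}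
    {p : ℕ → V} {χ : V → Bool} (hn : 1 ≤ n) (h : UCSetup T n p χ)
    (hTG : ∀ a b, G.Adj a b ↔ T.Adj a b ∨ (a = p 0 ∧ b = p (2 * n)) ∨ (a = p (2 * n) ∧ b = p 0))
    (j t : ℕ) (ht : 1 ≤ t) (htj : t * (n + 1) ≤ j) (v w : V →₀ ℕ) (hv : v ∈ UCP (UCE G) j)
    (hw : w ∈ UCP (UCE G) (j - t * (n + 1))) (hle : w + t • UCc n p ≤ v) :
    ∃ v' ∈ UCP (UCE G) (j - (n + 1)), v' + UCc n p ≤ v := by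
  classical
  obtain ⟨d, rfl⟩ := exists_add_of_le hle
  obtain ⟨t, rfl⟩ : ∃ t', t = t' + 1 := ⟨t - 1, by omega⟩
  obtain ⟨m, rfl⟩ := exists_add_of_le htj
  have hm : (t + 1) * (n + 1) + m - (t + 1) * (n + 1) = m := by omega
  have hm' : (t + 1) * (n + 1) + m - (n + 1) = t * (n + 1) + m := by
    rw [add_mul]; omega
  rw [hm] at hw
  rw [hm']
  have hT : ∀ a b, T.Adj a b → G.Adj a b := fun a b hab => (hTG a b).2 (Or.inl hab)
  have hz : G.Adj (p 0) (p (2 * n)) := (hTG _ _).2 (Or.inr (Or.inl ⟨rfl, rfl⟩))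
  have key : ∀ (f : V → ℕ) (q : ℕ), (∀ a b, G.Adj a b → q ≤ f a + f b) →
      q * (t * (n + 1) + m) ≤ ∑ x, (w + d + t • UCc n p) x * f x := by
    intro f q hf
    have e1 := UCP_weight f q hf hv
    have e2 := UCP_weight f q hf hw
    simp only [Finsupp.add_apply, Finsupp.smul_apply, smul_eq_mul, add_mul,
      Finset.sum_add_distrib, mul_assoc, ← Finset.mul_sum] at e1 e2 ⊢
    set A := ∑ x, w x * f x
    set B := ∑ x, d x * f x
    set C := ∑ x, UCc n p x * f x
    have : (t + 1) * (q * (t * (n + 1) + m)) ≤ (t + 1) * (A + B + t * C) := by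
      nlinarith
    exact Nat.le_of_mul_le_mul_left this (by omega)
  have hind : ∀ (C : Finset V) (u : V →₀ ℕ),
      ∑ x, u x * (if x ∈ C then 1 else 0) = ∑ x ∈ C, u x := by
    intro C u
    simp
  obtain ⟨-, v', hv', hle'⟩ := UC_decomp hn h hT hz (w + d + t • UCc n p) (t * (n + 1) + m) 0
    (by
      intro C hC hzC
      rw [← hind]
      have := key (fun x => if x ∈ C then 1 else 0) 1 (by
        intro a b hab
        have hor : a ∈ C ∨ b ∈ C := by
          rcases (hTG a b).1 hab with h1 | ⟨rfl, rfl⟩ | ⟨rfl, rfl⟩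
          · exact hC a b h1
          · exact hzC
          · exact hzC.symm
        rcases hor with h1 | h1 <;> simp [h1])
      simpa only [one_mul] using this)
    (by
      intro P Q hP hQ b3 b4 b5 b6
      rw [← hind P, ← hind Q, ← Finset.sum_add_distrib, add_zero]
      simp only [← mul_add]
      refine key (fun x => (if x ∈ P then 1 else 0) + if x ∈ Q then 1 else 0) 2 ?_
      intro a b hab
      rcases (hTG a b).1 hab with h1 | ⟨rfl, rfl⟩ | ⟨rfl, rfl⟩
      · have c1 := hP a b h1
        have c2 := hQ a b h1
        rcases c1 with c1 | c1 <;> rcases c2 with c2 | c2 <;> simp only [c1, c2, if_true] <;> omega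
      · simp only [b3, b4, if_true]; omega
      · simp only [b3, b4, if_true]; omega)
    (Or.inl rfl)
  simp only [zero_mul, Nat.sub_zero, zero_smul, add_zero] at hv' hle'
  refine ⟨v', hv', ?_⟩
  intro x
  have := hle' x
  simp only [Finsupp.add_apply, Finsupp.smul_apply, smul_eq_mul, add_mul] at this ⊢
  omega

end

section
theorem UC_reach {V : Type} (H : SimpleGraph V) (p : ℕ → V) (i j : ℕ) (hij : i ≤ j)
    (hadj : ∀ m, i ≤ m → m < j → H.Adj (p m) (p (m + 1))) : H.Reachable (p i) (p j) := by
  induction j, hij using Nat.le_induction with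
  | base => exact SimpleGraph.Reachable.refl _
  | succ j hj ih =>
    exact (ih (fun m h1 h2 => hadj m h1 (by omega))).trans (hadj j hj (by omega)).reachable

theorem UC_setup {V : Type} [Fintype V] {G : SimpleGraph V} {n : ℕ} (hn : 1 ≤ n)
    {x : ZMod (2 * n + 1) → V} (hx : IsUnicyclicOddCycle G n x) :
    ∃ (T : SimpleGraph V) (χ : V → Bool), UCSetup T n (fun j : ℕ => x (j : ZMod (2 * n + 1))) χ ∧
      (∀ a b, G.Adj a b ↔ T.Adj a b ∨
        (a = x ((0 : ℕ) : ZMod (2 * n + 1)) ∧ b = x ((2 * n : ℕ) : ZMod (2 * n + 1))) ∨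
        (a = x ((2 * n : ℕ) : ZMod (2 * n + 1)) ∧ b = x ((0 : ℕ) : ZMod (2 * n + 1)))) ∧
      (∀ j, j < 2 * n → G.Adj (x (j : ZMod (2 * n + 1))) (x ((j + 1 : ℕ) : ZMod (2 * n + 1)))) := by
  classical
  obtain ⟨p, hp⟩ : ∃ p : ℕ → V, p = fun j : ℕ => x (j : ZMod (2 * n + 1)) := ⟨_, rfl⟩
  have hp' : ∀ j : ℕ, x (j : ZMod (2 * n + 1)) = p j := fun j => by rw [hp]
  simp only [hp']
  rw [show (fun j : ℕ => p j) = p from rfl]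
  have inj : ∀ i j, i ≤ 2 * n → j ≤ 2 * n → p i = p j → i = j := by
    intro i j hi hj e
    rw [← hp', ← hp'] at e
    have e' := hx.inj e
    rw [ZMod.natCast_eq_natCast_iff'] at e'
    rwa [Nat.mod_eq_of_lt (by omega), Nat.mod_eq_of_lt (by omega)] at e'
  have hGadj : ∀ j, j < 2 * n → G.Adj (p j) (p (j + 1)) := by
    intro j hj
    rw [← hp', ← hp', hx.adj_iff]
    left; push_cast; rfl
  have hGz : G.Adj (p 0) (p (2 * n)) := by
    rw [← hp', ← hp', hx.adj_iff]
    right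
    have : ((2 * n + 1 : ℕ) : ZMod (2 * n + 1)) = 0 := ZMod.natCast_self _
    push_cast at this ⊢
    exact this.symm
  obtain ⟨T, hT⟩ : ∃ T, T = G.deleteEdges {s(p 0, p (2 * n))} := ⟨_, rfl⟩
  have hTadj : ∀ a b, T.Adj a b ↔ G.Adj a b ∧ s(a, b) ≠ s(p 0, p (2 * n)) := by
    intro a b
    rw [hT, SimpleGraph.deleteEdges_adj]
    simp only [Set.mem_singleton_iff, ne_eq]
  have hpT : ∀ j, j < 2 * n → T.Adj (p j) (p (j + 1)) := by
    intro j hj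
    rw [hTadj]
    refine ⟨hGadj j hj, fun e => ?_⟩
    rw [Sym2.eq_iff] at e
    rcases e with ⟨e1, e2⟩ | ⟨e1, e2⟩
    · have := inj _ _ (by omega) (by omega) e1
      have := inj _ _ (by omega) (by omega) e2
      omega
    · have := inj _ _ (by omega) (by omega) e1
      omega
  have hTc : T.Connected := by
    rw [hT]
    apply hx.connected.connected_delete_edge_of_not_isBridge
    rw [SimpleGraph.isBridge_iff, not_not, ← hT]
    exact UC_reach T p 0 (2 * n) (by omega) (fun m _ h => hpT m h)
  have hTree : T.IsTree := by
    rw [SimpleGraph.isTree_iff_connected_and_card]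
    refine ⟨hTc, ?_⟩
    rw [Nat.card_coe_set_eq, Nat.card_eq_fintype_card, ← hx.edge_count, hT,
      SimpleGraph.edgeSet_deleteEdges]
    exact Set.ncard_sdiff_singleton_add_one (by simpa using hGz) (Set.toFinite _)
  obtain ⟨c⟩ := hTree.colorable_two
  have hc : ∀ a b, T.Adj a b → c a ≠ c b := fun a b h => c.valid h
  have hc2 : ∀ i, 2 * i ≤ 2 * n → c (p (2 * i)) = c (p 0) := by
    intro i
    induction i with
    | zero => intro _; rfl
    | succ i ih =>
      intro hi
      have h1 := ih (by omega)
      have h2 := hc _ _ (hpT (2 * i) (by omega))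
      have h3 := hc _ _ (hpT (2 * i + 1) (by omega))
      rw [show 2 * (i + 1) = 2 * i + 1 + 1 by ring]
      omega
  refine ⟨T, fun v => decide (c v = c (p 0)), ⟨?_, inj, ?_, ?_⟩, ?_, hGadj⟩
  · intro a b hab
    have := hc a b hab
    simp only [ne_eq, decide_eq_decide]
    omega
  · intro i hi
    simp [hc2 i (by omega)]
  · intro k hk
    have hbr : T.IsBridge s(p (2 * k), p (2 * k + 1)) :=
      SimpleGraph.isAcyclic_iff_forall_adj_isBridge.1 hTree.2 (hpT (2 * k) (by omega))
    rw [SimpleGraph.isBridge_iff] at hbr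
    obtain ⟨H, hH⟩ : ∃ H, H = T.deleteEdges {s(p (2 * k), p (2 * k + 1))} := ⟨_, rfl⟩
    rw [← hH] at hbr
    have hHadj : ∀ a b, H.Adj a b ↔ T.Adj a b ∧ s(a, b) ≠ s(p (2 * k), p (2 * k + 1)) := by
      intro a b
      rw [hH, SimpleGraph.deleteEdges_adj]
      simp only [Set.mem_singleton_iff, ne_eq]
    have hpH : ∀ j, j < 2 * n → j ≠ 2 * k → H.Adj (p j) (p (j + 1)) := by
      intro j hj hjk
      rw [hHadj]
      refine ⟨hpT j hj, fun e => ?_⟩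
      rw [Sym2.eq_iff] at e
      rcases e with ⟨e1, e2⟩ | ⟨e1, e2⟩
      · have := inj _ _ (by omega) (by omega) e1
        omega
      · have := inj _ _ (by omega) (by omega) e1
        have := inj _ _ (by omega) (by omega) e2
        omega
    have r1 : H.Reachable (p 0) (p (2 * k)) :=
      UC_reach H p 0 (2 * k) (by omega) (fun m _ h => hpH m (by omega) (by omega))
    have r2 : H.Reachable (p (2 * k + 1)) (p (2 * n)) :=
      UC_reach H p (2 * k + 1) (2 * n) (by omega) (fun m _ h => hpH m (by omega) (by omega))
    have r3 : ¬ H.Reachable (p 0) (p (2 * k + 1)) := fun r => hbr (r1.symm.trans r)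
    refine ⟨Finset.univ.filter (fun v => H.Reachable (p 0) v), ?_⟩
    simp only [Finset.mem_filter, Finset.mem_univ, true_and]
    refine ⟨SimpleGraph.Reachable.refl _, fun r => r3 (r.trans r2.symm), r1, r3, ?_⟩
    intro a b hab ha hb
    by_cases e : s(a, b) = s(p (2 * k), p (2 * k + 1))
    · rw [Sym2.eq_iff] at e
      rcases e with e | ⟨e1, e2⟩
      · exact e
      · rw [e1] at ha
        exact absurd ha r3
    · exact absurd (ha.trans ((hHadj a b).2 ⟨hab, e⟩).reachable) hb
  · intro a b
    rw [hTadj]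
    constructor
    · intro h
      by_cases e : s(a, b) = s(p 0, p (2 * n))
      · right; rwa [Sym2.eq_iff] at e
      · exact Or.inl ⟨h, e⟩
    · rintro (h | ⟨rfl, rfl⟩ | ⟨rfl, rfl⟩)
      · exact h.1
      · exact hGz
      · exact hGz.symm

end

section
open MvPolynomial
theorem UC_edgeIdeal (𝕜 : Type) [Field 𝕜] {V : Type} (G : SimpleGraph V) :
    edgeIdeal 𝕜 G = Ideal.span ((fun s => monomial s (1 : 𝕜)) '' UCE G) := by
  unfold edgeIdeal UCE
  congr 1
  ext p
  constructor
  · rintro ⟨u, v, h, rfl⟩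
    exact ⟨_, ⟨u, v, h, rfl⟩, by simp [X, monomial_mul]⟩
  · rintro ⟨_, ⟨u, v, h, rfl⟩, rfl⟩
    exact ⟨u, v, h, by simp [X, monomial_mul]⟩

theorem UC_span_pow (𝕜 : Type) [Field 𝕜] {V : Type} (S : Set (V →₀ ℕ)) (N : ℕ) :
    (Ideal.span ((fun s => monomial s (1 : 𝕜)) '' S)) ^ N =
      Ideal.span ((fun s => monomial s (1 : 𝕜)) '' UCP S N) := by
  induction N with
  | zero =>
    simp only [UCP, pow_zero, Set.image_singleton]
    rw [← C_apply, C_1, Ideal.span_singleton_one]; exact Ideal.one_eq_top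
  | succ N ih =>
    rw [pow_succ', ih, Ideal.span_mul_span']
    congr 1
    ext p
    simp only [Set.mem_mul, Set.mem_image, UCP, Set.mem_ofPred_eq]
    constructor
    · rintro ⟨_, ⟨e, he, rfl⟩, _, ⟨v, hv, rfl⟩, rfl⟩
      exact ⟨e + v, ⟨e, he, v, hv, rfl⟩, by simp [monomial_mul]⟩
    · rintro ⟨_, ⟨e, he, v, hv, rfl⟩, rfl⟩
      exact ⟨_, ⟨e, he, rfl⟩, _, ⟨v, hv, rfl⟩, by simp [monomial_mul]⟩

theorem UC_pow_eq (𝕜 : Type) [Field 𝕜] {V : Type} (G : SimpleGraph V) (N : ℕ) :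
    edgeIdeal 𝕜 G ^ N = Ideal.span ((fun s => monomial s (1 : 𝕜)) '' UCP (UCE G) N) := by
  rw [UC_edgeIdeal, UC_span_pow]

theorem UC_pow_mul_eq (𝕜 : Type) [Field 𝕜] {V : Type} (G : SimpleGraph V) (N : ℕ) (d : V →₀ ℕ) :
    edgeIdeal 𝕜 G ^ N * Ideal.span {monomial d (1 : 𝕜)} =
      Ideal.span ((fun s => monomial s (1 : 𝕜)) '' ((fun v => v + d) '' UCP (UCE G) N)) := by
  rw [UC_pow_eq, Ideal.span_mul_span']
  congr 1
  ext p
  simp only [Set.mul_singleton, Set.mem_image]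
  constructor
  · rintro ⟨_, ⟨e, he, rfl⟩, rfl⟩
    exact ⟨_, ⟨e, he, rfl⟩, by simp [monomial_mul]⟩
  · rintro ⟨_, ⟨e, he, rfl⟩, rfl⟩
    exact ⟨_, ⟨e, he, rfl⟩, by simp [monomial_mul]⟩

theorem UC_mem_span {𝕜 : Type} [Field 𝕜] {V : Type} (S : Set (V →₀ ℕ)) (m : V →₀ ℕ) :
    monomial m (1 : 𝕜) ∈ Ideal.span ((fun s => monomial s (1 : 𝕜)) '' S) ↔ ∃ v ∈ S, v ≤ m := by
  classical
  rw [MvPolynomial.mem_ideal_span_monomial_image]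
  simp [support_monomial]

theorem UC_eq_of_le_degree {V : Type} {u v : V →₀ ℕ} (h : u ≤ v) (hd : u.degree = v.degree) :
    u = v := by
  obtain ⟨w, rfl⟩ := le_iff_exists_add.mp h
  rw [map_add] at hd
  have : w.degree = 0 := by omega
  rw [Finsupp.degree_eq_zero_iff] at this
  rw [this, add_zero]

theorem UC_minGen {𝕜 : Type} [Field 𝕜] {V : Type} (S : Set (V →₀ ℕ)) (d : ℕ)
    (hS : ∀ u ∈ S, u.degree = d) (f : MvPolynomial V 𝕜) :
    IsMinMonomialGen (Ideal.span ((fun s => monomial s (1 : 𝕜)) '' S)) f ↔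
      ∃ u ∈ S, f = monomial u 1 := by
  constructor
  · rintro ⟨⟨m, rfl⟩, h, h2⟩
    rw [UC_mem_span] at h
    obtain ⟨v, hv, hvm⟩ := h
    refine ⟨v, hv, (h2 _ ⟨v, rfl⟩ (Ideal.subset_span ⟨v, hv, rfl⟩) ?_).symm⟩
    rw [monomial_dvd_monomial]
    exact ⟨Or.inr hvm, one_dvd _⟩
  · rintro ⟨u, hu, rfl⟩
    refine ⟨⟨u, rfl⟩, Ideal.subset_span ⟨u, hu, rfl⟩, ?_⟩
    rintro _ ⟨m, rfl⟩ hm hd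
    rw [monomial_dvd_monomial] at hd
    have hmu : m ≤ u := by
      rcases hd.1 with h | h
      · exact absurd h one_ne_zero
      · exact h
    rw [UC_mem_span] at hm
    obtain ⟨v, hv, hvm⟩ := hm
    have hvu : v = u := UC_eq_of_le_degree (hvm.trans hmu) (by rw [hS v hv, hS u hu])
    subst hvu
    rw [le_antisymm hmu hvm]

def UCGe {V : Type} (G : SimpleGraph V) (n : ℕ) (d : V →₀ ℕ) (j : ℕ) : Set (V →₀ ℕ) :=
  {u | u ∈ UCP (UCE G) j ∧ (n < j → ¬ ∃ v ∈ UCP (UCE G) (j - (n + 1)), v + d ≤ u)}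

theorem UC_GSet (𝕜 : Type) [Field 𝕜] {V : Type} (G : SimpleGraph V) (n j : ℕ) (d : V →₀ ℕ) :
    GSet 𝕜 (edgeIdeal 𝕜 G) (monomial d 1) n j = (fun s => monomial s (1 : 𝕜)) '' UCGe G n d j := by
  have h1 : ∀ N f, IsMinMonomialGen (edgeIdeal 𝕜 G ^ N) f ↔ ∃ u ∈ UCP (UCE G) N, f = monomial u 1 := by
    intro N f
    rw [UC_pow_eq]
    exact UC_minGen _ (2 * N) (fun u hu => UCP_degree hu) f
  have h2 : ∀ N f, IsMinMonomialGen (edgeIdeal 𝕜 G ^ N * Ideal.span {monomial d (1 : 𝕜)}) f ↔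
      ∃ u ∈ UCP (UCE G) N, f = monomial (u + d) 1 := by
    intro N f
    rw [UC_pow_mul_eq, UC_minGen _ (2 * N + d.degree)]
    · simp
    · rintro _ ⟨u, hu, rfl⟩
      rw [map_add, UCP_degree hu]
  unfold GSet UCGe
  ext f
  split_ifs with hj
  · simp only [Set.mem_ofPred_eq, h1, Set.mem_image]
    constructor
    · rintro ⟨u, hu, rfl⟩
      exact ⟨u, ⟨hu, fun h => absurd h (by omega)⟩, rfl⟩
    · rintro ⟨u, hu, rfl⟩
      exact ⟨u, hu.1, rfl⟩
  · simp only [Set.mem_ofPred_eq, h1, h2, Set.mem_image]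
    constructor
    · rintro ⟨⟨u, hu, rfl⟩, h⟩
      refine ⟨u, ⟨hu, fun _ => ?_⟩, rfl⟩
      rintro ⟨v, hv, hle⟩
      exact h ⟨_, ⟨v, hv, rfl⟩, by rw [monomial_dvd_monomial]; exact ⟨Or.inr hle, one_dvd _⟩⟩
    · rintro ⟨u, ⟨hu, h⟩, rfl⟩
      refine ⟨⟨u, hu, rfl⟩, ?_⟩
      rintro ⟨_, ⟨v, hv, rfl⟩, hdvd⟩
      rw [monomial_dvd_monomial] at hdvd
      rcases hdvd.1 with h' | h'
      · exact absurd h' one_ne_zero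
      · exact h (by omega) ⟨v, hv, h'⟩

theorem UC_GSet_ncard (𝕜 : Type) [Field 𝕜] {V : Type} (G : SimpleGraph V) (n j : ℕ) (d : V →₀ ℕ) :
    (GSet 𝕜 (edgeIdeal 𝕜 G) (monomial d 1) n j).ncard = (UCGe G n d j).ncard := by
  rw [UC_GSet]
  exact Set.ncard_image_of_injective _ (monomial_left_injective one_ne_zero)

theorem UC_c (𝕜 : Type) [Field 𝕜] {V : Type} (n : ℕ) (x : ZMod (2 * n + 1) → V) :
    (∏ j : ZMod (2 * n + 1), X (x j) : MvPolynomial V 𝕜) =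
      monomial (UCc n (fun j : ℕ => x (j : ZMod (2 * n + 1)))) 1 := by
  rw [UCc, monomial_sum_one]
  symm
  refine Finset.prod_bij (fun j _ => (j : ZMod (2 * n + 1))) (fun _ _ => Finset.mem_univ _) ?_ ?_ ?_
  · intro a ha b hb h
    rw [Finset.mem_range] at ha hb
    have := congrArg ZMod.val h
    rwa [ZMod.val_natCast_of_lt ha, ZMod.val_natCast_of_lt hb] at this
  · intro b _
    exact ⟨b.val, Finset.mem_range.mpr (ZMod.val_lt b), by simp⟩
  · intro a _
    rfl

end

section
open MvPolynomial
theorem UC_ass {𝕜 : Type} [Field 𝕜] {V : Type} [Finite V] (G : SimpleGraph V)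
    {p : Ideal (MvPolynomial V 𝕜)}
    (hp : p ∈ associatedPrimes (MvPolynomial V 𝕜) (MvPolynomial V 𝕜 ⧸ edgeIdeal 𝕜 G)) :
    edgeIdeal 𝕜 G ≤ p ∧ ∀ v, X v ∈ p → ∃ u, G.Adj v u ∧ X u ∉ p := by
  classical
  rw [AssociatedPrimes.mem_iff, isAssociatedPrime_iff] at hp
  obtain ⟨hprime, y, hy⟩ := hp
  obtain ⟨f, rfl⟩ := Ideal.Quotient.mk_surjective y
  have hmem : ∀ r, r ∈ p ↔ r * f ∈ edgeIdeal 𝕜 G := by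
    intro r
    rw [hy, Submodule.mem_colon_singleton, Submodule.mem_bot, ← Ideal.Quotient.eq_zero_iff_mem,
      map_mul]
    rfl
  have hf : f ∉ edgeIdeal 𝕜 G := by
    intro h
    apply hprime.ne_top
    rw [Ideal.eq_top_iff_one, hmem, one_mul]
    exact h
  have hcr : ∀ g : MvPolynomial V 𝕜, g ∈ edgeIdeal 𝕜 G ↔ ∀ m ∈ g.support, ∃ e ∈ UCE G, e ≤ m := by
    intro g
    rw [UC_edgeIdeal, MvPolynomial.mem_ideal_span_monomial_image]
  refine ⟨fun r hr => (hmem r).2 (Ideal.mul_mem_right _ _ hr), ?_⟩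
  rw [hcr] at hf
  push Not at hf
  obtain ⟨m, hm, hme⟩ := hf
  have key : ∀ v, X v ∈ p → ∃ e ∈ UCE G, e ≤ m + Finsupp.single v 1 := by
    intro v hv
    rw [hmem, hcr] at hv
    apply hv
    rw [mem_support_iff, add_comm m, coeff_X_mul]
    exact mem_support_iff.mp hm
  intro v hv
  obtain ⟨_, ⟨a, b, hab, rfl⟩, hle⟩ := key v hv
  have hne : a ≠ b := hab.ne
  have hw : ∃ w, G.Adj v w ∧ 1 ≤ m w := by
    by_cases hav : a = v
    · subst hav
      refine ⟨b, hab, ?_⟩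
      have := hle b
      simpa [Finsupp.single_apply, hne, hne.symm] using this
    by_cases hbv : b = v
    · subst hbv
      refine ⟨a, hab.symm, ?_⟩
      have := hle a
      simpa [Finsupp.single_apply, hne, hne.symm] using this
    exfalso
    apply hme _ ⟨a, b, hab, rfl⟩
    intro z
    have := hle z
    by_cases hz : v = z
    · subst hz
      simp [hav, hbv]
    · simpa [Finsupp.single_apply, hz] using this
  obtain ⟨w, hvw, hmw⟩ := hw
  refine ⟨w, hvw, fun hwp => ?_⟩
  obtain ⟨_, ⟨a, b, hab, rfl⟩, hle⟩ := key w hwp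
  have hne : a ≠ b := hab.ne
  apply hme _ ⟨a, b, hab, rfl⟩
  intro z
  have := hle z
  by_cases hz : w = z
  · subst hz
    refine le_trans ?_ hmw
    simp only [Finsupp.add_apply, Finsupp.single_apply]
    split_ifs with h1 h2 <;> first | omega | (exact absurd (h1.trans h2.symm) hne)
  · simpa [Finsupp.single_apply, hz] using this

theorem UCc_two {V : Type} {G : SimpleGraph V} {n : ℕ} {p : ℕ → V}
    (hpath : ∀ j < 2 * n, G.Adj (p j) (p (j + 1))) :
    (∃ e ∈ UCP (UCE G) n, UCc n p = e + Finsupp.single (p (2 * n)) 1) ∧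
      (∃ e ∈ UCP (UCE G) n, UCc n p = e + Finsupp.single (p 0) 1) := by
  have aux : ∀ (q : ℕ → V) (N : ℕ), (∀ j < 2 * N, G.Adj (q j) (q (j + 1))) →
      (∑ j ∈ Finset.range (2 * N), Finsupp.single (q j) 1) ∈ UCP (UCE G) N := by
    intro q N
    induction N with
    | zero => intro _; simp [UCP]
    | succ N ih =>
      intro h
      refine ⟨Finsupp.single (q (2 * N)) 1 + Finsupp.single (q (2 * N + 1)) 1,
        ⟨_, _, h _ (by omega), rfl⟩, _, ih (fun j hj => h j (by omega)), ?_⟩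
      rw [show 2 * (N + 1) = 2 * N + 1 + 1 by ring, Finset.sum_range_succ, Finset.sum_range_succ]
      abel
  constructor
  · refine ⟨_, aux p n hpath, ?_⟩
    rw [UCc, Finset.sum_range_succ]
  · rcases n with _ | n
    · exact ⟨0, rfl, by simp [UCc]⟩
    have h2 : (∑ j ∈ Finset.range (2 * (n + 1)), Finsupp.single (p (j + 1)) 1) ∈
        UCP (UCE G) (n + 1) := by
      have : ∀ N, N ≤ n + 1 → (∑ j ∈ Finset.range (2 * N), Finsupp.single (p (j + 1)) 1) ∈
          UCP (UCE G) N := by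
        intro N
        induction N with
        | zero => intro _; simp [UCP]
        | succ N ih =>
          intro h
          refine ⟨Finsupp.single (p (2 * N + 1)) 1 + Finsupp.single (p (2 * N + 1 + 1)) 1,
            ⟨_, _, hpath _ (by omega), rfl⟩, _, ih (by omega), ?_⟩
          rw [show 2 * (N + 1) = 2 * N + 1 + 1 by ring, Finset.sum_range_succ,
            Finset.sum_range_succ]
          abel
      exact this _ le_rfl
    refine ⟨_, h2, ?_⟩
    rw [UCc, Finset.sum_range_succ']

theorem UC_aux1 {S : Type} [CommRing S] (J : Ideal S) (a b : S) (N : ℕ) (ha : a ∈ J ^ N)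
    (hb : b ∈ J) : a * b ∈ J ^ (N + 1) := by
  rw [pow_succ]
  exact Ideal.mul_mem_mul ha hb

theorem UC_aux2 {S : Type} [CommRing S] (J : Ideal S) (a b : S) (s N q i : ℕ)
    (hs : s = N + q * i) (ha : a ∈ J ^ N) (hb : b ∈ J ^ q) : a * b ^ i ∈ J ^ s := by
  rw [hs, pow_add, pow_mul]
  exact Ideal.mul_mem_mul ha (Ideal.pow_mem_pow hb i)

theorem UC_loc_mem {𝕜 : Type} [Field 𝕜] {V : Type} [Finite V] {G : SimpleGraph V} {n : ℕ}
    {p : ℕ → V} (hpath : ∀ j < 2 * n, G.Adj (p j) (p (j + 1))) (hcl : G.Adj (p 0) (p (2 * n)))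
    {P : Ideal (MvPolynomial V 𝕜)} (hP : P.IsPrime)
    (hass : P ∈ associatedPrimes (MvPolynomial V 𝕜) (MvPolynomial V 𝕜 ⧸ edgeIdeal 𝕜 G))
    (s i : ℕ) (his : i * (n + 1) ≤ s) (v m : V →₀ ℕ) (hv : v ∈ UCP (UCE G) (s - i * (n + 1)))
    (hle : v + i • UCc n p ≤ m) :
    monomial m (1 : 𝕜) ∈ localizationComap P hP (edgeIdeal 𝕜 G ^ s) := by
  obtain ⟨hIP, hX⟩ := UC_ass G hass
  unfold localizationComap
  let _ := hP
  rw [Ideal.mem_comap, Ideal.map_pow]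
  set A := algebraMap (MvPolynomial V 𝕜) (Localization P.primeCompl) with hA
  set J := Ideal.map A (edgeIdeal 𝕜 G) with hJ
  have hadj : ∀ a b, G.Adj a b → (X a * X b : MvPolynomial V 𝕜) ∈ edgeIdeal 𝕜 G :=
    fun a b h => Ideal.subset_span ⟨a, b, h, rfl⟩
  have hXJ : ∀ a, X a ∈ P → A (X a) ∈ J := by
    intro a ha
    obtain ⟨u, hau, hu⟩ := hX a ha
    rw [hJ, hA, IsLocalization.algebraMap_mem_map_algebraMap_iff P.primeCompl]
    exact ⟨X u, hu, hadj _ _ hau.symm⟩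
  have hmon : ∀ N, ∀ w ∈ UCP (UCE G) N, A (monomial w 1) ∈ J ^ N := by
    intro N w hw
    rw [hJ, ← Ideal.map_pow]
    apply Ideal.mem_map_of_mem
    rw [UC_pow_eq]
    exact Ideal.subset_span ⟨w, hw, rfl⟩
  have hc : A (monomial (UCc n p) 1) ∈ J ^ (n + 1) := by
    obtain ⟨⟨e1, he1, h1⟩, ⟨e2, he2, h2⟩⟩ := UCc_two hpath
    have hor : X (p 0) ∈ P ∨ X (p (2 * n)) ∈ P := hP.mem_or_mem (hIP (hadj _ _ hcl))
    have fin : ∀ e ∈ UCP (UCE G) n, ∀ a, X a ∈ P →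
        A (monomial (e + Finsupp.single a 1) 1) ∈ J ^ (n + 1) := by
      intro e he a ha
      have : (monomial (e + Finsupp.single a 1) 1 : MvPolynomial V 𝕜) = monomial e 1 * X a := by
        simp [X, monomial_mul]
      rw [this, map_mul]
      exact UC_aux1 J _ _ n (hmon _ _ he) (hXJ _ ha)
    rcases hor with h | h
    · rw [h2]; exact fin _ he2 _ h
    · rw [h1]; exact fin _ he1 _ h
  obtain ⟨w, rfl⟩ := le_iff_exists_add.mp hle
  have e1 : (monomial (v + i • UCc n p + w) 1 : MvPolynomial V 𝕜) =
      monomial v 1 * (monomial (UCc n p) 1) ^ i * monomial w 1 := by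
    simp [monomial_mul, monomial_pow]
  rw [e1, map_mul, map_mul, map_pow]
  apply Ideal.mul_mem_right
  have hs' : s = (s - i * (n + 1)) + (n + 1) * i := by rw [mul_comm (n+1)]; omega
  exact UC_aux2 J _ _ _ _ _ _ hs' (hmon _ _ hv) hc

end

section
open MvPolynomial
theorem UC_minCover {V : Type} [Fintype V] [DecidableEq V] (G : SimpleGraph V) (C : Finset V)
    (hC : UCCover G C) :
    ∃ C' ⊆ C, UCCover G C' ∧ ∀ v ∈ C', ∃ u, u ∉ C' ∧ G.Adj v u := by
  induction C using Finset.strongInduction with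
  | H C ih =>
    by_cases h : ∀ v ∈ C, ∃ u, u ∉ C ∧ G.Adj v u
    · exact ⟨C, subset_rfl, hC, h⟩
    · push Not at h
      obtain ⟨v, hv, hu⟩ := h
      obtain ⟨C', h1, h2, h3⟩ := ih (C.erase v) (Finset.erase_ssubset hv) (by
        intro a b hab
        by_cases ha : a = v
        · subst ha
          right
          rw [Finset.mem_erase]
          exact ⟨hab.ne.symm, by_contra fun hb => hu b hb hab⟩
        · by_cases hb : b = v
          · subst hb
            left
            rw [Finset.mem_erase]
            exact ⟨ha, by_contra fun hb => hu a hb hab.symm⟩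
          · rw [Finset.mem_erase, Finset.mem_erase]
            rcases hC a b hab with h | h
            · exact Or.inl ⟨ha, h⟩
            · exact Or.inr ⟨hb, h⟩)
      exact ⟨C', h1.trans (Finset.erase_subset _ _), h2, h3⟩

noncomputable def UCphi (𝕜 : Type) [Field 𝕜] {V : Type} [DecidableEq V] (C : Finset V) :
    MvPolynomial V 𝕜 →ₐ[𝕜] Polynomial (MvPolynomial V 𝕜) :=
  aeval (fun v => Polynomial.C (X v) * (if v ∈ C then Polynomial.X else 1))

theorem UCphi_X {𝕜 : Type} [Field 𝕜] {V : Type} [DecidableEq V] (C : Finset V) (v : V) :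
    UCphi 𝕜 C (X v) = Polynomial.C (X v) * (if v ∈ C then Polynomial.X else 1) := by
  rw [UCphi, aeval_X]

theorem UCphi_monomial {𝕜 : Type} [Field 𝕜] {V : Type} [Fintype V] [DecidableEq V] (C : Finset V)
    (m : V →₀ ℕ) (a : 𝕜) :
    UCphi 𝕜 C (monomial m a) =
      Polynomial.C (monomial m a) * Polynomial.X ^ (∑ v ∈ C, m v) := by
  rw [UCphi, aeval_monomial, Finsupp.prod_fintype _ _ (by simp)]
  simp only [mul_pow, Finset.prod_mul_distrib]
  rw [← mul_assoc]
  congr 1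
  · rw [monomial_eq, map_mul, Finsupp.prod_fintype _ _ (by simp), map_prod]
    simp only [map_pow]
    rfl
  · simp only [ite_pow, one_pow]
    rw [Finset.prod_ite_mem, Finset.univ_inter, Finset.prod_pow_eq_pow_sum]

theorem UCphi_coeff {𝕜 : Type} [Field 𝕜] {V : Type} [Fintype V] [DecidableEq V] (C : Finset V)
    (f : MvPolynomial V 𝕜) (m : V →₀ ℕ) (j : ℕ) :
    MvPolynomial.coeff m ((UCphi 𝕜 C f).coeff j) =
      if ∑ v ∈ C, m v = j then MvPolynomial.coeff m f else 0 := by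
  induction f using MvPolynomial.induction_on' with
  | monomial u a =>
    rw [UCphi_monomial, Polynomial.coeff_C_mul_X_pow]
    by_cases hu : u = m
    · subst hu
      by_cases hj : ∑ v ∈ C, u v = j
      · rw [if_pos hj, if_pos hj.symm]
      · rw [if_neg hj, if_neg (fun h => hj h.symm), coeff_zero]
    · split_ifs <;> simp [coeff_monomial, hu]
  | add p q hp hq =>
    rw [map_add, Polynomial.coeff_add, coeff_add, hp, hq, coeff_add]
    split_ifs <;> simp

theorem UCphi_dvd {𝕜 : Type} [Field 𝕜] {V : Type} [Fintype V] [DecidableEq V] (C : Finset V)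
    (f : MvPolynomial V 𝕜) (s : ℕ) (h : Polynomial.X ^ s ∣ UCphi 𝕜 C f) (m : V →₀ ℕ)
    (hm : m ∈ f.support) : s ≤ ∑ v ∈ C, m v := by
  rw [Polynomial.X_pow_dvd_iff] at h
  by_contra hlt
  have h1 := UCphi_coeff C f m (∑ v ∈ C, m v)
  rw [h _ (by omega), if_pos rfl, coeff_zero] at h1
  exact (mem_support_iff.mp hm) h1.symm

noncomputable def UCprime (𝕜 : Type) [Field 𝕜] {V : Type} [DecidableEq V] (C : Finset V) :
    Ideal (MvPolynomial V 𝕜) :=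
  Ideal.comap (UCphi 𝕜 C).toRingHom (Ideal.span {Polynomial.X})

theorem UCprime_isPrime (𝕜 : Type) [Field 𝕜] {V : Type} [DecidableEq V] (C : Finset V) :
    (UCprime 𝕜 C).IsPrime := by
  unfold UCprime
  have : (Ideal.span {(Polynomial.X : Polynomial (MvPolynomial V 𝕜))}).IsPrime :=
    (Ideal.span_singleton_prime Polynomial.X_ne_zero).2 Polynomial.prime_X
  exact Ideal.comap_isPrime _ _

theorem UCprime_mem {𝕜 : Type} [Field 𝕜] {V : Type} [DecidableEq V] (C : Finset V)
    (f : MvPolynomial V 𝕜) : f ∈ UCprime 𝕜 C ↔ Polynomial.X ∣ UCphi 𝕜 C f := by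
  unfold UCprime
  rw [Ideal.mem_comap, Ideal.mem_span_singleton]
  rfl

theorem UCprime_edge {𝕜 : Type} [Field 𝕜] {V : Type} [DecidableEq V] {G : SimpleGraph V}
    (C : Finset V) (hC : UCCover G C) : edgeIdeal 𝕜 G ≤ UCprime 𝕜 C := by
  unfold edgeIdeal
  rw [Ideal.span_le]
  rintro _ ⟨a, b, hab, rfl⟩
  rw [SetLike.mem_coe, UCprime_mem, map_mul, UCphi_X, UCphi_X]
  rcases hC a b hab with h | h
  · rw [if_pos h]
    exact Dvd.dvd.mul_right (Dvd.intro_left _ rfl) _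
  · rw [if_pos h]
    exact Dvd.dvd.mul_left (Dvd.intro_left _ rfl) _

theorem UCprime_X {𝕜 : Type} [Field 𝕜] {V : Type} [DecidableEq V]
    (C : Finset V) (u : V) (hu : u ∉ C) : X u ∉ UCprime 𝕜 C := by
  rw [UCprime_mem, UCphi_X, if_neg hu, mul_one, Polynomial.X_dvd_iff, Polynomial.coeff_C_zero]
  exact X_ne_zero u

theorem UCprime_ass {𝕜 : Type} [Field 𝕜] {V : Type} [Fintype V] [DecidableEq V]
    {G : SimpleGraph V} (C : Finset V) (hC : UCCover G C) (hmin : ∀ v ∈ C, ∃ u, u ∉ C ∧ G.Adj v u) :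
    UCprime 𝕜 C ∈ associatedPrimes (MvPolynomial V 𝕜) (MvPolynomial V 𝕜 ⧸ edgeIdeal 𝕜 G) := by
  rw [AssociatedPrimes.mem_iff, isAssociatedPrime_iff]
  have hP := UCprime_isPrime 𝕜 C
  refine ⟨hP, Ideal.Quotient.mk _ (∏ u ∈ Finset.univ \ C, X u), ?_⟩
  ext r
  rw [Submodule.mem_colon_singleton, Submodule.mem_bot]
  have : r • (Ideal.Quotient.mk (edgeIdeal 𝕜 G) (∏ u ∈ Finset.univ \ C, X u)) =
    Ideal.Quotient.mk (edgeIdeal 𝕜 G) (r * ∏ u ∈ Finset.univ \ C, X u) := by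
    rw [map_mul]; rfl
  rw [this, Ideal.Quotient.eq_zero_iff_mem]
  constructor
  · intro hr
    rw [UCprime_mem] at hr
    have hr' := UCphi_dvd C r 1 (by rwa [pow_one])
    have e1 : (∏ u ∈ Finset.univ \ C, X u : MvPolynomial V 𝕜) =
        monomial (∑ u ∈ Finset.univ \ C, Finsupp.single u 1) 1 := by
      rw [monomial_sum_one]; rfl
    rw [e1, UC_edgeIdeal, MvPolynomial.mem_ideal_span_monomial_image]
    intro m hm
    rw [mem_support_iff, coeff_mul_monomial'] at hm
    split_ifs at hm with hle
    · rw [mul_one] at hm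
      have h1 := hr' _ (mem_support_iff.mpr hm)
      obtain ⟨v, hv, hv1⟩ := Finset.exists_ne_zero_of_sum_ne_zero (by omega :
        ∑ v ∈ C, (m - ∑ u ∈ Finset.univ \ C, Finsupp.single u 1 : V →₀ ℕ) v ≠ 0)
      obtain ⟨u, hu, hvu⟩ := hmin v hv
      refine ⟨_, ⟨v, u, hvu, rfl⟩, ?_⟩
      have hmv : 1 ≤ m v := by
        rw [Finsupp.tsub_apply] at hv1
        omega
      have hmu : 1 ≤ m u := by
        refine le_trans ?_ (hle u)
        rw [Finsupp.finsetSum_apply]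
        refine le_trans ?_ (Finset.single_le_sum (fun _ _ => Nat.zero_le _)
          (Finset.mem_sdiff.mpr ⟨Finset.mem_univ u, hu⟩))
        simp
      have hne := hvu.ne
      intro z
      simp only [Finsupp.add_apply, Finsupp.single_apply]
      split_ifs with h1 h2 h2
      · exact absurd (h1.trans h2.symm) hne
      · subst h1; omega
      · subst h2; omega
      · omega
    · exact absurd rfl hm
  · intro h
    refine (hP.mem_or_mem (UCprime_edge C hC h)).resolve_right ?_
    rw [hP.prod_mem_iff]
    rintro ⟨u, hu, hu'⟩
    exact UCprime_X C u (Finset.mem_sdiff.mp hu).2 hu'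

theorem UC_symb_cover {𝕜 : Type} [Field 𝕜] {V : Type} [Fintype V] [DecidableEq V]
    {G : SimpleGraph V} (s : ℕ) (f : MvPolynomial V 𝕜)
    (hf : f ∈ symbolicPower (edgeIdeal 𝕜 G) s) (m : V →₀ ℕ) (hm : m ∈ f.support)
    (C : Finset V) (hC : UCCover G C) : s ≤ ∑ v ∈ C, m v := by
  obtain ⟨C', hsub, hC', hmin⟩ := UC_minCover G C hC
  refine le_trans ?_ (Finset.sum_le_sum_of_subset hsub)
  have hP := UCprime_isPrime 𝕜 C'
  have h1 : f ∈ localizationComap (UCprime 𝕜 C') hP (edgeIdeal 𝕜 G ^ s) := by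
    unfold symbolicPower at hf
    rw [Ideal.mem_sInf] at hf
    exact hf ⟨_, hP, UCprime_ass C' hC' hmin, rfl⟩
  unfold localizationComap at h1
  let _ := hP
  rw [Ideal.mem_comap, IsLocalization.algebraMap_mem_map_algebraMap_iff (UCprime 𝕜 C').primeCompl]
    at h1
  obtain ⟨g, hg, hgf⟩ := h1
  apply UCphi_dvd C' f s _ m hm
  have hle : edgeIdeal 𝕜 G ^ s ≤ Ideal.comap (UCphi 𝕜 C').toRingHom
      (Ideal.span {Polynomial.X} ^ s) :=
    (Ideal.pow_right_mono (UCprime_edge C' hC') s).trans (Ideal.le_comap_pow _ s)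
  have h2 := hle hgf
  rw [Ideal.mem_comap, Ideal.span_singleton_pow, Ideal.mem_span_singleton] at h2
  have h3 : Polynomial.X ^ s ∣ UCphi 𝕜 C' g * UCphi 𝕜 C' f := by
    rw [← map_mul]; exact h2
  exact Polynomial.prime_X.pow_dvd_of_dvd_mul_left s
    (fun h => hg ((UCprime_mem C' g).2 h)) h3

theorem UC_symb_iff {𝕜 : Type} [Field 𝕜] {V : Type} [Fintype V] [DecidableEq V]
    {T G : SimpleGraph V} {n : ℕ} (hn : 1 ≤ n) {p : ℕ → V} {χ : V → Bool}
    (h : UCSetup T n p χ)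
    (hTG : ∀ a b, G.Adj a b ↔ T.Adj a b ∨ (a = p 0 ∧ b = p (2 * n)) ∨ (a = p (2 * n) ∧ b = p 0))
    (hpath : ∀ j < 2 * n, G.Adj (p j) (p (j + 1))) (s : ℕ) (f : MvPolynomial V 𝕜) :
    f ∈ symbolicPower (edgeIdeal 𝕜 G) s ↔ ∀ m ∈ f.support,
      ∃ i, i * (n + 1) ≤ s ∧ ∃ v ∈ UCP (UCE G) (s - i * (n + 1)), v + i • UCc n p ≤ m := by
  constructor
  · intro hf m hm
    exact UC_sym hn h hTG m s (fun C hC => UC_symb_cover s f hf m hm C hC)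
  · intro hf
    unfold symbolicPower
    rw [Ideal.mem_sInf]
    rintro _ ⟨P, hP, hass, rfl⟩
    rw [f.as_sum]
    apply Ideal.sum_mem
    intro m hm
    obtain ⟨i, his, v, hv, hle⟩ := hf m hm
    have h1 := UC_loc_mem hpath ((hTG _ _).2 (Or.inr (Or.inl ⟨rfl, rfl⟩))) hP hass s i his v m hv hle
    have : (monomial m (coeff m f) : MvPolynomial V 𝕜) = C (coeff m f) * monomial m 1 := by
      rw [C_mul_monomial, mul_one]
    rw [this]
    exact Ideal.mul_mem_left _ _ h1

end

section
open MvPolynomial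

def UCB {V : Type} (G : SimpleGraph V) (n k r : ℕ) (d : V →₀ ℕ) : Set (V →₀ ℕ) :=
  ⋃ i ∈ (Finset.range k : Finset ℕ), (fun g => (k - i) • d + g) '' UCGe G n d (i * (n + 1) + r)

theorem UCB_ncard {V : Type} [Fintype V] (G : SimpleGraph V) (n k r : ℕ) (d : V →₀ ℕ)
    (hd : d.degree = 2 * n + 1) :
    (UCB G n k r d).Finite ∧
    (UCB G n k r d).ncard = ∑ i ∈ Finset.range k, (UCGe G n d (i * (n + 1) + r)).ncard := by
  have hfin : ∀ i, ((fun g => (k - i) • d + g) '' UCGe G n d (i * (n + 1) + r)).Finite := fun i =>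
    ((UCP_finite G _).subset (fun u hu => hu.1)).image _
  have hdeg : ∀ i < k, ∀ u ∈ (fun g => (k - i) • d + g) '' UCGe G n d (i * (n + 1) + r),
      u.degree + (k - i) = 2 * (k * (n + 1) + r) := by
    rintro i hi _ ⟨g, hg, rfl⟩
    simp only [map_add, map_nsmul, hd, UCP_degree hg.1, smul_eq_mul]
    obtain ⟨t, rfl⟩ := Nat.exists_eq_add_of_le hi.le
    rw [show i + t - i = t by omega]
    ring
  refine ⟨Set.Finite.biUnion (Finset.finite_toSet _) (fun i _ => hfin i), ?_⟩
  unfold UCB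
  have hdis : Set.PairwiseDisjoint (Finset.range k : Set ℕ)
      (fun i => (fun g => (k - i) • d + g) '' UCGe G n d (i * (n + 1) + r)) := by
    intro i hi j hj hij
    rw [Function.onFun, Set.disjoint_left]
    intro u hu hu'
    rw [Finset.mem_coe, Finset.mem_range] at hi hj
    have h1 := hdeg i hi u hu
    have h2 := hdeg j hj u hu'
    omega
  have h := Set.Finite.ncard_biUnion (Finset.finite_toSet (Finset.range k)) (fun i _ => hfin i) hdis
  rw [finsum_mem_coe_finset] at h
  refine h.trans (Finset.sum_congr rfl ?_)
  intro i _
  exact Set.ncard_image_of_injective _ (add_right_injective _)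

theorem UC_mu {𝕜 : Type} [Field 𝕜] {V : Type} (I M : Ideal (MvPolynomial V 𝕜))
    (B : Set (V →₀ ℕ)) (hB : B.Finite) (hIM : I ≤ M) (hBM : ∀ b ∈ B, monomial b 1 ∈ M)
    (hgen : M ≤ I ⊔ Ideal.span ((fun b => monomial b (1 : 𝕜)) '' B))
    (hI : ∀ b ∈ B, ∀ f ∈ I, coeff b f = 0)
    (hmin : ∀ b ∈ B, ∀ f ∈ M, ∀ m ∈ f.support, m ≤ b → m = b) :
    sInf {m : ℕ | ∃ S : Finset (MvPolynomial V 𝕜), S.card = m ∧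
      (↑S : Set (MvPolynomial V 𝕜)) ⊆ (M : Set (MvPolynomial V 𝕜)) ∧
      I ⊔ Ideal.span (↑S : Set (MvPolynomial V 𝕜)) = M} = B.ncard := by
  classical
  apply le_antisymm
  · apply Nat.sInf_le
    refine ⟨hB.toFinset.image (fun b => monomial b (1 : 𝕜)), ?_, ?_, ?_⟩
    · rw [Finset.card_image_of_injective _ (monomial_left_injective one_ne_zero),
        Set.ncard_eq_toFinset_card B hB]
    · intro f hf
      rw [Finset.coe_image, Set.Finite.coe_toFinset] at hf
      obtain ⟨b, hb, rfl⟩ := hf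
      exact hBM b hb
    · rw [Finset.coe_image, Set.Finite.coe_toFinset]
      refine le_antisymm (sup_le hIM ?_) hgen
      rw [Ideal.span_le]
      rintro _ ⟨b, hb, rfl⟩
      exact hBM b hb
  · apply le_csInf
    · refine ⟨_, hB.toFinset.image (fun b => monomial b (1 : 𝕜)), rfl, ?_, ?_⟩
      · intro f hf
        rw [Finset.coe_image, Set.Finite.coe_toFinset] at hf
        obtain ⟨b, hb, rfl⟩ := hf
        exact hBM b hb
      · rw [Finset.coe_image, Set.Finite.coe_toFinset]
        refine le_antisymm (sup_le hIM ?_) hgen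
        rw [Ideal.span_le]
        rintro _ ⟨b, hb, rfl⟩
        exact hBM b hb
    rintro _ ⟨S, rfl, hSM, hS⟩
    have : Fintype B := hB.fintype
    let π : MvPolynomial V 𝕜 →ₗ[𝕜] (B → 𝕜) := LinearMap.pi (fun b => lcoeff 𝕜 b.1)
    have hπ : ∀ f b, π f b = coeff b.1 f := fun f b => rfl
    have hmul : ∀ g : MvPolynomial V 𝕜, ∀ f ∈ M, π (g * f) = (coeff 0 g) • π f := by
      intro g f hf
      ext b
      rw [Pi.smul_apply, hπ, hπ, coeff_mul, smul_eq_mul]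
      rw [Finset.sum_eq_single (0, b.1)]
      · rintro ⟨i, j⟩ hij hne
        rw [Finset.HasAntidiagonal.mem_antidiagonal] at hij
        simp only at hij ⊢
        by_cases hj : coeff j f = 0
        · rw [hj, mul_zero]
        · exfalso
          have hjb : j = b.1 := hmin b.1 b.2 f hf j (mem_support_iff.mpr hj)
            (by rw [← hij]; exact le_add_self)
          apply hne
          have hi0 : i = 0 := by
            rw [hjb] at hij
            exact add_eq_right.mp hij
          rw [hjb, hi0]
      · intro h
        exact absurd (Finset.HasAntidiagonal.mem_antidiagonal.mpr (zero_add _)) h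
    have hspan : ∀ f ∈ Ideal.span (↑S : Set (MvPolynomial V 𝕜)),
        f ∈ M ∧ π f ∈ Submodule.span 𝕜 ((S.image π : Finset (B → 𝕜)) : Set (B → 𝕜)) := by
      intro f hf
      induction hf using Submodule.span_induction with
      | mem y hy =>
        exact ⟨hSM hy, Submodule.subset_span (Finset.mem_coe.mpr (Finset.mem_image_of_mem π hy))⟩
      | zero => exact ⟨M.zero_mem, by rw [map_zero]; exact Submodule.zero_mem _⟩
      | add y z _ _ hy hz =>
        exact ⟨M.add_mem hy.1 hz.1, by rw [map_add]; exact Submodule.add_mem _ hy.2 hz.2⟩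
      | smul g y _ hy =>
        refine ⟨M.mul_mem_left g hy.1, ?_⟩
        rw [smul_eq_mul, hmul g y hy.1]
        exact Submodule.smul_mem _ _ hy.2
    have htop : Submodule.span 𝕜 ((S.image π : Finset (B → 𝕜)) : Set (B → 𝕜)) = ⊤ := by
      rw [eq_top_iff, ← (Pi.basisFun 𝕜 B).span_eq, Submodule.span_le]
      rintro _ ⟨b, rfl⟩
      have hb := hBM b.1 b.2
      rw [← hS] at hb
      obtain ⟨y, hy, z, hz, hyz⟩ := Submodule.mem_sup.mp hb
      have h1 : π (monomial b.1 1) = π z := by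
        rw [← hyz, map_add]
        have : π y = 0 := by
          ext b'
          exact hI b'.1 b'.2 y hy
        rw [this, zero_add]
      have h2 : π (monomial b.1 1) = Pi.basisFun 𝕜 B b := by
        ext b'
        rw [hπ, coeff_monomial, Pi.basisFun_apply, Pi.single_apply]
        congr 1
        rw [Subtype.ext_iff, eq_iff_iff]
        exact eq_comm
      rw [SetLike.mem_coe, ← h2, h1]
      exact (hspan z hz).2
    have h3 := finrank_span_finset_le_card (R := 𝕜) (S.image π)
    rw [Set.finrank, htop, finrank_top, Module.finrank_fintype_fun_eq_card] at h3
    rw [Set.ncard_eq_toFinset_card' B, Set.toFinset_card]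
    exact h3.trans Finset.card_image_le

end

section
open MvPolynomial

theorem UC_final {𝕜 : Type} [Field 𝕜] {V : Type} [Fintype V] [DecidableEq V]
    {T G : SimpleGraph V} {n : ℕ} (hn : 1 ≤ n) {p : ℕ → V} {χ : V → Bool}
    (h : UCSetup T n p χ)
    (hTG : ∀ a b, G.Adj a b ↔ T.Adj a b ∨ (a = p 0 ∧ b = p (2 * n)) ∨ (a = p (2 * n) ∧ b = p 0))
    (hpath : ∀ j < 2 * n, G.Adj (p j) (p (j + 1)))
    (s k r : ℕ) (hs : s = k * (n + 1) + r) (hr : r ≤ n) :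
    sdefect (edgeIdeal 𝕜 G) s =
      ∑ i ∈ Finset.range k, (UCGe G n (UCc n p) (i * (n + 1) + r)).ncard := by
  have hd := UCc_degree n p
  obtain ⟨hfin, hcard⟩ := UCB_ncard G n k r (UCc n p) hd
  have hsym := UC_symb_iff (𝕜 := 𝕜) hn h hTG hpath s
  rw [← hcard]
  unfold sdefect
  have hIiff : ∀ f : MvPolynomial V 𝕜, f ∈ edgeIdeal 𝕜 G ^ s ↔
      ∀ m ∈ f.support, ∃ v ∈ UCP (UCE G) s, v ≤ m := by
    intro f
    rw [UC_pow_eq, MvPolynomial.mem_ideal_span_monomial_image]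
  have hBel : ∀ b ∈ UCB G n k r (UCc n p), ∃ i < k,
      ∃ g ∈ UCGe G n (UCc n p) (i * (n + 1) + r), b = (k - i) • UCc n p + g := by
    intro b hb
    unfold UCB at hb
    simp only [Set.mem_iUnion, Finset.mem_range] at hb
    obtain ⟨i, hi, g, hg, rfl⟩ := hb
    exact ⟨i, hi, g, hg, rfl⟩
  have hmulk : ∀ i ≤ k, s - (k - i) * (n + 1) = i * (n + 1) + r ∧ (k - i) * (n + 1) ≤ s := by
    intro i hi
    obtain ⟨t, rfl⟩ := Nat.exists_eq_add_of_le hi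
    have : s = t * (n + 1) + (i * (n + 1) + r) := by rw [hs]; ring
    rw [show i + t - i = t by omega]
    omega
  have hBdeg : ∀ b ∈ UCB G n k r (UCc n p), b.degree < 2 * s := by
    intro b hb
    obtain ⟨i, hi, g, hg, rfl⟩ := hBel b hb
    have hdg := UCP_degree hg.1
    rw [map_add, map_nsmul, hd, hdg, smul_eq_mul]
    obtain ⟨h1, h2⟩ := hmulk i hi.le
    have : (k - i) * (2 * n + 1) + (k - i) = 2 * ((k - i) * (n + 1)) := by ring
    omega
  apply UC_mu
  · exact hfin
  · intro f hf
    rw [hsym]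
    rw [hIiff] at hf
    intro m hm
    obtain ⟨v, hv, hle⟩ := hf m hm
    exact ⟨0, by omega, v, by simpa using hv, by simpa using hle⟩
  · intro b hb
    obtain ⟨i, hi, g, hg, rfl⟩ := hBel b hb
    obtain ⟨h1, h2⟩ := hmulk i hi.le
    rw [hsym]
    intro m hm
    have hm' := support_monomial_subset hm
    rw [Finset.mem_singleton] at hm'
    subst hm'
    exact ⟨k - i, h2, g, by rw [h1]; exact hg.1, by rw [add_comm]⟩
  · intro f hf
    rw [hsym] at hf
    rw [UC_pow_eq, ← Ideal.span_union, ← Set.image_union,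
      MvPolynomial.mem_ideal_span_monomial_image]
    intro m hm
    have hex := hf m hm
    let Q : ℕ → Prop := fun i => i * (n + 1) ≤ s ∧
      ∃ v ∈ UCP (UCE G) (s - i * (n + 1)), v + i • UCc n p ≤ m
    have hbd : ∀ i, Q i → i ≤ k := by
      intro i hi
      by_contra hlt
      have h1 : (k + 1) * (n + 1) ≤ i * (n + 1) := Nat.mul_le_mul_right _ (by omega)
      have h2 : (k + 1) * (n + 1) = k * (n + 1) + (n + 1) := by ring
      have := hi.1
      omega
    classical
    obtain ⟨i0, hi0⟩ : ∃ i, Q i := hex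
    have hQ : Q (Nat.findGreatest Q k) := Nat.findGreatest_spec (hbd i0 hi0) hi0
    have hmax : ∀ j, Nat.findGreatest Q k < j → ¬ Q j := fun j hj hQj =>
      Nat.findGreatest_is_greatest hj (hbd j hQj) hQj
    have hik := hbd _ hQ
    generalize Nat.findGreatest Q k = i at hQ hmax hik
    obtain ⟨his, v, hv, hle⟩ := hQ
    rcases Nat.eq_zero_or_pos i with rfl | hipos
    · exact ⟨v, Or.inl (by simpa using hv), by simpa using hle⟩
    · refine ⟨i • UCc n p + v, Or.inr ?_, by rwa [add_comm]⟩
      obtain ⟨h1, h2⟩ := hmulk (k - i) (by omega)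
      rw [show k - (k - i) = i by omega] at h1 h2
      unfold UCB
      simp only [Set.mem_iUnion, Finset.mem_range]
      refine ⟨k - i, by omega, v, ⟨by rw [← h1]; exact hv, ?_⟩, ?_⟩
      · rintro hlt ⟨w, hw, hwle⟩
        apply hmax (i + 1) (by omega)
        have e : (i + 1) * (n + 1) = i * (n + 1) + (n + 1) := by ring
        refine ⟨by omega, w, ?_, ?_⟩
        · rw [show s - (i + 1) * (n + 1) = (k - i) * (n + 1) + r - (n + 1) by omega]
          exact hw
        · refine le_trans ?_ hle
          rw [add_nsmul, one_nsmul, add_comm (i • _), ← add_assoc]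
          exact add_le_add_left hwle _
      · simp only
        rw [show k - (k - i) = i by omega]
  · intro b hb f hf
    by_contra hne
    rw [hIiff] at hf
    obtain ⟨v, hv, hle⟩ := hf b (mem_support_iff.mpr hne)
    have h1 := UCP_degree hv
    have h2 := hBdeg b hb
    have h3 : v.degree ≤ b.degree := Finsupp.degree_mono hle
    omega
  · intro b hb f hf m hm hmb
    rw [hsym] at hf
    obtain ⟨i', his, v, hv, hle⟩ := hf m hm
    obtain ⟨i, hi, g, hg, rfl⟩ := hBel b hb
    obtain ⟨h1, h2⟩ := hmulk i hi.le
    have hle' := hle.trans hmb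
    by_cases hcmp : i' ≤ k - i
    · have hdeg : (v + i' • UCc n p).degree = s * 2 - i' := by
        rw [map_add, map_nsmul, hd, UCP_degree hv, smul_eq_mul]
        have : i' * (2 * n + 1) + i' = 2 * (i' * (n + 1)) := by ring
        omega
      have hdeg2 : ((k - i) • UCc n p + g).degree = s * 2 - (k - i) := by
        rw [map_add, map_nsmul, hd, UCP_degree hg.1, smul_eq_mul]
        have : (k - i) * (2 * n + 1) + (k - i) = 2 * ((k - i) * (n + 1)) := by ring
        omega
      have hmono : (v + i' • UCc n p).degree ≤ ((k - i) • UCc n p + g).degree :=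
        Finsupp.degree_mono hle'
      have hmono2 : m.degree ≤ ((k - i) • UCc n p + g).degree := Finsupp.degree_mono hmb
      have hmono3 : (v + i' • UCc n p).degree ≤ m.degree := Finsupp.degree_mono hle
      exact UC_eq_of_le_degree hmb (by omega)
    · exfalso
      obtain ⟨t, rfl⟩ := Nat.exists_eq_add_of_lt (not_le.mp hcmp)
      have e : (k - i + t + 1) * (n + 1) = (k - i) * (n + 1) + (t + 1) * (n + 1) := by ring
      have hn1 : (t + 1) * (n + 1) = t * (n + 1) + (n + 1) := by ring
      have hlt : n < i * (n + 1) + r := by omega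
      refine hg.2 hlt (UC_concave hn h hTG (i * (n + 1) + r) (t + 1) (by omega) (by omega) g v hg.1
        ?_ ?_)
      · rw [show i * (n + 1) + r - (t + 1) * (n + 1) = s - (k - i + t + 1) * (n + 1) by omega]
        exact hv
      · have e2 : v + (k - i + t + 1) • UCc n p = (k - i) • UCc n p + (v + (t + 1) • UCc n p) := by
          rw [add_assoc (k - i), add_nsmul]; abel
        rw [e2] at hle'
        exact le_of_add_le_add_left hle'

end

/-- for the edge ideal `I` of a unicyclic graph with unique odd cycle `C_{2n+1}`
and `s = k(n+1) + r` with `k ≥ 1` and `0 ≤ r ≤ n`, one has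
`sdefect(I, s) = Σ_{i=0}^{k-1} |𝒢_{i(n+1)+r}|`. -/
theorem unicyclic_sdefect_sum {V : Type} [Fintype V] (𝕜 : Type) [Field 𝕜]
    (G : SimpleGraph V) (n : ℕ) (hn : 1 ≤ n)
    (x : ZMod (2 * n + 1) → V) (hx : IsUnicyclicOddCycle G n x)
    (c : MvPolynomial V 𝕜) (hc : c = ∏ j : ZMod (2 * n + 1), X (x j))
    (s k r : ℕ) (hs : s = k * (n + 1) + r) (hk : 1 ≤ k) (hr : r ≤ n) :
    sdefect (edgeIdeal 𝕜 G) s =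
      ∑ i ∈ Finset.range k, (GSet 𝕜 (edgeIdeal 𝕜 G) c n (i * (n + 1) + r)).ncard := by
  classical
  obtain ⟨T, χ, h1, h2, h3⟩ := UC_setup hn hx
  rw [hc, UC_c]
  simp only [UC_GSet_ncard]
  exact UC_final hn h1 h2 h3 s k r hs hr

end
end

section
/- Let I = I(C_5) ⊆ 𝕜[x_1,…,x_5] be the edge ideal of the 5-cycle C_5 = (x_1,…,x_5). Then for every s ≥ 1, the s-th symbolic defect is given by: sdefect(I, s) = (15/2)k³ − (15/2)k² + 1 if s = 3k; sdefect(I, s) = (15/2)k³ − (5/2)k if s = 3k+1; and sdefect(I, s) = (15/2)k³ + (15/2)k² if s = 3k+2. -/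
open MvPolynomial

noncomputable section

/-- The edge ideal of the 5-cycle `C_5 = (x_1, …, x_5)`:
`I(C_5) = ⟨x_1x_2, x_2x_3, x_3x_4, x_4x_5, x_5x_1⟩`. -/
def edgeIdealC5 (𝕜 : Type) [Field 𝕜] : Ideal (MvPolynomial (Fin 5) 𝕜) :=
  Ideal.span {X 0 * X 1, X 1 * X 2, X 2 * X 3, X 3 * X 4, X 4 * X 0}


/-! ### Weight valuations -/

abbrev RR (𝕜 : Type) [Field 𝕜] := MvPolynomial (Fin 5) 𝕜

def wtHom (𝕜 : Type) [Field 𝕜] (w : Fin 5 → ℕ) : RR 𝕜 →+* Polynomial (RR 𝕜) :=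
  eval₂Hom (Polynomial.C.comp MvPolynomial.C)
    (fun i => Polynomial.C (X i) * Polynomial.X ^ (w i))

def wt (w : Fin 5 → ℕ) (a : Fin 5 →₀ ℕ) : ℕ := ∑ v, w v * a v

lemma wtHom_monomial (𝕜 : Type) [Field 𝕜] (w : Fin 5 → ℕ) (a : Fin 5 →₀ ℕ) (c : 𝕜) :
    wtHom 𝕜 w (monomial a c) = Polynomial.C (monomial a c) * Polynomial.X ^ (wt w a) := by
  unfold wtHom wt
  rw [coe_eval₂Hom, eval₂_monomial, monomial_eq, Finsupp.prod_fintype _ _ (by simp),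
    Finsupp.prod_fintype _ _ (by simp)]
  simp only [mul_pow, Finset.prod_mul_distrib, ← pow_mul, Finset.prod_pow_eq_pow_sum]
  simp [mul_assoc, map_prod]

lemma wtHom_coeff (𝕜 : Type) [Field 𝕜] (w : Fin 5 → ℕ) (f : RR 𝕜) (d : ℕ) (a : Fin 5 →₀ ℕ) :
    coeff a ((wtHom 𝕜 w f).coeff d) = if wt w a = d then coeff a f else 0 := by
  induction f using MvPolynomial.induction_on' with
  | monomial b c =>
    rw [wtHom_monomial, Polynomial.coeff_C_mul, Polynomial.coeff_X_pow]
    by_cases h : b = a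
    · subst h
      by_cases h2 : wt w b = d
      · simp [h2]
      · simp [h2, show ¬ d = wt w b from fun h => h2 h.symm]
    · by_cases h2 : d = wt w b <;> simp [h2, coeff_monomial, h]
  | add p q hp hq =>
    rw [map_add, Polynomial.coeff_add, coeff_add, hp, hq, coeff_add]
    split_ifs <;> simp

def wtIdeal (𝕜 : Type) [Field 𝕜] (w : Fin 5 → ℕ) (n : ℕ) : Ideal (RR 𝕜) :=
  Ideal.comap (wtHom 𝕜 w) (Ideal.span {Polynomial.X ^ n})

lemma mem_wtIdeal_dvd {𝕜 : Type} [Field 𝕜] {w : Fin 5 → ℕ} {n : ℕ} {f : RR 𝕜} :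
    f ∈ wtIdeal 𝕜 w n ↔ Polynomial.X ^ n ∣ wtHom 𝕜 w f := by
  rw [wtIdeal, Ideal.mem_comap, Ideal.mem_span_singleton]

lemma mem_wtIdeal {𝕜 : Type} [Field 𝕜] {w : Fin 5 → ℕ} {n : ℕ} {f : RR 𝕜} :
    f ∈ wtIdeal 𝕜 w n ↔ ∀ a, coeff a f ≠ 0 → n ≤ wt w a := by
  rw [mem_wtIdeal_dvd, Polynomial.X_pow_dvd_iff]
  constructor
  · intro h a ha
    by_contra hlt
    have := h (wt w a) (by omega)
    have h2 := wtHom_coeff 𝕜 w f (wt w a) a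
    rw [this] at h2
    simp at h2
    exact ha h2.symm
  · intro h d hd
    ext a
    rw [wtHom_coeff]
    split_ifs with h1
    · by_contra h2
      have := h a (by simpa using h2)
      omega
    · simp

lemma wtIdeal_mul {𝕜 : Type} [Field 𝕜] (w : Fin 5 → ℕ) (m n : ℕ) :
    wtIdeal 𝕜 w m * wtIdeal 𝕜 w n ≤ wtIdeal 𝕜 w (m + n) := by
  rw [Ideal.mul_le]
  intro r hr t ht
  rw [mem_wtIdeal_dvd] at *
  rw [map_mul, pow_add]
  exact mul_dvd_mul hr ht

lemma pow_le_wtIdeal {𝕜 : Type} [Field 𝕜] (w : Fin 5 → ℕ) (c : ℕ) (I : Ideal (RR 𝕜))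
    (h : I ≤ wtIdeal 𝕜 w c) (s : ℕ) : I ^ s ≤ wtIdeal 𝕜 w (c * s) := by
  induction s with
  | zero => intro f _; rw [mem_wtIdeal]; simp
  | succ n ih =>
    rw [pow_succ]
    exact (Ideal.mul_mono ih h).trans (wtIdeal_mul w _ _)

lemma wtIdeal_cancel {𝕜 : Type} [Field 𝕜] {w : Fin 5 → ℕ} {n : ℕ} {u f : RR 𝕜}
    (hu : u ∉ wtIdeal 𝕜 w 1) (h : u * f ∈ wtIdeal 𝕜 w n) : f ∈ wtIdeal 𝕜 w n := by
  rw [mem_wtIdeal_dvd] at *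
  rw [map_mul] at h
  rw [pow_one] at hu
  exact Polynomial.prime_X.pow_dvd_of_dvd_mul_left n hu h

lemma wtIdeal_one_prime (𝕜 : Type) [Field 𝕜] (w : Fin 5 → ℕ) : (wtIdeal 𝕜 w 1).IsPrime := by
  have : (Ideal.span {(Polynomial.X ^ 1 : Polynomial (RR 𝕜))}).IsPrime := by
    rw [pow_one, Ideal.span_singleton_prime Polynomial.X_ne_zero]
    exact Polynomial.prime_X
  exact Ideal.comap_isPrime _ _

lemma monomial_mem_wtIdeal {𝕜 : Type} [Field 𝕜] {w : Fin 5 → ℕ} {n : ℕ} {a : Fin 5 →₀ ℕ} :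
    (monomial a (1 : 𝕜)) ∈ wtIdeal 𝕜 w n ↔ n ≤ wt w a := by
  rw [mem_wtIdeal]
  constructor
  · intro h; exact h a (by simp)
  · intro h b hb
    rw [coeff_monomial] at hb
    split_ifs at hb with h1
    · rwa [← h1]
    · simp at hb

lemma X_mem_wtIdeal {𝕜 : Type} [Field 𝕜] {w : Fin 5 → ℕ} {n : ℕ} {i : Fin 5} :
    (X i : RR 𝕜) ∈ wtIdeal 𝕜 w n ↔ n ≤ w i := by
  rw [X, monomial_mem_wtIdeal]
  simp [wt, Finsupp.single_apply]

lemma mem_of_monomials {𝕜 : Type} [Field 𝕜] (I : Ideal (RR 𝕜)) (f : RR 𝕜)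
    (h : ∀ a, coeff a f ≠ 0 → monomial a (1 : 𝕜) ∈ I) : f ∈ I := by
  rw [f.as_sum]
  refine Ideal.sum_mem _ fun a ha => ?_
  have : monomial a (coeff a f) = C (coeff a f) * monomial a (1 : 𝕜) := by
    rw [C_mul_monomial, mul_one]
  rw [this]
  exact Ideal.mul_mem_left _ _ (h a (mem_support_iff.mp ha))

/-! ### The cycle -/

def cov (i v : Fin 5) : ℕ := if v = i ∨ v = i + 1 ∨ v = i + 3 then 1 else 0

lemma wt_cov (i : Fin 5) (a : Fin 5 →₀ ℕ) :
    wt (cov i) a = a i + a (i + 1) + a (i + 3) := by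
  unfold wt
  rw [Fin.sum_univ_five]
  fin_cases i <;> simp [cov, Fin.ext_iff] <;> ring

abbrev PP (𝕜 : Type) [Field 𝕜] (i : Fin 5) : Ideal (RR 𝕜) := wtIdeal 𝕜 (cov i) 1

lemma edge_mem (𝕜 : Type) [Field 𝕜] (i : Fin 5) : (X i * X (i + 1) : RR 𝕜) ∈ edgeIdealC5 𝕜 := by
  apply Ideal.subset_span
  fin_cases i <;> simp

lemma edge_mem' (𝕜 : Type) [Field 𝕜] (i j : Fin 5) (h : j = i + 1 ∨ i = j + 1) :
    (X i * X j : RR 𝕜) ∈ edgeIdealC5 𝕜 := by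
  rcases h with rfl | rfl
  · exact edge_mem 𝕜 i
  · rw [mul_comm]; exact edge_mem 𝕜 j

lemma edgeIdeal_le {𝕜 : Type} [Field 𝕜] (J : Ideal (RR 𝕜))
    (h : ∀ i : Fin 5, (X i * X (i + 1) : RR 𝕜) ∈ J) : edgeIdealC5 𝕜 ≤ J := by
  rw [edgeIdealC5, Ideal.span_le]
  have h0 := h 0
  have h1 := h 1
  have h2 := h 2
  have h3 := h 3
  have h4 := h 4
  rintro x (rfl | rfl | rfl | rfl | rfl) <;> assumption

lemma edgeIdeal_le_PP (𝕜 : Type) [Field 𝕜] (i : Fin 5) : edgeIdealC5 𝕜 ≤ PP 𝕜 i := by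
  apply edgeIdeal_le
  intro j
  have : 1 ≤ cov i j ∨ 1 ≤ cov i (j + 1) := by revert i j; decide
  rcases this with h | h
  · exact Ideal.mul_mem_right _ _ (X_mem_wtIdeal.mpr h)
  · exact Ideal.mul_mem_left _ _ (X_mem_wtIdeal.mpr h)

lemma edgeIdeal_le_deg (𝕜 : Type) [Field 𝕜] : edgeIdealC5 𝕜 ≤ wtIdeal 𝕜 (fun _ => 1) 2 := by
  apply edgeIdeal_le
  intro j
  exact wtIdeal_mul _ 1 1 (Ideal.mul_mem_mul (X_mem_wtIdeal.mpr le_rfl) (X_mem_wtIdeal.mpr le_rfl))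

lemma wt_deg (a : Fin 5 →₀ ℕ) : wt (fun _ => 1) a = a 0 + a 1 + a 2 + a 3 + a 4 := by
  simp [wt, Fin.sum_univ_five]

lemma monomial_split {𝕜 : Type} [Field 𝕜] (a : Fin 5 →₀ ℕ) (b : Fin 5 →₀ ℕ) (h : b ≤ a) :
    (monomial a (1 : 𝕜)) = monomial b 1 * monomial (a - b) 1 := by
  rw [monomial_mul, one_mul, add_tsub_cancel_of_le h]

lemma single_le_of {a : Fin 5 →₀ ℕ} {i : Fin 5} {n : ℕ} (h : n ≤ a i) :
    Finsupp.single i n ≤ a := by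
  classical
  intro v
  rw [Finsupp.single_apply]
  split_ifs with h1
  · subst h1; exact h
  · exact Nat.zero_le _

def edgeExp (i : Fin 5) : Fin 5 →₀ ℕ := Finsupp.single i 1 + Finsupp.single (i + 1) 1

lemma monomial_edgeExp (𝕜 : Type) [Field 𝕜] (i : Fin 5) :
    (monomial (edgeExp i) (1 : 𝕜)) = X i * X (i + 1) := by
  rw [edgeExp, X, X, monomial_mul, one_mul]

lemma edgeExp_le {a : Fin 5 →₀ ℕ} {i : Fin 5} (h : 1 ≤ a i) (h' : 1 ≤ a (i + 1)) :
    edgeExp i ≤ a := by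
  intro v
  have hne : i ≠ i + 1 := by clear * -; revert i; decide
  rw [edgeExp, Finsupp.add_apply, Finsupp.single_apply, Finsupp.single_apply]
  split_ifs with h1 h2 h2
  · exact absurd (h1.trans h2.symm) hne
  · subst h1; simpa using h
  · subst h2; simpa using h'
  · simp

/-- Powers of the edge ideal contain all monomials satisfying the covering inequalities and the
degree inequality. -/
lemma mem_pow_edgeIdeal (𝕜 : Type) [Field 𝕜] (s : ℕ) : ∀ (a : Fin 5 →₀ ℕ),
    (∀ i, s ≤ a i + a (i + 1) + a (i + 3)) → 2 * s ≤ a 0 + a 1 + a 2 + a 3 + a 4 →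
    monomial a (1 : 𝕜) ∈ edgeIdealC5 𝕜 ^ s := by
  induction s with
  | zero => intro a _ _; simp
  | succ s ih =>
    intro a hc hd
    have key : ∃ i, 1 ≤ a i ∧ 1 ≤ a (i + 1) ∧ s + 2 ≤ a i + a (i + 1) + a (i + 3) := by
      by_contra hcon
      push Not at hcon
      have h0 := hc 0
      have h1 := hc 1
      have h2 := hc 2
      have h3 := hc 3
      have h4 := hc 4
      have g0 := hcon 0
      have g1 := hcon 1
      have g2 := hcon 2
      have g3 := hcon 3
      have g4 := hcon 4
      simp only [Fin.isValue, Fin.reduceAdd, zero_add] at *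
      generalize a 0 = x0 at *
      generalize a 1 = x1 at *
      generalize a 2 = x2 at *
      generalize a 3 = x3 at *
      generalize a 4 = x4 at *
      clear hc hcon ih
      omega
    obtain ⟨i, hi, hi1, hi3⟩ := key
    have hle := edgeExp_le hi hi1
    rw [monomial_split a _ hle, pow_succ', monomial_edgeExp]
    refine Ideal.mul_mem_mul (edge_mem 𝕜 i) (ih _ ?_ ?_)
    · intro j
      have hj := hc j
      fin_cases i <;> fin_cases j <;>
        simp [edgeExp, Fin.ext_iff] at * <;> omega
    · fin_cases i <;> simp [edgeExp] at * <;> omega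

lemma mem_edgeIdeal_of_PP {𝕜 : Type} [Field 𝕜] (f : RR 𝕜) (h : ∀ i, f ∈ PP 𝕜 i) :
    f ∈ edgeIdealC5 𝕜 := by
  rw [← pow_one (edgeIdealC5 𝕜)]
  apply mem_of_monomials
  intro a ha
  have hc : ∀ i, 1 ≤ a i + a (i + 1) + a (i + 3) := by
    intro i
    have := mem_wtIdeal.mp (h i) a ha
    rwa [wt_cov] at this
  apply mem_pow_edgeIdeal 𝕜 1 a hc
  have h0 := hc 0
  have h1 := hc 1
  have h2 := hc 2
  have h3 := hc 3
  have h4 := hc 4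
  simp only [Fin.isValue, Fin.reduceAdd, zero_add] at *
  omega

lemma PP_le_of {𝕜 : Type} [Field 𝕜] (i : Fin 5) (J : Ideal (RR 𝕜)) (h0 : X i ∈ J)
    (h1 : X (i + 1) ∈ J) (h3 : X (i + 3) ∈ J) : PP 𝕜 i ≤ J := by
  intro f hf
  apply mem_of_monomials
  intro a ha
  have := mem_wtIdeal.mp hf a ha
  rw [wt_cov] at this
  have : 1 ≤ a i ∨ 1 ≤ a (i + 1) ∨ 1 ≤ a (i + 3) := by omega
  rcases this with h | h | h <;> rw [monomial_split a _ (single_le_of h)] <;>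
    exact Ideal.mul_mem_right _ _ (by assumption)

lemma comp_mul_mem (𝕜 : Type) [Field 𝕜] (i : Fin 5) (f : RR 𝕜) (hf : f ∈ PP 𝕜 i) :
    f * (X (i + 2) * X (i + 4)) ∈ edgeIdealC5 𝕜 := by
  have : PP 𝕜 i ≤ Submodule.comap (LinearMap.mulRight (RR 𝕜) (X (i + 2) * X (i + 4))) (edgeIdealC5 𝕜) := by
    apply PP_le_of
    · have : (X i * (X (i + 2) * X (i + 4)) : RR 𝕜) = X (i + 2) * (X i * X (i + 4)) := by ring
      simp only [Submodule.mem_comap, LinearMap.mulRight_apply, this]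
      exact Ideal.mul_mem_left _ _ (edge_mem' _ _ _ (by clear * -; revert i; decide))
    · have : (X (i + 1) * (X (i + 2) * X (i + 4)) : RR 𝕜) = X (i + 4) * (X (i + 1) * X (i + 2)) := by
        ring
      simp only [Submodule.mem_comap, LinearMap.mulRight_apply, this]
      exact Ideal.mul_mem_left _ _ (edge_mem' _ _ _ (by clear * -; revert i; decide))
    · have : (X (i + 3) * (X (i + 2) * X (i + 4)) : RR 𝕜) = X (i + 4) * (X (i + 3) * X (i + 2)) := by
        ring
      simp only [Submodule.mem_comap, LinearMap.mulRight_apply, this]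
      exact Ideal.mul_mem_left _ _ (edge_mem' _ _ _ (by clear * -; revert i; decide))
  exact this hf

lemma X2_not_mem (𝕜 : Type) [Field 𝕜] (i : Fin 5) : (X (i + 2) : RR 𝕜) ∉ PP 𝕜 i := by
  rw [X_mem_wtIdeal]; revert i; decide

lemma X4_not_mem (𝕜 : Type) [Field 𝕜] (i : Fin 5) : (X (i + 4) : RR 𝕜) ∉ PP 𝕜 i := by
  rw [X_mem_wtIdeal]; revert i; decide

lemma comp_not_mem (𝕜 : Type) [Field 𝕜] (i : Fin 5) :
    (X (i + 2) * X (i + 4) : RR 𝕜) ∉ PP 𝕜 i := by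
  intro h
  rcases (wtIdeal_one_prime 𝕜 (cov i)).mem_or_mem h with h | h
  · exact X2_not_mem 𝕜 i h
  · exact X4_not_mem 𝕜 i h

lemma mem_colon_mk {R : Type} [CommRing R] (I : Ideal R) (g r : R) :
    r ∈ Submodule.colon (⊥ : Submodule R (R ⧸ I)) {Ideal.Quotient.mk I g} ↔ r * g ∈ I := by
  rw [Submodule.mem_colon_singleton, Submodule.mem_bot, ← Ideal.Quotient.eq_zero_iff_mem, map_mul]
  rfl

lemma PP_mem_ass (𝕜 : Type) [Field 𝕜] (i : Fin 5) :
    PP 𝕜 i ∈ associatedPrimes (RR 𝕜) (RR 𝕜 ⧸ edgeIdealC5 𝕜) := by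
  have hp := wtIdeal_one_prime 𝕜 (cov i)
  refine ⟨hp, Ideal.Quotient.mk _ (X (i + 2) * X (i + 4)), ?_⟩
  apply le_antisymm
  · intro f hf
    apply Ideal.le_radical
    rw [mem_colon_mk]
    exact comp_mul_mem 𝕜 i f hf
  · rintro f ⟨n, hn⟩
    rw [mem_colon_mk] at hn
    rcases hp.mem_or_mem (edgeIdeal_le_PP 𝕜 i hn) with h | h
    · exact hp.mem_of_pow_mem _ h
    · exact absurd h (comp_not_mem 𝕜 i)

lemma ass_eq_PP (𝕜 : Type) [Field 𝕜] (p : Ideal (RR 𝕜))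
    (h : p ∈ associatedPrimes (RR 𝕜) (RR 𝕜 ⧸ edgeIdealC5 𝕜)) : ∃ i, p = PP 𝕜 i := by
  obtain ⟨hp, x, hx⟩ := h
  obtain ⟨g, rfl⟩ := Ideal.Quotient.mk_surjective x
  have hI : edgeIdealC5 𝕜 ≤ p := by
    intro f hf
    rw [hx]
    apply Ideal.le_radical
    rw [mem_colon_mk]
    exact Ideal.mul_mem_right _ _ hf
  have hg : g ∉ edgeIdealC5 𝕜 := by
    intro hg
    apply hp.ne_top
    rw [Ideal.eq_top_iff_one, hx]
    apply Ideal.le_radical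
    rw [mem_colon_mk]
    simpa using hg
  obtain ⟨i, hi⟩ : ∃ i, g ∉ PP 𝕜 i := by
    by_contra hcon
    push Not at hcon
    exact hg (mem_edgeIdeal_of_PP g hcon)
  have hP := wtIdeal_one_prime 𝕜 (cov i)
  have hle : p ≤ PP 𝕜 i := by
    intro f hf
    rw [hx] at hf
    obtain ⟨n, hn⟩ := hf
    rw [mem_colon_mk] at hn
    rcases hP.mem_or_mem (edgeIdeal_le_PP 𝕜 i hn) with h | h
    · exact hP.mem_of_pow_mem _ h
    · exact absurd h hi
  refine ⟨i, le_antisymm hle (PP_le_of i p ?_ ?_ ?_)⟩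
  · have : (X i * X (i + 4) : RR 𝕜) ∈ p := hI (edge_mem' _ _ _ (by clear hle hP hi; revert i; decide))
    exact (hp.mem_or_mem this).resolve_right fun h => X4_not_mem 𝕜 i (hle h)
  · have : (X (i + 1) * X (i + 2) : RR 𝕜) ∈ p := hI (edge_mem' _ _ _ (by clear hle hP hi; revert i; decide))
    exact (hp.mem_or_mem this).resolve_right fun h => X2_not_mem 𝕜 i (hle h)
  · have : (X (i + 3) * X (i + 4) : RR 𝕜) ∈ p := hI (edge_mem' _ _ _ (by clear hle hP hi; revert i; decide))
    exact (hp.mem_or_mem this).resolve_right fun h => X4_not_mem 𝕜 i (hle h)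

lemma mem_localizationComap {R : Type} [CommRing R] (p : Ideal R) (hp : p.IsPrime) (J : Ideal R)
    (f : R) : f ∈ localizationComap p hp J ↔ ∃ u, u ∉ p ∧ u * f ∈ J := by
  unfold localizationComap
  rw [Ideal.mem_comap, IsLocalization.algebraMap_mem_map_algebraMap_iff p.primeCompl]
  rfl

lemma monomial_loc (𝕜 : Type) [Field 𝕜] (i : Fin 5) (s : ℕ) : ∀ (a : Fin 5 →₀ ℕ),
    s ≤ a i + a (i + 1) + a (i + 3) →
    monomial a (1 : 𝕜) * (X (i + 2) * X (i + 4)) ^ s ∈ edgeIdealC5 𝕜 ^ s := by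
  induction s with
  | zero => intro a _; simp
  | succ s ih =>
    intro a ha
    obtain ⟨v, hv, hva, hs⟩ : ∃ v : Fin 5, (v = i ∨ v = i + 1 ∨ v = i + 3) ∧ 1 ≤ a v ∧
        s ≤ (a - Finsupp.single v 1 : Fin 5 →₀ ℕ) i + (a - Finsupp.single v 1 : Fin 5 →₀ ℕ) (i + 1) +
          (a - Finsupp.single v 1 : Fin 5 →₀ ℕ) (i + 3) := by
      have : 1 ≤ a i ∨ 1 ≤ a (i + 1) ∨ 1 ≤ a (i + 3) := by omega
      rcases this with h | h | h
      · refine ⟨i, by simp, h, ?_⟩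
        fin_cases i <;> simp at * <;> omega
      · refine ⟨i + 1, by simp, h, ?_⟩
        fin_cases i <;> simp at * <;> omega
      · refine ⟨i + 3, by simp, h, ?_⟩
        fin_cases i <;> simp at * <;> omega
    rw [monomial_split a _ (single_le_of hva), pow_succ', pow_succ', mul_mul_mul_comm]
    refine Ideal.mul_mem_mul (comp_mul_mem 𝕜 i _ ?_) (ih _ hs)
    refine X_mem_wtIdeal.mpr ?_
    simp [cov, hv]

lemma mem_symbolic (𝕜 : Type) [Field 𝕜] (s : ℕ) (f : RR 𝕜) :
    f ∈ symbolicPower (edgeIdealC5 𝕜) s ↔ ∀ i, f ∈ wtIdeal 𝕜 (cov i) s := by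
  unfold symbolicPower
  rw [Submodule.mem_sInf]
  constructor
  · intro h i
    have := h _ ⟨PP 𝕜 i, wtIdeal_one_prime 𝕜 (cov i), PP_mem_ass 𝕜 i, rfl⟩
    rw [mem_localizationComap] at this
    obtain ⟨u, hu, huf⟩ := this
    have h2 := pow_le_wtIdeal (cov i) 1 _ (edgeIdeal_le_PP 𝕜 i) s huf
    rw [one_mul] at h2
    exact wtIdeal_cancel hu h2
  · rintro h J ⟨p, hp, hass, rfl⟩
    obtain ⟨i, rfl⟩ := ass_eq_PP 𝕜 p hass
    apply mem_of_monomials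
    intro a ha
    rw [mem_localizationComap]
    refine ⟨(X (i + 2) * X (i + 4)) ^ s, fun hcon => comp_not_mem 𝕜 i (hp.mem_of_pow_mem _ hcon), ?_⟩
    rw [mul_comm]
    apply monomial_loc
    have := mem_wtIdeal.mp (h i) a ha
    rwa [wt_cov] at this

/-! ### Reduction to counting minimal generators -/

def InSym (s : ℕ) (a : Fin 5 →₀ ℕ) : Prop := ∀ i, s ≤ a i + a (i + 1) + a (i + 3)

def Gen (s : ℕ) (a : Fin 5 →₀ ℕ) : Prop :=
  InSym s a ∧ a 0 + a 1 + a 2 + a 3 + a 4 < 2 * s ∧ ∀ b ≤ a, InSym s b → b = a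

lemma mem_symbolic' (𝕜 : Type) [Field 𝕜] (s : ℕ) (f : RR 𝕜) :
    f ∈ symbolicPower (edgeIdealC5 𝕜) s ↔ ∀ a, coeff a f ≠ 0 → InSym s a := by
  rw [mem_symbolic]
  simp only [mem_wtIdeal, wt_cov, InSym]
  exact ⟨fun h a ha i => h i a ha, fun h i a ha => h a ha i⟩

lemma monomial_mem_symbolic (𝕜 : Type) [Field 𝕜] (s : ℕ) (a : Fin 5 →₀ ℕ) (h : InSym s a) :
    monomial a (1 : 𝕜) ∈ symbolicPower (edgeIdealC5 𝕜) s := by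
  rw [mem_symbolic']
  intro b hb
  rw [coeff_monomial] at hb
  split_ifs at hb with h1
  · rwa [← h1]
  · simp at hb

lemma pow_le_symbolic (𝕜 : Type) [Field 𝕜] (s : ℕ) :
    edgeIdealC5 𝕜 ^ s ≤ symbolicPower (edgeIdealC5 𝕜) s := by
  intro f hf
  rw [mem_symbolic]
  intro i
  have h2 := pow_le_wtIdeal (cov i) 1 _ (edgeIdeal_le_PP 𝕜 i) s hf
  rwa [one_mul] at h2

lemma coeff_pow_eq_zero {𝕜 : Type} [Field 𝕜] {s : ℕ} {a : Fin 5 →₀ ℕ} (ha : Gen s a) {f : RR 𝕜}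
    (hf : f ∈ edgeIdealC5 𝕜 ^ s) : coeff a f = 0 := by
  by_contra h
  have h2 := mem_wtIdeal.mp (pow_le_wtIdeal _ 2 _ (edgeIdeal_le_deg 𝕜) s hf) a h
  rw [wt_deg] at h2
  have := ha.2.1
  omega

lemma coeff_mul_gen {𝕜 : Type} [Field 𝕜] {s : ℕ} {a : Fin 5 →₀ ℕ} (ha : Gen s a) {f : RR 𝕜}
    (hf : f ∈ symbolicPower (edgeIdealC5 𝕜) s) (r : RR 𝕜) :
    coeff a (r * f) = coeff 0 r * coeff a f := by
  classical
  rw [coeff_mul, Finset.sum_eq_single ((0, a) : (Fin 5 →₀ ℕ) × (Fin 5 →₀ ℕ))]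
  · rintro ⟨x, y⟩ hxy hne
    rw [Finset.HasAntidiagonal.mem_antidiagonal] at hxy
    simp only at hxy ⊢
    by_cases hy : coeff y f = 0
    · rw [hy, mul_zero]
    · exfalso
      have hs := (mem_symbolic' 𝕜 s f).mp hf y hy
      have hya : y = a := ha.2.2 y (by rw [← hxy]; exact le_add_self) hs
      subst hya
      apply hne
      have : x = 0 := by simpa using hxy
      rw [this]
  · intro h
    exact absurd (by simp) h

lemma exists_minimal_le (s : ℕ) (a : Fin 5 →₀ ℕ) (h : InSym s a) :
    ∃ b ≤ a, InSym s b ∧ ∀ c ≤ b, InSym s c → c = b := by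
  induction a using WellFoundedLT.induction with
  | ind a ih =>
    by_cases hm : ∀ c ≤ a, InSym s c → c = a
    · exact ⟨a, le_rfl, h, hm⟩
    · push Not at hm
      obtain ⟨c, hc, hs, hne⟩ := hm
      obtain ⟨b, hb, h1, h2⟩ := ih c (lt_of_le_of_ne hc hne) hs
      exact ⟨b, hb.trans hc, h1, h2⟩

theorem sdefect_eq_card (𝕜 : Type) [Field 𝕜] (s : ℕ) (B : Finset (Fin 5 →₀ ℕ))
    (hB : ∀ a, a ∈ B ↔ Gen s a) : sdefect (edgeIdealC5 𝕜) s = B.card := by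
  classical
  unfold sdefect
  apply IsLeast.csInf_eq
  constructor
  · refine ⟨B.image (fun a => monomial a (1 : 𝕜)), ?_, ?_, ?_⟩
    · rw [Finset.card_image_of_injective]
      exact monomial_left_injective one_ne_zero
    · intro x hx
      rw [Finset.mem_coe, Finset.mem_image] at hx
      obtain ⟨a, ha, rfl⟩ := hx
      exact monomial_mem_symbolic 𝕜 s a ((hB a).mp ha).1
    · apply le_antisymm
      · apply sup_le (pow_le_symbolic 𝕜 s)
        rw [Ideal.span_le]
        intro x hx
        rw [Finset.mem_coe, Finset.mem_image] at hx
        obtain ⟨a, ha, rfl⟩ := hx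
        exact monomial_mem_symbolic 𝕜 s a ((hB a).mp ha).1
      · intro f hf
        apply mem_of_monomials
        intro a ha
        obtain ⟨b, hba, hb, hmin⟩ := exists_minimal_le s a ((mem_symbolic' 𝕜 s f).mp hf a ha)
        rw [monomial_split a b hba]
        apply Ideal.mul_mem_right
        by_cases hd : b 0 + b 1 + b 2 + b 3 + b 4 < 2 * s
        · apply Ideal.mem_sup_right
          apply Ideal.subset_span
          rw [Finset.mem_coe, Finset.mem_image]
          exact ⟨b, (hB b).mpr ⟨hb, hd, hmin⟩, rfl⟩
        · exact Ideal.mem_sup_left (mem_pow_edgeIdeal 𝕜 s b hb (by omega))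
  · rintro m ⟨S, rfl, hS, hspan⟩
    let L : RR 𝕜 →ₗ[𝕜] (B → 𝕜) := LinearMap.pi (fun a => lcoeff 𝕜 (a : Fin 5 →₀ ℕ))
    have hL : ∀ f (a : B), L f a = coeff (a : Fin 5 →₀ ℕ) f := fun f a => rfl
    have key : ∀ f ∈ symbolicPower (edgeIdealC5 𝕜) s,
        L f ∈ Submodule.span 𝕜 ((S.image L : Finset (B → 𝕜)) : Set (B → 𝕜)) := by
      intro f hf
      rw [← hspan] at hf
      obtain ⟨g, hg, h, hh, rfl⟩ := Submodule.mem_sup.mp hf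
      have hg0 : L g = 0 := by
        funext a
        rw [hL]
        exact coeff_pow_eq_zero ((hB a).mp a.2) hg
      rw [map_add, hg0, zero_add]
      have : h ∈ symbolicPower (edgeIdealC5 𝕜) s ∧
          L h ∈ Submodule.span 𝕜 ((S.image L : Finset (B → 𝕜)) : Set (B → 𝕜)) := by
        induction hh using Submodule.span_induction with
        | mem x hx =>
          exact ⟨hS hx, Submodule.subset_span (Finset.mem_coe.mpr (Finset.mem_image_of_mem _ hx))⟩
        | zero => exact ⟨Ideal.zero_mem _, by rw [map_zero]; exact Submodule.zero_mem _⟩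
        | add x y hx' hy' hx hy =>
          have hx := hx (Ideal.add_mem _ (Ideal.mem_sup_left hg) (Ideal.mem_sup_right hx'))
          have hy := hy (Ideal.add_mem _ (Ideal.mem_sup_left hg) (Ideal.mem_sup_right hy'))
          exact ⟨Ideal.add_mem _ hx.1 hy.1, by rw [map_add]; exact Submodule.add_mem _ hx.2 hy.2⟩
        | smul r x hx' hx =>
          have hx := hx (Ideal.add_mem _ (Ideal.mem_sup_left hg) (Ideal.mem_sup_right hx'))
          refine ⟨Ideal.mul_mem_left _ _ hx.1, ?_⟩
          have : L (r • x) = coeff 0 r • L x := by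
            funext a
            rw [Pi.smul_apply, hL, hL, smul_eq_mul, smul_eq_mul]
            exact coeff_mul_gen ((hB a).mp a.2) hx.1 r
          rw [this]
          exact Submodule.smul_mem _ _ hx.2
      exact this.2
    have htop : Submodule.span 𝕜 ((S.image L : Finset (B → 𝕜)) : Set (B → 𝕜)) = ⊤ := by
      rw [eq_top_iff, ← (Pi.basisFun 𝕜 B).span_eq, Submodule.span_le]
      rintro _ ⟨a, rfl⟩
      have := key _ (monomial_mem_symbolic 𝕜 s a ((hB a).mp a.2).1)
      have heq : (Pi.basisFun 𝕜 B) a = L (monomial (a : Fin 5 →₀ ℕ) 1) := by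
        funext b
        rw [hL, coeff_monomial, Pi.basisFun_apply, Pi.single_apply]
        by_cases hab : a = b
        · subst hab; simp
        · rw [if_neg (fun h => hab h.symm), if_neg (fun h => hab (Subtype.ext h))]
      rw [heq]
      exact this
    have h1 := finrank_span_finset_le_card (R := 𝕜) (S.image L)
    rw [Set.finrank, htop, finrank_top, Module.finrank_fintype_fun_eq_card, Fintype.card_coe] at h1
    exact h1.trans Finset.card_image_le

/-! ### Counting -/

def vec (i : Fin 5) (p q r j : ℕ) : Fin 5 →₀ ℕ :=
  Finsupp.equivFunOnFinite.symm (fun v => ![j + p, j + p + q, j + q + r, j + r, j] (v - i))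

def params (k c : ℕ) : Finset (Fin 5 × (Σ _ : ℕ, Σ _ : ℕ, ℕ × ℕ)) :=
  Finset.univ ×ˢ ((Finset.range k).sigma fun m => (Finset.range (3 * m + c)).sigma
    fun n => Finset.HasAntidiagonal.antidiagonal n)

def parVec (k c : ℕ) (x : Fin 5 × (Σ _ : ℕ, Σ _ : ℕ, ℕ × ℕ)) : Fin 5 →₀ ℕ :=
  vec x.1 (3 * x.2.1 + c - x.2.2.1) x.2.2.2.1 x.2.2.2.2 (k - x.2.1)

def gens (k c : ℕ) : Finset (Fin 5 →₀ ℕ) := by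
  classical
  exact (params k c).image (parVec k c) ∪
    (if c = 0 then {Finsupp.equivFunOnFinite.symm (fun _ => k)} else ∅)

lemma lin_aux (s a0 a1 a2 a3 a4 : ℕ)
    (c0 : s ≤ a0 + a1 + a3) (c1 : s ≤ a1 + a2 + a4) (c2 : s ≤ a2 + a3 + a0)
    (c3 : s ≤ a3 + a4 + a1) (c4 : s ≤ a4 + a0 + a2) (hd : a0 + a1 + a2 + a3 + a4 < 2 * s)
    (m0 : a0 = 0 ∨ s = a0 + a1 + a3 ∨ s = a2 + a3 + a0 ∨ s = a4 + a0 + a2)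
    (m1 : a1 = 0 ∨ s = a0 + a1 + a3 ∨ s = a1 + a2 + a4 ∨ s = a3 + a4 + a1)
    (m2 : a2 = 0 ∨ s = a1 + a2 + a4 ∨ s = a2 + a3 + a0 ∨ s = a4 + a0 + a2)
    (m3 : a3 = 0 ∨ s = a0 + a1 + a3 ∨ s = a2 + a3 + a0 ∨ s = a3 + a4 + a1)
    (m4 : a4 = 0 ∨ s = a1 + a2 + a4 ∨ s = a3 + a4 + a1 ∨ s = a4 + a0 + a2)
    (h0 : a4 < a0) (h1 : a4 ≤ a1) (h2 : a4 ≤ a2) (h3 : a4 ≤ a3) :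
    1 ≤ a4 ∧ a0 ≤ a1 ∧ a2 + a0 = a1 + a3 ∧ s = a1 + a3 + a4 := by
  have : 1 ≤ a4 := by omega
  have n0 := m0.resolve_left (by omega)
  have n1 := m1.resolve_left (by omega)
  have n2 := m2.resolve_left (by omega)
  have n3 := m3.resolve_left (by omega)
  have n4 := m4.resolve_left (by omega)
  clear m0 m1 m2 m3 m4
  refine ⟨this, ?_⟩
  rcases n0 with n0 | n0 | n0 <;> rcases n1 with n1 | n1 | n1 <;> omega


lemma mem_params (k c : ℕ) (i : Fin 5) (m n q r : ℕ) :
    (i, ⟨m, ⟨n, (q, r)⟩⟩) ∈ params k c ↔ m < k ∧ n < 3 * m + c ∧ q + r = n := by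
  simp [params]

lemma mem_gens (k c : ℕ) (hc : c < 3) (a : Fin 5 →₀ ℕ) : a ∈ gens k c ↔
    (∃ i p q r j, 1 ≤ p ∧ 1 ≤ j ∧ p + q + r + 3 * j = 3 * k + c ∧ a = vec i p q r j) ∨
    (c = 0 ∧ a = Finsupp.equivFunOnFinite.symm (fun _ => k)) := by
  classical
  unfold gens
  rw [Finset.mem_union]
  apply or_congr
  · rw [Finset.mem_image]
    constructor
    · rintro ⟨⟨i, m, n, q, r⟩, hx, rfl⟩
      rw [mem_params] at hx
      exact ⟨i, 3 * m + c - n, q, r, k - m, by omega, by omega, by omega, rfl⟩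
    · rintro ⟨i, p, q, r, j, hp, hj, hs, rfl⟩
      refine ⟨(i, ⟨k - j, ⟨q + r, (q, r)⟩⟩), ?_, ?_⟩
      · rw [mem_params]; omega
      · simp only [parVec]
        congr 1 <;> omega
  · split_ifs with h <;> simp [h]

lemma vec_inj {i i' : Fin 5} {p q r j p' q' r' j' : ℕ} (hp : 1 ≤ p) (hp' : 1 ≤ p')
    (h : vec i p q r j = vec i' p' q' r' j') :
    i = i' ∧ p = p' ∧ q = q' ∧ r = r' ∧ j = j' := by
  have h0 := DFunLike.congr_fun h 0
  have h1 := DFunLike.congr_fun h 1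
  have h2 := DFunLike.congr_fun h 2
  have h3 := DFunLike.congr_fun h 3
  have h4 := DFunLike.congr_fun h 4
  clear h
  fin_cases i <;> fin_cases i' <;> simp [vec] at * <;> omega

lemma parVec_injOn (k c : ℕ) : Set.InjOn (parVec k c) (params k c) := by
  rintro ⟨i, m, n, q, r⟩ hx ⟨i', m', n', q', r'⟩ hx' h
  rw [Finset.mem_coe, mem_params] at hx hx'
  have := vec_inj (by simp only; omega) (by simp only; omega) h
  simp only at this
  obtain ⟨rfl, h1, rfl, rfl, h2⟩ := this
  obtain rfl : m = m' := by omega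
  obtain rfl : n = n' := by omega
  rfl

lemma vec_gen (s : ℕ) (i : Fin 5) (p q r j : ℕ) (hj : 1 ≤ j)
    (hs : p + q + r + 3 * j = s) : Gen s (vec i p q r j) := by
  refine ⟨?_, ?_, ?_⟩
  · intro l
    fin_cases i <;> fin_cases l <;> simp [vec] <;> omega
  · fin_cases i <;> simp [vec] <;> omega
  · intro b hb hsym
    have b0 := hb 0
    have b1 := hb 1
    have b2 := hb 2
    have b3 := hb 3
    have b4 := hb 4
    have c0 := hsym 0
    have c1 := hsym 1
    have c2 := hsym 2
    have c3 := hsym 3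
    have c4 := hsym 4
    clear hb hsym
    ext v
    fin_cases i <;> simp [vec] at * <;> fin_cases v <;> simp <;> omega

lemma const_gen (k : ℕ) (hk : 1 ≤ k) :
    Gen (3 * k) (Finsupp.equivFunOnFinite.symm (fun _ => k)) := by
  have : (Finsupp.equivFunOnFinite.symm (fun _ => k) : Fin 5 →₀ ℕ) = vec 0 0 0 0 k := by
    ext v
    fin_cases v <;> simp [vec]
  rw [this]
  exact vec_gen _ _ _ _ _ _ hk (by omega)

lemma gen_tight (s : ℕ) (a : Fin 5 →₀ ℕ) (h : Gen s a) (v : Fin 5) :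
    a v = 0 ∨ s = a v + a (v + 1) + a (v + 3) ∨ s = a (v + 2) + a (v + 3) + a v ∨
      s = a (v + 4) + a v + a (v + 2) := by
  by_contra hcon
  push Not at hcon
  obtain ⟨hv, h1, h2, h3⟩ := hcon
  have hs : InSym s (a - Finsupp.single v 1) := by
    intro l
    have hl := h.1 l
    clear h
    fin_cases v <;> fin_cases l <;> simp at * <;> omega
  have := DFunLike.congr_fun (h.2.2 _ tsub_le_self hs) v
  simp at this
  omega

lemma gen_form (s : ℕ) (a : Fin 5 →₀ ℕ) (h : Gen s a) :
    (∃ i p q r j, 1 ≤ p ∧ 1 ≤ j ∧ p + q + r + 3 * j = s ∧ a = vec i p q r j) ∨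
    (∃ k, s = 3 * k ∧ a = Finsupp.equivFunOnFinite.symm (fun _ => k)) := by
  have ht := gen_tight s a h
  obtain ⟨hc, hd, -⟩ := h
  by_cases hi : ∃ i : Fin 5, a (i + 4) < a i ∧ a (i + 4) ≤ a (i + 1) ∧ a (i + 4) ≤ a (i + 2) ∧
      a (i + 4) ≤ a (i + 3)
  · left
    obtain ⟨i, h0, h1, h2, h3⟩ := hi
    have c0 := hc i
    have c1 := hc (i + 1)
    have c2 := hc (i + 2)
    have c3 := hc (i + 3)
    have c4 := hc (i + 4)
    have t0 := ht i
    have t1 := ht (i + 1)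
    have t2 := ht (i + 2)
    have t3 := ht (i + 3)
    have t4 := ht (i + 4)
    simp only [add_assoc i, Fin.reduceAdd, add_zero, Fin.isValue] at c0 c1 c2 c3 c4 t0 t1 t2 t3 t4
    have hd' : a i + a (i + 1) + a (i + 2) + a (i + 3) + a (i + 4) < 2 * s := by
      clear * - hd
      fin_cases i <;> simp <;> omega
    obtain ⟨r1, r2, r3, r4⟩ := lin_aux s (a i) (a (i + 1)) (a (i + 2)) (a (i + 3)) (a (i + 4))
      (by omega) (by omega) (by omega) (by omega) (by omega) hd' (by omega) (by omega) (by omega)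
      (by omega) (by omega) h0 h1 h2 h3
    refine ⟨i, a i - a (i + 4), a (i + 1) - a i, a (i + 3) - a (i + 4), a (i + 4), by omega, r1,
      by omega, ?_⟩
    clear * - h0 h1 h2 h3 r2 r3
    ext v
    fin_cases i <;> fin_cases v <;> simp [vec] at * <;> omega
  · right
    push Not at hi
    have i0 := hi 0
    have i1 := hi 1
    have i2 := hi 2
    have i3 := hi 3
    have i4 := hi 4
    have c0 := hc 0
    have t0 := ht 0
    simp only [zero_add, Fin.reduceAdd, Fin.isValue] at i0 i1 i2 i3 i4 c0 t0
    have e : a 1 = a 0 ∧ a 2 = a 0 ∧ a 3 = a 0 ∧ a 4 = a 0 := by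
      clear c0 t0 hi hc ht hd
      generalize a 0 = x0 at *
      generalize a 1 = x1 at *
      generalize a 2 = x2 at *
      generalize a 3 = x3 at *
      generalize a 4 = x4 at *
      omega
    refine ⟨a 0, by omega, ?_⟩
    ext v
    fin_cases v <;> simp [e]

lemma mem_gens_iff (k c : ℕ) (hc : c < 3) (hs : 1 ≤ 3 * k + c) (a : Fin 5 →₀ ℕ) :
    a ∈ gens k c ↔ Gen (3 * k + c) a := by
  rw [mem_gens k c hc]
  constructor
  · rintro (⟨i, p, q, r, j, -, hj, hs, rfl⟩ | ⟨rfl, rfl⟩)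
    · exact vec_gen _ _ _ _ _ _ hj hs
    · exact const_gen k (by omega)
  · intro h
    rcases gen_form _ a h with h | ⟨k', hk, rfl⟩
    · exact Or.inl h
    · refine Or.inr ⟨by omega, ?_⟩
      obtain rfl : k = k' := by omega
      rfl

lemma card_params (k c : ℕ) :
    (params k c).card = 5 * ∑ m ∈ Finset.range k, ∑ n ∈ Finset.range (3 * m + c), (n + 1) := by
  simp [params, Finset.card_product, Finset.card_sigma]

lemma card_gens (k c : ℕ) : (gens k c).card =
    5 * (∑ m ∈ Finset.range k, ∑ n ∈ Finset.range (3 * m + c), (n + 1)) +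
      if c = 0 then 1 else 0 := by
  classical
  unfold gens
  rw [Finset.card_union_of_disjoint, Finset.card_image_of_injOn (parVec_injOn k c), card_params]
  · split_ifs <;> simp
  · split_ifs with h
    · rw [Finset.disjoint_singleton_right, Finset.mem_image]
      rintro ⟨⟨i, m, n, q, r⟩, hx, he⟩
      rw [mem_params] at hx
      have e1 := DFunLike.congr_fun he i
      have e2 := DFunLike.congr_fun he (i + 4)
      clear he
      fin_cases i <;> simp [parVec, vec] at * <;> omega
    · simp

lemma C5_sum_inner (t : ℕ) : (∑ n ∈ Finset.range t, ((n : ℚ) + 1)) = t * (t + 1) / 2 := by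
  induction t with
  | zero => simp
  | succ t ih => rw [Finset.sum_range_succ, ih]; push_cast; ring

lemma C5_sum_outer (k : ℕ) (c : ℚ) :
    5 * (∑ m ∈ Finset.range k, (3 * (m : ℚ) + c) * (3 * m + c + 1) / 2) =
    15 / 2 * k ^ 3 + (15 / 2 * c - 15 / 2) * k ^ 2 + (5 / 2 * c ^ 2 - 5 * c) * k := by
  induction k with
  | zero => simp
  | succ k ih => rw [Finset.sum_range_succ, mul_add, ih]; push_cast; ring

lemma sdefect_form (𝕜 : Type) [Field 𝕜] (k c : ℕ) (hc : c < 3) (hs : 1 ≤ 3 * k + c) :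
    (sdefect (edgeIdealC5 𝕜) (3 * k + c) : ℚ) =
    15 / 2 * k ^ 3 + (15 / 2 * c - 15 / 2) * k ^ 2 + (5 / 2 * c ^ 2 - 5 * c) * k +
      if c = 0 then 1 else 0 := by
  rw [sdefect_eq_card 𝕜 _ (gens k c) (mem_gens_iff k c hc hs), card_gens, ← C5_sum_outer]
  push_cast
  simp only [C5_sum_inner]
  push_cast
  rfl

/-- the symbolic defects of the edge ideal of `C_5` are given by the
quasi-polynomial `sdefect(I,3k) = (15/2)k³ - (15/2)k² + 1`,
`sdefect(I,3k+1) = (15/2)k³ - (5/2)k`, `sdefect(I,3k+2) = (15/2)k³ + (15/2)k²`. -/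
theorem sdefect_C5 (𝕜 : Type) [Field 𝕜] (s : ℕ) (hs : 1 ≤ s) (k : ℕ) :
    (s = 3 * k →
      (sdefect (edgeIdealC5 𝕜) s : ℚ) = 15 / 2 * k ^ 3 - 15 / 2 * k ^ 2 + 1) ∧
    (s = 3 * k + 1 →
      (sdefect (edgeIdealC5 𝕜) s : ℚ) = 15 / 2 * k ^ 3 - 5 / 2 * k) ∧
    (s = 3 * k + 2 →
      (sdefect (edgeIdealC5 𝕜) s : ℚ) = 15 / 2 * k ^ 3 + 15 / 2 * k ^ 2) := by
  refine ⟨?_, ?_, ?_⟩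
  · rintro rfl
    have := sdefect_form 𝕜 k 0 (by norm_num) hs
    rw [add_zero] at this
    rw [this]
    push_cast
    simp
    ring
  · rintro rfl
    rw [sdefect_form 𝕜 k 1 (by norm_num) hs]
    push_cast
    simp
    ring
  · rintro rfl
    rw [sdefect_form 𝕜 k 2 (by norm_num) hs]
    push_cast
    simp
    ring

end
end

section
/- Let G be the unicyclic graph on vertices x_1, x_2, x_3, x_4 with edges {x_1,x_2}, {x_2,x_3}, {x_3,x_1}, {x_1,x_4} (a triangle with one pendant edge at x_1), and let I = I(G) ⊆ 𝕜[x_1,…,x_4] be its edge ideal. Then for every s ≥ 1, the s-th symbolic defect is given by: sdefect(I, s) = 2k² − 1 if s = 2k, and sdefect(I, s) = 2k² + 2k if s = 2k+1. -/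
open MvPolynomial

noncomputable section

/-- The unicyclic graph on vertices `x_1, x_2, x_3, x_4` (here `0, 1, 2, 3`) with edges
`{x_1,x_2}, {x_2,x_3}, {x_3,x_1}, {x_1,x_4}`: a triangle with a pendant edge at `x_1`. -/
def trianglePendant : SimpleGraph (Fin 4) :=
  SimpleGraph.fromRel fun u v =>
    (u = 0 ∧ v = 1) ∨ (u = 1 ∧ v = 2) ∨ (u = 2 ∧ v = 0) ∨ (u = 0 ∧ v = 3)

namespace TriPend

variable {𝕜 : Type} [Field 𝕜]

def wt (c : Fin 4 → ℕ) (e : Fin 4 →₀ ℕ) : ℕ := c 0 * e 0 + c 1 * e 1 + c 2 * e 2 + c 3 * e 3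

def phi (𝕜 : Type) [Field 𝕜] (c : Fin 4 → ℕ) :
    MvPolynomial (Fin 4) 𝕜 →ₐ[𝕜] Polynomial (MvPolynomial (Fin 4) 𝕜) :=
  aeval (fun i => Polynomial.C (X i) * Polynomial.X ^ (c i))

def Q (𝕜 : Type) [Field 𝕜] (c : Fin 4 → ℕ) (s : ℕ) : Ideal (MvPolynomial (Fin 4) 𝕜) :=
  Ideal.comap (phi 𝕜 c) (Ideal.span {Polynomial.X ^ s})

lemma phi_monomial (c : Fin 4 → ℕ) (e : Fin 4 →₀ ℕ) (a : 𝕜) :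
    phi 𝕜 c (monomial e a) = Polynomial.monomial (wt c e) (monomial e a) := by
  have h1 : (monomial e a : MvPolynomial (Fin 4) 𝕜)
      = C a * (X 0 ^ e 0 * X 1 ^ e 1 * X 2 ^ e 2 * X 3 ^ e 3) := by
    rw [monomial_eq, Finsupp.prod_fintype _ _ (by simp)]
    simp [Fin.prod_univ_four]
  have h2 : Polynomial.monomial (wt c e) (monomial e a : MvPolynomial (Fin 4) 𝕜)
      = Polynomial.C (C a * (X 0 ^ e 0 * X 1 ^ e 1 * X 2 ^ e 2 * X 3 ^ e 3))
        * Polynomial.X ^ (wt c e) := by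
    rw [← h1, Polynomial.C_mul_X_pow_eq_monomial]
  rw [h2, h1]
  have h3 : phi 𝕜 c (C a) = Polynomial.C (C a) := by
    simp [phi, IsScalarTower.algebraMap_apply 𝕜 (MvPolynomial (Fin 4) 𝕜)
      (Polynomial (MvPolynomial (Fin 4) 𝕜)), MvPolynomial.algebraMap_eq]
  have h4 : ∀ i, phi 𝕜 c (X i) = Polynomial.C (X i) * Polynomial.X ^ (c i) := by
    intro i; simp [phi]
  simp only [map_mul, map_pow, h3, h4, wt]
  ring

lemma coeff_phi (c : Fin 4 → ℕ) (f : MvPolynomial (Fin 4) 𝕜) (e : Fin 4 →₀ ℕ) (n : ℕ) :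
    coeff e ((phi 𝕜 c f).coeff n) = if wt c e = n then coeff e f else 0 := by
  classical
  induction f using MvPolynomial.induction_on' with
  | monomial u a =>
    rw [phi_monomial, Polynomial.coeff_monomial]
    by_cases hu : u = e
    · subst hu; split_ifs <;> simp
    · split_ifs <;> simp [coeff_monomial, hu]
  | add p q hp hq =>
    rw [map_add, Polynomial.coeff_add, coeff_add, hp, hq]
    split_ifs <;> simp

lemma mem_Q {c : Fin 4 → ℕ} {s : ℕ} {f : MvPolynomial (Fin 4) 𝕜} :
    f ∈ Q 𝕜 c s ↔ ∀ e ∈ f.support, s ≤ wt c e := by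
  rw [Q, Ideal.mem_comap, Ideal.mem_span_singleton, Polynomial.X_pow_dvd_iff]
  constructor
  · intro h e he
    by_contra! hlt
    have := congrArg (coeff e) (h _ hlt)
    rw [coeff_phi, if_pos rfl] at this
    simp at this
    exact (mem_support_iff.1 he) this
  · intro h d hd
    ext e
    rw [coeff_phi, coeff_zero]
    split_ifs with h1
    · by_contra hne
      have := h e (mem_support_iff.2 hne)
      omega
    · rfl

lemma Q_prime (c : Fin 4 → ℕ) : (Q 𝕜 c 1).IsPrime := by
  have : (Ideal.span {(Polynomial.X : Polynomial (MvPolynomial (Fin 4) 𝕜)) ^ 1}).IsPrime := by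
    rw [pow_one, Ideal.span_singleton_prime Polynomial.X_ne_zero]
    exact Polynomial.prime_X
  exact Ideal.IsPrime.comap _

lemma Q_primary {c : Fin 4 → ℕ} {s : ℕ} {u f : MvPolynomial (Fin 4) 𝕜} (hu : u ∉ Q 𝕜 c 1)
    (h : u * f ∈ Q 𝕜 c s) : f ∈ Q 𝕜 c s := by
  rw [Q, Ideal.mem_comap, Ideal.mem_span_singleton] at *
  rw [pow_one] at hu
  rw [map_mul] at h
  exact Polynomial.prime_X.pow_dvd_of_dvd_mul_left s hu h

lemma pow_le_Q {c : Fin 4 → ℕ} {n : ℕ} {I : Ideal (MvPolynomial (Fin 4) 𝕜)} (h : I ≤ Q 𝕜 c n)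
    (s : ℕ) : I ^ s ≤ Q 𝕜 c (n * s) := by
  refine (Ideal.pow_right_mono h s).trans ?_
  refine (Ideal.le_comap_pow (phi 𝕜 c) s).trans ?_
  rw [Ideal.span_singleton_pow, ← pow_mul, Q]

def A (s : ℕ) (e : Fin 4 →₀ ℕ) : Prop :=
  s ≤ e 0 + e 1 ∧ s ≤ e 0 + e 2 ∧ s ≤ e 1 + e 2 + e 3

def c1 : Fin 4 → ℕ := ![1,1,0,0]
def c2 : Fin 4 → ℕ := ![1,0,1,0]
def c3 : Fin 4 → ℕ := ![0,1,1,1]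
def c4 : Fin 4 → ℕ := ![1,1,1,1]

@[simp] lemma wt1 (e) : wt c1 e = e 0 + e 1 := by simp [wt, c1]
@[simp] lemma wt2 (e) : wt c2 e = e 0 + e 2 := by simp [wt, c2]
@[simp] lemma wt3 (e) : wt c3 e = e 1 + e 2 + e 3 := by simp [wt, c3]
@[simp] lemma wt4 (e) : wt c4 e = e 0 + e 1 + e 2 + e 3 := by simp [wt, c4]

variable (𝕜) in
abbrev I : Ideal (MvPolynomial (Fin 4) 𝕜) := edgeIdeal 𝕜 trianglePendant

lemma adj_mem {u v : Fin 4} (h : trianglePendant.Adj u v) : (X u * X v) ∈ I 𝕜 :=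
  Ideal.subset_span ⟨u, v, h, rfl⟩

lemma m01 : (X 0 * X 1) ∈ I 𝕜 := adj_mem (by simp [trianglePendant])
lemma m12 : (X 1 * X 2) ∈ I 𝕜 := adj_mem (by simp [trianglePendant])
lemma m02 : (X 0 * X 2) ∈ I 𝕜 := adj_mem (by simp [trianglePendant])
lemma m03 : (X 0 * X 3) ∈ I 𝕜 := adj_mem (by simp [trianglePendant])

lemma I_le (c : Fin 4 → ℕ) (n : ℕ) (h : ∀ u v, trianglePendant.Adj u v → n ≤ c u + c v) :
    I 𝕜 ≤ Q 𝕜 c n := by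
  rw [I, edgeIdeal, Ideal.span_le]
  rintro _ ⟨u, v, huv, rfl⟩
  have := h u v huv
  rw [SetLike.mem_coe, Q, Ideal.mem_comap, Ideal.mem_span_singleton, map_mul]
  simp only [phi, aeval_X]
  refine (pow_dvd_pow _ this).trans ⟨Polynomial.C (X u) * Polynomial.C (X v), by ring⟩

lemma I_le1 : I 𝕜 ≤ Q 𝕜 c1 1 := I_le _ _ (by
  intro u v; fin_cases u <;> fin_cases v <;> simp [trianglePendant, c1])
lemma I_le2 : I 𝕜 ≤ Q 𝕜 c2 1 := I_le _ _ (by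
  intro u v; fin_cases u <;> fin_cases v <;> simp [trianglePendant, c2])
lemma I_le3 : I 𝕜 ≤ Q 𝕜 c3 1 := I_le _ _ (by
  intro u v; fin_cases u <;> fin_cases v <;> simp [trianglePendant, c3])
lemma I_le4 : I 𝕜 ≤ Q 𝕜 c4 2 := I_le _ _ (by
  intro u v; fin_cases u <;> fin_cases v <;> simp [trianglePendant, c4])

lemma exists_pqrt (s a b c d : ℕ) (h1 : s ≤ a + b) (h2 : s ≤ a + c) (h3 : s ≤ b + c + d)
    (h4 : 2 * s ≤ a + b + c + d) : ∃ p q r t, p + q + r + t = s ∧ p + r + t ≤ a ∧ p + q ≤ b ∧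
      q + r ≤ c ∧ t ≤ d := by
  obtain ⟨t, ht⟩ : ∃ t, t = min d (min a s) := ⟨_, rfl⟩
  refine ⟨s - t - c, s - t - (a - t), s - t - (s - t - (a - t)) - (s - t - c), t, ?_⟩
  omega

lemma monomial_mem {s : ℕ} {e : Fin 4 →₀ ℕ} (a : 𝕜) (h : A s e)
    (h4 : 2 * s ≤ e 0 + e 1 + e 2 + e 3) : monomial e a ∈ I 𝕜 ^ s := by
  obtain ⟨h1, h2, h3⟩ := h
  obtain ⟨p, q, r, t, hs, k0, k1, k2, k3⟩ := exists_pqrt s _ _ _ _ h1 h2 h3 h4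
  obtain ⟨y0, k0⟩ := Nat.exists_eq_add_of_le k0
  obtain ⟨y1, k1⟩ := Nat.exists_eq_add_of_le k1
  obtain ⟨y2, k2⟩ := Nat.exists_eq_add_of_le k2
  obtain ⟨y3, k3⟩ := Nat.exists_eq_add_of_le k3
  have hm : (monomial e a : MvPolynomial (Fin 4) 𝕜)
      = C a * (X 0 ^ e 0 * X 1 ^ e 1 * X 2 ^ e 2 * X 3 ^ e 3) := by
    rw [monomial_eq, Finsupp.prod_fintype _ _ (by simp)]
    simp [Fin.prod_univ_four]
  have hm2 : (monomial e a : MvPolynomial (Fin 4) 𝕜)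
      = (C a * (X 0 ^ y0 * X 1 ^ y1 * X 2 ^ y2 * X 3 ^ y3)) *
        ((X 0 * X 1) ^ p * (X 1 * X 2) ^ q * (X 0 * X 2) ^ r * (X 0 * X 3) ^ t) := by
    rw [hm, k0, k1, k2, k3]; ring
  rw [hm2]
  refine Ideal.mul_mem_left _ _ ?_
  rw [← hs, pow_add, pow_add, pow_add]
  exact Ideal.mul_mem_mul (Ideal.mul_mem_mul (Ideal.mul_mem_mul (Ideal.pow_mem_pow m01 _)
    (Ideal.pow_mem_pow m12 _)) (Ideal.pow_mem_pow m02 _)) (Ideal.pow_mem_pow m03 _)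

lemma mem_I_pow {s : ℕ} {f : MvPolynomial (Fin 4) 𝕜} :
    f ∈ I 𝕜 ^ s ↔ ∀ e ∈ f.support, A s e ∧ 2 * s ≤ e 0 + e 1 + e 2 + e 3 := by
  constructor
  · intro h e he
    have a1 := mem_Q.1 (pow_le_Q I_le1 s h) e he
    have a2 := mem_Q.1 (pow_le_Q I_le2 s h) e he
    have a3 := mem_Q.1 (pow_le_Q I_le3 s h) e he
    have a4 := mem_Q.1 (pow_le_Q I_le4 s h) e he
    simp only [wt1, wt2, wt3, wt4, one_mul] at *
    exact ⟨⟨a1, a2, a3⟩, a4⟩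
  · intro h
    rw [← support_sum_monomial_coeff f]
    exact Ideal.sum_mem _ fun e he => monomial_mem _ (h e he).1 (h e he).2

structure Cov (𝕜 : Type) [Field 𝕜] (c : Fin 4 → ℕ) (d : Fin 4 →₀ ℕ) : Prop where
  le : I 𝕜 ≤ Q 𝕜 c 1
  zero : wt c d = 0
  mv : ∀ s e, s ≤ wt c e → A s (e + s • d) ∧ 2 * s ≤ (e + s • d) 0 + (e + s • d) 1 +
    (e + s • d) 2 + (e + s • d) 3

def vec (a b c d : ℕ) : Fin 4 →₀ ℕ := Finsupp.equivFunOnFinite.symm ![a, b, c, d]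
@[simp] lemma vec0 (a b c d) : vec a b c d 0 = a := rfl
@[simp] lemma vec1 (a b c d) : vec a b c d 1 = b := rfl
@[simp] lemma vec2 (a b c d) : vec a b c d 2 = c := rfl
@[simp] lemma vec3 (a b c d) : vec a b c d 3 = d := rfl

lemma cov1 : Cov 𝕜 c1 (vec 0 0 1 1) := ⟨I_le1, by simp, by
  intro s e h; simp [A] at *; omega⟩
lemma cov2 : Cov 𝕜 c2 (vec 0 1 0 1) := ⟨I_le2, by simp, by
  intro s e h; simp [A] at *; omega⟩
lemma cov3 : Cov 𝕜 c3 (vec 1 0 0 0) := ⟨I_le3, by simp, by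
  intro s e h; simp [A] at *; omega⟩

lemma Cov.mul_mem {c d} (h : Cov 𝕜 c d) {s : ℕ} {f : MvPolynomial (Fin 4) 𝕜}
    (hf : f ∈ Q 𝕜 c s) : monomial (s • d) 1 * f ∈ I 𝕜 ^ s := by
  rw [mem_Q] at hf
  rw [← support_sum_monomial_coeff f, Finset.mul_sum]
  refine Ideal.sum_mem _ fun e he => ?_
  rw [monomial_mul, add_comm]
  have := h.mv s e (hf e he)
  exact monomial_mem _ this.1 this.2

lemma Cov.notMem {c d} (h : Cov 𝕜 c d) (s : ℕ) : (monomial (s • d) (1 : 𝕜)) ∉ Q 𝕜 c 1 := by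
  rw [mem_Q]
  intro h1
  have := h1 (s • d) (by simp)
  have h0 := h.zero
  simp only [wt, Finsupp.smul_apply, smul_eq_mul] at *
  have : s * (c 0 * d 0 + c 1 * d 1 + c 2 * d 2 + c 3 * d 3) ≥ 1 := by
    linarith
  rw [h0] at this; omega

lemma mem_colon (r g : MvPolynomial (Fin 4) 𝕜) :
    r ∈ Submodule.colon (⊥ : Submodule (MvPolynomial (Fin 4) 𝕜) (MvPolynomial (Fin 4) 𝕜 ⧸ I 𝕜))
      {Ideal.Quotient.mk (I 𝕜) g} ↔ r * g ∈ I 𝕜 := by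
  rw [Submodule.mem_colon_singleton, Submodule.mem_bot, ← Ideal.Quotient.eq_zero_iff_mem]
  rfl

lemma Cov.ass {c d} (h : Cov 𝕜 c d) :
    Q 𝕜 c 1 ∈ associatedPrimes (MvPolynomial (Fin 4) 𝕜) (MvPolynomial (Fin 4) 𝕜 ⧸ I 𝕜) := by
  rw [AssociatedPrimes.mem_iff, isAssociatedPrime_iff]
  refine ⟨Q_prime c, Ideal.Quotient.mk (I 𝕜) (monomial (1 • d) 1), ?_⟩
  ext r
  rw [mem_colon]
  constructor
  · intro hr
    have := h.mul_mem hr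
    rwa [pow_one, mul_comm] at this
  · intro hr
    exact ((Q_prime c).mem_or_mem (h.le hr)).resolve_right (h.notMem 1)

lemma Cov.loc {c d} (h : Cov 𝕜 c d) (hp : (Q 𝕜 c 1).IsPrime) (s : ℕ) :
    localizationComap (Q 𝕜 c 1) hp (I 𝕜 ^ s) = Q 𝕜 c s := by
  ext f
  unfold localizationComap
  rw [Ideal.mem_comap, IsLocalization.algebraMap_mem_map_algebraMap_iff (Q 𝕜 c 1).primeCompl]
  constructor
  · rintro ⟨u, hu, hf⟩
    have := pow_le_Q h.le s hf
    rw [one_mul] at this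
    exact Q_primary hu this
  · intro hf
    exact ⟨_, h.notMem s, h.mul_mem hf⟩

lemma inf_le_I : Q 𝕜 c1 1 ⊓ Q 𝕜 c2 1 ⊓ Q 𝕜 c3 1 ≤ I 𝕜 := by
  rintro f ⟨⟨h1, h2⟩, h3⟩
  rw [← pow_one (I 𝕜), mem_I_pow]
  intro e he
  have h1 := mem_Q.1 h1 e he
  have h2 := mem_Q.1 h2 e he
  have h3 := mem_Q.1 h3 e he
  simp [A] at *
  omega

lemma ass_cases {p : Ideal (MvPolynomial (Fin 4) 𝕜)}
    (h : p ∈ associatedPrimes (MvPolynomial (Fin 4) 𝕜) (MvPolynomial (Fin 4) 𝕜 ⧸ I 𝕜)) :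
    p = Q 𝕜 c1 1 ∨ p = Q 𝕜 c2 1 ∨ p = Q 𝕜 c3 1 := by
  rw [AssociatedPrimes.mem_iff, isAssociatedPrime_iff] at h
  obtain ⟨hp, x, hx⟩ := h
  obtain ⟨g, rfl⟩ := Ideal.Quotient.mk_surjective x
  have hmem : ∀ r, r ∈ p ↔ r * g ∈ I 𝕜 := fun r => by rw [hx, mem_colon]
  have le_of : ∀ {c d}, Cov 𝕜 c d → g ∉ Q 𝕜 c 1 → p ≤ Q 𝕜 c 1 := by
    intro c d hc hg r hr
    exact ((Q_prime c).mem_or_mem (hc.le ((hmem r).1 hr))).resolve_right hg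
  by_contra! hne
  obtain ⟨n1, n2, n3⟩ := hne
  have key : ∀ {c d}, Cov 𝕜 c d → p ≠ Q 𝕜 c 1 → ∃ u, u ∉ p ∧ u * g ∈ Q 𝕜 c 1 := by
    intro c d hc hn
    by_cases hg : g ∈ Q 𝕜 c 1
    · exact ⟨1, fun h => hp.ne_top ((Ideal.eq_top_iff_one _).2 h), by simpa using hg⟩
    · have : ¬ Q 𝕜 c 1 ≤ p := fun hle => hn (le_antisymm (le_of hc hg) hle)
      obtain ⟨u, hu, hup⟩ := SetLike.not_le_iff_exists.1 this
      exact ⟨u, hup, Ideal.mul_mem_right _ _ hu⟩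
  obtain ⟨u1, a1, b1⟩ := key cov1 n1
  obtain ⟨u2, a2, b2⟩ := key cov2 n2
  obtain ⟨u3, a3, b3⟩ := key cov3 n3
  have : u1 * u2 * u3 ∈ p := by
    rw [hmem]
    apply inf_le_I
    refine ⟨⟨?_, ?_⟩, ?_⟩
    · rw [show u1 * u2 * u3 * g = u2 * u3 * (u1 * g) by ring]; exact Ideal.mul_mem_left _ _ b1
    · rw [show u1 * u2 * u3 * g = u1 * u3 * (u2 * g) by ring]; exact Ideal.mul_mem_left _ _ b2
    · rw [show u1 * u2 * u3 * g = u1 * u2 * (u3 * g) by ring]; exact Ideal.mul_mem_left _ _ b3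
  rcases hp.mem_or_mem this with h | h
  · rcases hp.mem_or_mem h with h | h
    exacts [a1 h, a2 h]
  · exact a3 h

lemma mem_symb {s : ℕ} {f : MvPolynomial (Fin 4) 𝕜} :
    f ∈ symbolicPower (I 𝕜) s ↔ ∀ e ∈ f.support, A s e := by
  have : f ∈ symbolicPower (I 𝕜) s ↔ f ∈ Q 𝕜 c1 s ∧ f ∈ Q 𝕜 c2 s ∧ f ∈ Q 𝕜 c3 s := by
    unfold symbolicPower
    rw [Submodule.mem_sInf]
    constructor
    · intro h
      refine ⟨h _ ⟨_, Q_prime c1, cov1.ass, ?_⟩, h _ ⟨_, Q_prime c2, cov2.ass, ?_⟩,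
        h _ ⟨_, Q_prime c3, cov3.ass, ?_⟩⟩
      exacts [(cov1.loc _ s).symm, (cov2.loc _ s).symm, (cov3.loc _ s).symm]
    · rintro ⟨h1, h2, h3⟩ J ⟨p, hp, hass, rfl⟩
      rcases ass_cases hass with rfl | rfl | rfl
      · exact (cov1.loc hp s).ge h1
      · exact (cov2.loc hp s).ge h2
      · exact (cov3.loc hp s).ge h3
  rw [this, mem_Q, mem_Q, mem_Q]
  simp only [A, wt1, wt2, wt3]
  constructor
  · rintro ⟨a, b, c⟩ e he; exact ⟨a e he, b e he, c e he⟩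
  · intro h; exact ⟨fun e he => (h e he).1, fun e he => (h e he).2.1, fun e he => (h e he).2.2⟩

/-- Exponents of the minimal generators of the symbolic power outside the ordinary power;
`m` determines `n = 2 m + s % 2` and `j = s / 2 - m`. -/
def E (s : ℕ) (x : (_ : ℕ) × ℕ) : Fin 4 →₀ ℕ :=
  let n := 2 * x.1 + s % 2
  let j := s / 2 - x.1
  if x.2 ≤ n then vec (j + n) (j + x.2) j (n - x.2)
  else if x.2 ≤ 2 * n then vec (j + n) j (j + (x.2 - n)) (2 * n - x.2)
  else vec j (j + n) (j + n) 0

def T (s : ℕ) : Finset ((_ : ℕ) × ℕ) :=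
  (Finset.range (s / 2)).sigma fun m =>
    Finset.range (if 2 * m + s % 2 = 0 then 1 else 2 * (2 * m + s % 2) + 2)

lemma mem_T {s : ℕ} {x : (_ : ℕ) × ℕ} : x ∈ T s ↔ x.1 < s / 2 ∧
    ((2 * x.1 + s % 2 = 0 ∧ x.2 = 0) ∨
      (2 * x.1 + s % 2 ≠ 0 ∧ x.2 < 2 * (2 * x.1 + s % 2) + 2)) := by
  rw [T, Finset.mem_sigma, Finset.mem_range, Finset.mem_range]
  split_ifs <;> omega

lemma E_spec {s : ℕ} {x : (_ : ℕ) × ℕ} (hx : x ∈ T s) :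
    A s (E s x) ∧ (E s x) 0 + (E s x) 1 + (E s x) 2 + (E s x) 3 < 2 * s ∧
      ∀ b, b ≤ E s x → A s b → b = E s x := by
  rw [mem_T] at hx
  obtain ⟨m, i⟩ := x
  have ext4 : ∀ b c : Fin 4 →₀ ℕ, b 0 = c 0 → b 1 = c 1 → b 2 = c 2 → b 3 = c 3 → b = c := by
    intro b c h0 h1 h2 h3; ext k; fin_cases k <;> assumption
  simp only at hx
  simp only [E]
  split_ifs with h1 h2
  all_goals
    refine ⟨by simp only [A, vec0, vec1, vec2, vec3]; omega,
      by simp only [vec0, vec1, vec2, vec3]; omega, ?_⟩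
    intro b hb hA
    have l0 := hb 0
    have l1 := hb 1
    have l2 := hb 2
    have l3 := hb 3
    simp only [A, vec0, vec1, vec2, vec3] at *
    apply ext4 <;> simp only [vec0, vec1, vec2, vec3] <;> omega

lemma E_inj {s : ℕ} {x y : (_ : ℕ) × ℕ} (hx : x ∈ T s) (hy : y ∈ T s) (h : E s x = E s y) :
    x = y := by
  rw [mem_T] at hx hy
  obtain ⟨m, i⟩ := x
  obtain ⟨m', i'⟩ := y
  have l0 := DFunLike.congr_fun h 0
  have l1 := DFunLike.congr_fun h 1
  have l2 := DFunLike.congr_fun h 2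
  have l3 := DFunLike.congr_fun h 3
  simp only at hx hy
  clear h
  have : m = m' ∧ i = i' := by
    simp only [E] at l0 l1 l2 l3
    split_ifs at l0 l1 l2 l3 <;> simp only [vec0, vec1, vec2, vec3] at l0 l1 l2 l3 <;> omega
  rw [this.1, this.2]

lemma E_minimal_surj {s : ℕ} {e : Fin 4 →₀ ℕ} (a b c d : ℕ) (he : e = vec a b c d)
    (h1 : s ≤ a + b) (h2 : s ≤ a + c) (h3 : s ≤ b + c + d) (h4 : a + b + c + d < 2 * s)
    (m0 : a = 0 ∨ s = a + b ∨ s = a + c) (m1 : b = 0 ∨ s = a + b ∨ s = b + c + d)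
    (m2 : c = 0 ∨ s = a + c ∨ s = b + c + d) (m3 : d = 0 ∨ s = b + c + d) :
    ∃ x ∈ T s, E s x = e := by
  subst he
  have cc : (b = c ∧ d = 0 ∧ s = a + b ∧ s < b + c) ∨ (s = a + c ∧ s = b + c + d) ∨
      (s = a + b ∧ s = b + c + d ∧ b < c) := by omega
  have vx : ∀ a b c d a' b' c' d', a = a' → b = b' → c = c' → d = d' →
      vec a b c d = vec a' b' c' d' := by
    rintro _ _ _ _ _ _ _ _ rfl rfl rfl rfl; rfl
  rcases cc with h | h | h
  · refine ⟨⟨s / 2 - a, 2 * (s - 2 * a) + 1⟩, mem_T.2 ?_, ?_⟩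
    · simp only; omega
    · simp only [E]
      rw [if_neg (by omega), if_neg (by omega)]
      apply vx <;> omega
  · refine ⟨⟨s / 2 - c, b - c⟩, mem_T.2 ?_, ?_⟩
    · simp only; omega
    · simp only [E]
      rw [if_pos (by omega)]
      apply vx <;> omega
  · refine ⟨⟨s / 2 - b, (s - 2 * b) + (c - b)⟩, mem_T.2 ?_, ?_⟩
    · simp only; omega
    · simp only [E]
      rw [if_neg (by omega), if_pos (by omega)]
      apply vx <;> omega

lemma vec_eta (e : Fin 4 →₀ ℕ) : e = vec (e 0) (e 1) (e 2) (e 3) := by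
  ext k; fin_cases k <;> rfl

lemma vec_le {a b c d a' b' c' d' : ℕ} (h0 : a ≤ a') (h1 : b ≤ b') (h2 : c ≤ c') (h3 : d ≤ d') :
    vec a b c d ≤ vec a' b' c' d' := by
  intro k; fin_cases k <;> assumption

lemma E_cover (s N : ℕ) : ∀ a b c d : ℕ, a + b + c + d = N → 
    s ≤ a + b → s ≤ a + c → s ≤ b + c + d → N < 2 * s →
    ∃ x ∈ T s, E s x ≤ vec a b c d := by
  induction N with
  | zero => intro a b c d h h1 h2 h3 h4; omega
  | succ N ih =>
    intro a b c d h h1 h2 h3 h4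
    by_cases m0 : a = 0 ∨ s = a + b ∨ s = a + c
    swap
    · obtain ⟨x, hx, hle⟩ := ih (a - 1) b c d (by omega) (by omega) (by omega) (by omega) (by omega)
      exact ⟨x, hx, hle.trans (vec_le (by omega) le_rfl le_rfl le_rfl)⟩
    by_cases m1 : b = 0 ∨ s = a + b ∨ s = b + c + d
    swap
    · obtain ⟨x, hx, hle⟩ := ih a (b - 1) c d (by omega) (by omega) (by omega) (by omega) (by omega)
      exact ⟨x, hx, hle.trans (vec_le le_rfl (by omega) le_rfl le_rfl)⟩
    by_cases m2 : c = 0 ∨ s = a + c ∨ s = b + c + d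
    swap
    · obtain ⟨x, hx, hle⟩ := ih a b (c - 1) d (by omega) (by omega) (by omega) (by omega) (by omega)
      exact ⟨x, hx, hle.trans (vec_le le_rfl le_rfl (by omega) le_rfl)⟩
    by_cases m3 : d = 0 ∨ s = b + c + d
    swap
    · obtain ⟨x, hx, hle⟩ := ih a b c (d - 1) (by omega) (by omega) (by omega) (by omega) (by omega)
      exact ⟨x, hx, hle.trans (vec_le le_rfl le_rfl le_rfl (by omega))⟩
    obtain ⟨x, hx, he⟩ := E_minimal_surj a b c d rfl h1 h2 h3 (by omega) m0 m1 m2 m3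
    exact ⟨x, hx, he.le⟩

lemma card_T_even (k : ℕ) : ((T (2 * (k + 1))).card : ℤ) = 2 * ((k : ℤ) + 1) ^ 2 - 1 := by
  rw [T, Finset.card_sigma]
  simp only [Finset.card_range, show 2 * (k + 1) / 2 = k + 1 by omega,
    show 2 * (k + 1) % 2 = 0 by omega]
  induction k with
  | zero => simp
  | succ k ih =>
    rw [Finset.sum_range_succ, Nat.cast_add, ih, if_neg (by omega)]
    push_cast; ring

lemma card_T_odd (k : ℕ) : ((T (2 * k + 1)).card : ℤ) = 2 * (k : ℤ) ^ 2 + 2 * k := by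
  rw [T, Finset.card_sigma]
  simp only [Finset.card_range, show (2 * k + 1) / 2 = k by omega,
    show (2 * k + 1) % 2 = 1 by omega]
  induction k with
  | zero => simp
  | succ k ih =>
    rw [Finset.sum_range_succ, Nat.cast_add, ih, if_neg (by omega)]
    push_cast; ring

lemma upper (s : ℕ) : ∃ S : Finset (MvPolynomial (Fin 4) 𝕜), S.card = (T s).card ∧
    (↑S : Set (MvPolynomial (Fin 4) 𝕜)) ⊆ (symbolicPower (I 𝕜) s : Set _) ∧
    I 𝕜 ^ s ⊔ Ideal.span (↑S : Set (MvPolynomial (Fin 4) 𝕜)) = symbolicPower (I 𝕜) s := by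
  classical
  have hsub : (↑((T s).image fun x => monomial (E s x) (1 : 𝕜)) : Set (MvPolynomial (Fin 4) 𝕜)) ⊆
      (symbolicPower (I 𝕜) s : Set _) := by
    intro f hf
    rw [Finset.mem_coe, Finset.mem_image] at hf
    obtain ⟨x, hx, rfl⟩ := hf
    rw [SetLike.mem_coe, mem_symb]
    intro e he
    have : e = E s x := by
      have := support_monomial_subset he
      simpa using this
    rw [this]; exact (E_spec hx).1
  refine ⟨(T s).image fun x => monomial (E s x) (1 : 𝕜), ?_, hsub, ?_⟩
  · apply Finset.card_image_of_injOn
    intro x hx y hy h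
    exact E_inj hx hy (monomial_left_injective one_ne_zero h)
  · apply le_antisymm
    · refine sup_le ?_ (Ideal.span_le.2 hsub)
      intro f hf
      rw [mem_symb]
      exact fun e he => (mem_I_pow.1 hf e he).1
    · intro f hf
      rw [mem_symb] at hf
      rw [← support_sum_monomial_coeff f]
      refine Ideal.sum_mem _ fun e he => ?_
      by_cases h4 : 2 * s ≤ e 0 + e 1 + e 2 + e 3
      · exact Ideal.mem_sup_left (monomial_mem _ (hf e he) h4)
      · apply Ideal.mem_sup_right
        obtain ⟨h1, h2, h3⟩ := hf e he
        obtain ⟨x, hx, hle⟩ := E_cover s _ (e 0) (e 1) (e 2) (e 3) rfl h1 h2 h3 (by omega)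
        rw [← vec_eta] at hle
        have : (monomial e (coeff e f) : MvPolynomial (Fin 4) 𝕜)
            = monomial (e - E s x) (coeff e f) * monomial (E s x) 1 := by
          rw [monomial_mul, mul_one, tsub_add_cancel_of_le hle]
        rw [this]
        refine Ideal.mul_mem_left _ _ (Ideal.subset_span ?_)
        exact Finset.mem_coe.2 (Finset.mem_image_of_mem _ hx)

lemma coeff_mul_min {s : ℕ} {x : (_ : ℕ) × ℕ} (hx : x ∈ T s) (r g : MvPolynomial (Fin 4) 𝕜)
    (hg : g ∈ symbolicPower (I 𝕜) s) :
    coeff (E s x) (r * g) = coeff 0 r * coeff (E s x) g := by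
  classical
  rw [coeff_mul, Finset.sum_eq_single (0, E s x)]
  · rintro ⟨a, b⟩ hab hne
    rw [Finset.HasAntidiagonal.mem_antidiagonal] at hab
    simp only at hab ⊢
    by_contra hc
    have hb : coeff b g ≠ 0 := right_ne_zero_of_mul hc
    have hbE := (E_spec hx).2.2 b (hab ▸ le_add_self) (mem_symb.1 hg b (mem_support_iff.2 hb))
    subst hbE
    apply hne
    have : a = 0 := by simpa using hab
    rw [this]
  · intro h; exact absurd (by simp) h

/-- Coefficients at the minimal exponents. -/
def L (𝕜 : Type) [Field 𝕜] (s : ℕ) : MvPolynomial (Fin 4) 𝕜 →ₗ[𝕜] (T s → 𝕜) :=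
  LinearMap.pi fun x => lcoeff 𝕜 (E s x.1)

lemma L_apply (s : ℕ) (f : MvPolynomial (Fin 4) 𝕜) (x : T s) :
    L 𝕜 s f x = coeff (E s x.1) f := rfl

lemma lower (s : ℕ) (S : Finset (MvPolynomial (Fin 4) 𝕜))
    (hS : (↑S : Set (MvPolynomial (Fin 4) 𝕜)) ⊆ (symbolicPower (I 𝕜) s : Set _))
    (h : I 𝕜 ^ s ⊔ Ideal.span (↑S : Set (MvPolynomial (Fin 4) 𝕜)) = symbolicPower (I 𝕜) s) :
    (T s).card ≤ S.card := by
  classical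
  have h1 : ∀ f ∈ I 𝕜 ^ s, L 𝕜 s f = 0 := by
    intro f hf
    ext x
    rw [L_apply]
    by_contra hne
    have := (mem_I_pow.1 hf _ (mem_support_iff.2 hne)).2
    have := (E_spec x.2).2.1
    omega
  have h2 : ∀ f ∈ Ideal.span (↑S : Set (MvPolynomial (Fin 4) 𝕜)),
      L 𝕜 s f ∈ Submodule.span 𝕜 (↑(S.image (L 𝕜 s)) : Set (T s → 𝕜)) := by
    intro f hf
    have hle : Ideal.span (↑S : Set (MvPolynomial (Fin 4) 𝕜)) ≤ symbolicPower (I 𝕜) s :=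
      Ideal.span_le.2 hS
    induction hf using Submodule.span_induction with
    | mem g hg => exact Submodule.subset_span (Finset.mem_coe.2 (Finset.mem_image_of_mem _ hg))
    | zero => simp
    | add a b _ _ ha hb => rw [map_add]; exact add_mem ha hb
    | smul r g hg ih =>
      have : L 𝕜 s (r • g) = coeff 0 r • L 𝕜 s g := by
        ext x
        rw [L_apply, Pi.smul_apply, L_apply, smul_eq_mul, smul_eq_mul,
          coeff_mul_min x.2 r g (hle hg)]
      rw [this]
      exact Submodule.smul_mem _ _ ih
  have h3 : Submodule.span 𝕜 (↑(S.image (L 𝕜 s)) : Set (T s → 𝕜)) = ⊤ := by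
    rw [eq_top_iff, ← (Pi.basisFun 𝕜 (T s)).span_eq, Submodule.span_le]
    rintro _ ⟨x, rfl⟩
    have hx : (monomial (E s x.1) (1 : 𝕜)) ∈ symbolicPower (I 𝕜) s := by
      rw [mem_symb]
      intro e he
      have : e = E s x.1 := by
        have := support_monomial_subset he
        simpa using this
      rw [this]; exact (E_spec x.2).1
    rw [← h] at hx
    obtain ⟨a, ha, b, hb, hab⟩ := Submodule.mem_sup.1 hx
    have hL : L 𝕜 s (monomial (E s x.1) (1 : 𝕜)) = Pi.basisFun 𝕜 (T s) x := by
      ext y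
      rw [L_apply, coeff_monomial, Pi.basisFun_apply, Pi.single_apply]
      by_cases hxy : y = x
      · simp [hxy]
      · rw [if_neg hxy, if_neg]
        intro hE
        exact hxy (Subtype.ext (E_inj x.2 y.2 hE).symm)
    rw [SetLike.mem_coe, ← hL, ← hab, map_add, h1 a ha, zero_add]
    exact h2 b hb
  have h4 := finrank_span_finset_le_card (R := 𝕜) (S.image (L 𝕜 s))
  rw [Set.finrank, h3, finrank_top, Module.finrank_fintype_fun_eq_card, Fintype.card_coe] at h4
  exact h4.trans Finset.card_image_le

lemma sdefect_eq (s : ℕ) : sdefect (I 𝕜) s = (T s).card := by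
  apply le_antisymm
  · exact Nat.sInf_le (upper s)
  · refine le_csInf ⟨_, upper s⟩ ?_
    rintro m ⟨S, rfl, hS, h⟩
    exact lower s S hS h

end TriPend

/-- the symbolic defects of the edge ideal of a triangle with one pendant edge
are given by `sdefect(I,2k) = 2k² - 1` and `sdefect(I,2k+1) = 2k² + 2k`. -/
theorem sdefect_triangle_pendant (𝕜 : Type) [Field 𝕜] (s : ℕ) (hs : 1 ≤ s) (k : ℕ) :
    (s = 2 * k →
      (sdefect (edgeIdeal 𝕜 trianglePendant) s : ℤ) = 2 * k ^ 2 - 1) ∧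
    (s = 2 * k + 1 →
      (sdefect (edgeIdeal 𝕜 trianglePendant) s : ℤ) = 2 * k ^ 2 + 2 * k) := by
  constructor
  · rintro rfl
    obtain ⟨m, rfl⟩ : ∃ m, k = m + 1 := ⟨k - 1, by omega⟩
    rw [TriPend.sdefect_eq, TriPend.card_T_even]
    push_cast; ring
  · rintro rfl
    rw [TriPend.sdefect_eq, TriPend.card_T_odd]

end
end
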